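/- Let l ≥ 1 be an integer and let f be a modular unit that is invariant under the principal congruence subgroup Γ(l) and such that, for some rational number s, f(z)·exp(−2πisz) = Σ_{n≥0} c_n·exp(2πinz) for all z ∈ ℍ with rational coefficients c_n. Then f ∈ ℚ*·E(2l), i.e. there exist a nonzero rational number γ and integers m_1, …, m_l such that f = γ·∏_{r=1}^{l} [r]_{2l}^{m_r}; moreover, if l is odd, then f ∈ ℚ*·E(l). -/

import Mathlib

open Complex Filter Topology UpperHalfPlane Matrix MatrixGroups
open scoped Real Manifold

noncomputable section

/-- `B(x) = y² − y + 1/6` where `y` is the fractional part of `x`. -/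
def bern (x : ℝ) : ℝ := Int.fract x ^ 2 - Int.fract x + 1 / 6

/-- The modular unit `[r]_l`. -/
def rl (l r : ℤ) : UpperHalfPlane → ℂ := fun z =>
  Complex.exp (2 * (π : ℂ) * Complex.I *
      ((-((l : ℝ) * bern ((r : ℝ) / (l : ℝ)) / 2) : ℝ) : ℂ) * (z : ℂ)) *
    (∏' n : {n : ℤ // 0 < n ∧ n ≡ r [ZMOD l]},
      (1 - Complex.exp (2 * (π : ℂ) * Complex.I * ((n : ℤ) : ℂ) * (z : ℂ)))⁻¹) *
    (∏' n : {n : ℤ // 0 < n ∧ n ≡ -r [ZMOD l]},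
      (1 - Complex.exp (2 * (π : ℂ) * Complex.I * ((n : ℤ) : ℂ) * (z : ℂ)))⁻¹)

/-- A modular unit: holomorphic, nowhere vanishing on `ℍ`, invariant under some principal
congruence subgroup, and meromorphic at all cusps. -/
def IsModularUnit (f : UpperHalfPlane → ℂ) : Prop :=
  MDifferentiable 𝓘(ℂ) 𝓘(ℂ) f ∧
  (∀ z, f z ≠ 0) ∧
  (∃ N : ℕ, 0 < N ∧ ∀ A ∈ CongruenceSubgroup.Gamma N, ∀ z : UpperHalfPlane, f (A • z) = f z) ∧
  (∀ A : SL(2, ℤ), ∃ (α : ℝ) (κ : ℂ), κ ≠ 0 ∧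
    Filter.Tendsto
      (fun z : UpperHalfPlane =>
        f (A • z) * Complex.exp (-(2 * (π : ℂ) * Complex.I * (α : ℂ) * (z : ℂ))))
      UpperHalfPlane.atImInfty (nhds κ))

/-- Membership in the group `E(l)` generated by the `[r]_l`, `1 ≤ r ≤ ⌊l/2⌋`, i.e. being a
product of integral powers of the generators. -/
def MemE (l : ℕ) (f : UpperHalfPlane → ℂ) : Prop :=
  ∃ m : ℕ → ℤ, ∀ z, f z = ∏ r ∈ Finset.Icc 1 (l / 2), rl l r z ^ m r


namespace SU

/-- `p` evaluates at `Q` to `v`. -/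
def Ev (p : PowerSeries ℂ) (Q v : ℂ) : Prop := HasSum (fun k => PowerSeries.coeff k p * Q ^ k) v

lemma Ev.add {p p' : PowerSeries ℂ} {Q v v' : ℂ} (h : Ev p Q v) (h' : Ev p' Q v') :
    Ev (p + p') Q (v + v') := by
  have := HasSum.add h h'
  refine this.congr_fun ?_ |> id
  intro k; simp [add_mul]

lemma Ev.mul {p p' : PowerSeries ℂ} {Q v v' : ℂ} (h : Ev p Q v) (h' : Ev p' Q v') :
    Ev (p * p') Q (v * v') := by
  have hs := h.summable.norm
  have hs' := h'.summable.norm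
  have h1 := summable_norm_sum_mul_antidiagonal_of_summable_norm hs hs'
  have h2 := tsum_mul_tsum_eq_tsum_sum_antidiagonal_of_summable_norm hs hs'
  rw [h.tsum_eq, h'.tsum_eq] at h2
  have h3 := h1.of_norm.hasSum
  rw [← h2] at h3
  refine h3.congr_fun ?_ |> id
  intro k
  rw [PowerSeries.coeff_mul, Finset.sum_mul]
  refine Finset.sum_congr rfl fun x hx => ?_
  rw [← Finset.HasAntidiagonal.mem_antidiagonal.mp hx, pow_add]; ring

lemma Ev.C (a Q : ℂ) : Ev (PowerSeries.C a) Q a := by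
  unfold Ev
  convert hasSum_ite_eq 0 a using 2 with k
  rw [PowerSeries.coeff_C]; split_ifs with h <;> simp [h]

lemma Ev.one (Q : ℂ) : Ev 1 Q 1 := by simpa using Ev.C 1 Q
lemma Ev.zero (Q : ℂ) : Ev 0 Q 0 := by simpa using Ev.C 0 Q

lemma Ev.X_pow (Q : ℂ) (m : ℕ) : Ev (PowerSeries.X ^ m) Q (Q ^ m) := by
  unfold Ev
  convert hasSum_ite_eq m (Q ^ m) using 2 with k
  rw [PowerSeries.coeff_X_pow]; split_ifs with h <;> simp [h]

lemma Ev.neg {p : PowerSeries ℂ} {Q v : ℂ} (h : Ev p Q v) : Ev (-p) Q (-v) := by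
  have := HasSum.neg h
  unfold Ev
  simpa using this

lemma Ev.sub {p p' : PowerSeries ℂ} {Q v v' : ℂ} (h : Ev p Q v) (h' : Ev p' Q v') :
    Ev (p - p') Q (v - v') := by
  simpa [sub_eq_add_neg] using h.add h'.neg

lemma Ev.prod {ι : Type*} (s : Finset ι) {p : ι → PowerSeries ℂ} {Q : ℂ} {v : ι → ℂ}
    (h : ∀ i ∈ s, Ev (p i) Q (v i)) : Ev (∏ i ∈ s, p i) Q (∏ i ∈ s, v i) := by
  classical
  induction s using Finset.induction_on with
  | empty => simpa using Ev.one Q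
  | insert a s ha ih =>
    rw [Finset.prod_insert ha, Finset.prod_insert ha]
    exact (h a (by simp)).mul (ih fun i hi => h i (by simp [hi]))

lemma Ev.sum {ι : Type*} (s : Finset ι) {p : ι → PowerSeries ℂ} {Q : ℂ} {v : ι → ℂ}
    (h : ∀ i ∈ s, Ev (p i) Q (v i)) : Ev (∑ i ∈ s, p i) Q (∑ i ∈ s, v i) := by
  classical
  induction s using Finset.induction_on with
  | empty => simpa using Ev.zero Q
  | insert a s ha ih =>
    rw [Finset.sum_insert ha, Finset.sum_insert ha]
    exact (h a (by simp)).add (ih fun i hi => h i (by simp [hi]))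

lemma Ev.pow {p : PowerSeries ℂ} {Q v : ℂ} (h : Ev p Q v) (n : ℕ) : Ev (p ^ n) Q (v ^ n) := by
  simpa using Ev.prod (Finset.range n) (p := fun _ => p) (v := fun _ => v) (fun _ _ => h)

section prodPS
variable {R : Type*} [CommRing R]

/-- finite partial product -/
def FN (c : ℕ → R) (N : ℕ) : PowerSeries R :=
  ∏ n ∈ Finset.range N, (1 - PowerSeries.C (c n) * PowerSeries.X ^ (n + 1))

/-- the formal infinite product `∏ (1 - c n X^(n+1))` -/
def prodPS (c : ℕ → R) : PowerSeries R := PowerSeries.mk fun k => PowerSeries.coeff k (FN c k)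

lemma FN_succ (c : ℕ → R) (N : ℕ) :
    FN c (N + 1) = FN c N - PowerSeries.C (c N) * (FN c N * PowerSeries.X ^ (N + 1)) := by
  rw [FN, Finset.prod_range_succ, ← FN]; ring

lemma coeff_FN_succ (c : ℕ → R) (N k : ℕ) :
    PowerSeries.coeff k (FN c (N + 1)) = PowerSeries.coeff k (FN c N) -
      c N * (if N + 1 ≤ k then PowerSeries.coeff (k - (N + 1)) (FN c N) else 0) := by
  rw [FN_succ, map_sub, PowerSeries.coeff_C_mul, PowerSeries.coeff_mul_X_pow']

lemma coeff_FN_stable (c : ℕ → R) {N k : ℕ} (h : k ≤ N) :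
    PowerSeries.coeff k (FN c N) = PowerSeries.coeff k (prodPS c) := by
  rw [prodPS, PowerSeries.coeff_mk]
  induction N, h using Nat.le_induction with
  | base => rfl
  | succ N hN ih => rw [coeff_FN_succ, if_neg (by omega), ih]; simp

lemma constantCoeff_prodPS (c : ℕ → R) : PowerSeries.constantCoeff (prodPS c) = 1 := by
  rw [← PowerSeries.coeff_zero_eq_constantCoeff_apply, prodPS, PowerSeries.coeff_mk]
  simp [FN]

lemma map_prodPS {R' : Type*} [CommRing R'] (σ : R →+* R') (c : ℕ → R) :
    PowerSeries.map σ (prodPS c) = prodPS (fun n => σ (c n)) := by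
  ext k
  rw [PowerSeries.coeff_map, prodPS, prodPS, PowerSeries.coeff_mk, PowerSeries.coeff_mk,
    ← PowerSeries.coeff_map]
  congr 1
  simp [FN, map_prod]

end prodPS

lemma norm_coeff_FN_le {c : ℕ → ℂ} (hc : ∀ n, ‖c n‖ ≤ 1) {ρ : ℝ} (hρ : 0 ≤ ρ) (N k : ℕ) :
    ‖PowerSeries.coeff k (FN c N)‖ * ρ ^ k ≤ ∏ n ∈ Finset.range N, (1 + ρ ^ (n + 1)) := by
  induction N generalizing k with
  | zero =>
    simp only [FN, Finset.range_zero, Finset.prod_empty, PowerSeries.coeff_one]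
    split_ifs with h <;> simp [h]
  | succ N ih =>
    rw [coeff_FN_succ, Finset.prod_range_succ, mul_add, mul_one]
    set P := ∏ n ∈ Finset.range N, (1 + ρ ^ (n + 1))
    have hP : 0 ≤ P := Finset.prod_nonneg fun _ _ => by positivity
    have h1 := ih k
    refine (mul_le_mul_of_nonneg_right (norm_sub_le _ _) (by positivity)).trans ?_
    rw [add_mul]
    refine add_le_add h1 ?_
    split_ifs with h
    · have h2 := ih (k - (N + 1))
      have : ρ ^ k = ρ ^ (k - (N + 1)) * ρ ^ (N + 1) := by rw [← pow_add]; congr 1; omega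
      rw [norm_mul, this, ← mul_assoc]
      refine mul_le_mul_of_nonneg_right ?_ (by positivity)
      refine le_trans ?_ h2
      rw [mul_assoc]
      exact mul_le_of_le_one_left (by positivity) (hc N)
    · simp; positivity

lemma multipliable_c {c : ℕ → ℂ} (hc : ∀ n, ‖c n‖ ≤ 1) {Q : ℂ} (hQ : ‖Q‖ < 1) :
    Multipliable (fun n => 1 - c n * Q ^ (n + 1)) := by
  simp_rw [sub_eq_add_neg]
  apply multipliable_one_add_of_summable
  refine Summable.of_nonneg_of_le (fun _ => norm_nonneg _) (fun n => ?_)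
    ((summable_nat_add_iff 1).mpr (summable_geometric_of_lt_one (norm_nonneg Q) hQ))
  rw [norm_neg, norm_mul, norm_pow]
  exact mul_le_of_le_one_left (by positivity) (hc n)

lemma tprod_c_ne_zero {c : ℕ → ℂ} (hc : ∀ n, ‖c n‖ ≤ 1) {Q : ℂ} (hQ : ‖Q‖ < 1) :
    ∏' n, (1 - c n * Q ^ (n + 1)) ≠ 0 := by
  simp_rw [sub_eq_add_neg]
  have hle : ∀ n, ‖c n * Q ^ (n + 1)‖ ≤ ‖Q‖ ^ (n + 1) := fun n => by
    rw [norm_mul, norm_pow]; exact mul_le_of_le_one_left (by positivity) (hc n)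
  refine tprod_one_add_ne_zero_of_summable (fun n h0 => ?_) ?_
  · have h1 : c n * Q ^ (n + 1) = 1 := by linear_combination -h0
    have h2 := hle n
    rw [h1, norm_one] at h2
    have := pow_lt_one₀ (norm_nonneg Q) hQ (Nat.succ_ne_zero n)
    simp at this; linarith
  · refine Summable.of_nonneg_of_le (fun _ => norm_nonneg _) (fun n => ?_)
      ((summable_nat_add_iff 1).mpr (summable_geometric_of_lt_one (norm_nonneg Q) hQ))
    rw [norm_neg]; exact hle n

lemma Ev_prodPS {c : ℕ → ℂ} (hc : ∀ n, ‖c n‖ ≤ 1) {Q : ℂ} (hQ : ‖Q‖ < 1) :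
    Ev (prodPS c) Q (∏' n, (1 - c n * Q ^ (n + 1))) := by
  obtain ⟨ρ, hρ1, hρ2⟩ := exists_between hQ
  have hρ0 : 0 < ρ := (norm_nonneg _).trans_lt hρ1
  set B : ℝ := Real.exp (∑' n : ℕ, ρ ^ (n + 1)) with hB
  have hsum : Summable fun n : ℕ => ρ ^ (n + 1) :=
    (summable_nat_add_iff 1).mpr (summable_geometric_of_lt_one hρ0.le hρ2)
  have hbound : ∀ N k, ‖PowerSeries.coeff k (FN c N) * Q ^ k‖ ≤ B * (‖Q‖ / ρ) ^ k := by
    intro N k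
    have h1 := norm_coeff_FN_le hc hρ0.le N k
    have h2 : ∏ n ∈ Finset.range N, (1 + ρ ^ (n + 1)) ≤ B := by
      refine (Real.prod_one_add_le_exp_sum _ fun n => by positivity).trans ?_
      exact Real.exp_le_exp.mpr (hsum.sum_le_tsum _ fun n _ => by positivity)
    rw [norm_mul, norm_pow, div_pow]
    have h3 : ‖PowerSeries.coeff k (FN c N)‖ ≤ B / ρ ^ k := by
      rw [le_div_iff₀ (by positivity)]; exact h1.trans h2
    calc _ ≤ B / ρ ^ k * ‖Q‖ ^ k := mul_le_mul_of_nonneg_right h3 (by positivity)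
      _ = _ := by ring
  have hsb : Summable fun k : ℕ => B * (‖Q‖ / ρ) ^ k :=
    (summable_geometric_of_lt_one (by positivity) ((div_lt_one hρ0).mpr hρ1)).mul_left B
  have hlim : ∀ k, Tendsto (fun N => PowerSeries.coeff k (FN c N) * Q ^ k) atTop
      (𝓝 (PowerSeries.coeff k (prodPS c) * Q ^ k)) := by
    intro k
    refine tendsto_const_nhds.congr' ?_
    filter_upwards [eventually_ge_atTop k] with N hN
    rw [coeff_FN_stable c hN]
  have h1 := tendsto_tsum_of_dominated_convergence hsb hlim (Eventually.of_forall fun N k => hbound N k)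
  have hev : ∀ N, ∑' k, PowerSeries.coeff k (FN c N) * Q ^ k =
      ∏ n ∈ Finset.range N, (1 - c n * Q ^ (n + 1)) := fun N =>
    HasSum.tsum_eq (Ev.prod _ fun n _ => (Ev.one Q).sub ((Ev.C (c n) Q).mul (Ev.X_pow Q (n + 1))))
  simp_rw [hev] at h1
  have h2 := (multipliable_c hc hQ).hasProd.tendsto_prod_nat
  have h3 := tendsto_nhds_unique h1 h2
  have hs : Summable fun k => PowerSeries.coeff k (prodPS c) * Q ^ k := by
    refine Summable.of_norm_bounded hsb fun k => ?_
    rw [← coeff_FN_stable c le_rfl]; exact hbound k k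
  unfold Ev
  rw [← h3]; exact hs.hasSum

/-- exponential `e(x) = exp(2πix)` -/
def ee (x : ℂ) : ℂ := Complex.exp (2 * π * Complex.I * x)

lemma ee_add (x y : ℂ) : ee (x + y) = ee x * ee y := by simp [ee, mul_add, Complex.exp_add]
lemma ee_ne_zero (x : ℂ) : ee x ≠ 0 := Complex.exp_ne_zero _
lemma ee_zero : ee 0 = 1 := by simp [ee]
lemma ee_neg (x : ℂ) : ee (-x) = (ee x)⁻¹ := by rw [ee, ee, ← Complex.exp_neg]; ring_nf
lemma ee_sub (x y : ℂ) : ee (x - y) = ee x / ee y := by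
  rw [sub_eq_add_neg, ee_add, ee_neg, div_eq_mul_inv]
lemma ee_int (n : ℤ) : ee n = 1 := by
  rw [ee, Complex.exp_eq_one_iff]; exact ⟨n, by ring⟩
lemma ee_nat (n : ℕ) : ee n = 1 := by exact_mod_cast ee_int n
lemma ee_pow (x : ℂ) (n : ℕ) : ee x ^ n = ee (n * x) := by
  rw [ee, ee, ← Complex.exp_nat_mul]; ring_nf
lemma ee_zpow (x : ℂ) (n : ℤ) : ee x ^ n = ee (n * x) := by
  rw [ee, ee, ← Complex.exp_int_mul]; ring_nf
lemma norm_ee (x : ℂ) : ‖ee x‖ = Real.exp (-(2 * π * x.im)) := by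
  rw [ee, Complex.norm_exp]
  congr 1
  simp [Complex.mul_re, Complex.mul_im]
lemma ee_eq_one_iff (x : ℂ) : ee x = 1 ↔ ∃ n : ℤ, x = n := by
  rw [ee, Complex.exp_eq_one_iff]
  refine exists_congr fun n => ?_
  rw [show (n : ℂ) * (2 * π * Complex.I) = 2 * π * Complex.I * n by ring]
  exact mul_right_inj' Complex.two_pi_I_ne_zero
lemma differentiable_ee : Differentiable ℂ ee := by unfold ee; fun_prop

/-- local uniformizer -/
def QQ (L : ℕ) (z : ℍ) : ℂ := ee ((z : ℂ) / L)

lemma QQ_ne_zero (L : ℕ) (z : ℍ) : QQ L z ≠ 0 := ee_ne_zero _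

lemma norm_QQ (L : ℕ) (z : ℍ) : ‖QQ L z‖ = Real.exp (-(2 * π * (z.im / L))) := by
  rw [QQ, norm_ee]; simp

lemma norm_QQ_lt {L : ℕ} (hL : 0 < L) (z : ℍ) : ‖QQ L z‖ < 1 := by
  rw [norm_QQ, Real.exp_lt_one_iff]
  have := z.im_pos
  have : (0:ℝ) < L := by exact_mod_cast hL
  have := Real.pi_pos
  rw [neg_lt_zero]; positivity

lemma tendsto_norm_QQ {L : ℕ} (hL : 0 < L) : Tendsto (fun z => ‖QQ L z‖) atImInfty (𝓝 0) := by
  simp_rw [norm_QQ]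
  have hL' : (0:ℝ) < L := by exact_mod_cast hL
  have h0 : Tendsto (fun z : ℍ => z.im) atImInfty atTop := tendsto_comap
  have h1 : Tendsto (fun z : ℍ => 2 * π * (z.im / L)) atImInfty atTop :=
    (h0.atTop_div_const hL').const_mul_atTop (by positivity)
  exact Real.tendsto_exp_neg_atTop_nhds_zero.comp h1

lemma tendsto_QQ {L : ℕ} (hL : 0 < L) : Tendsto (QQ L) atImInfty (𝓝 0) :=
  tendsto_zero_iff_norm_tendsto_zero.mpr (tendsto_norm_QQ hL)

/-- `F` is represented by the power series `p` in `q^(1/L)`. -/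
def HasPS (L : ℕ) (p : PowerSeries ℂ) (F : ℍ → ℂ) : Prop := ∀ z, Ev p (QQ L z) (F z)

lemma Ev.tendsto {L : ℕ} (hL : 0 < L) {p : PowerSeries ℂ} {F : ℍ → ℂ} (h : HasPS L p F) :
    Tendsto F atImInfty (𝓝 (PowerSeries.constantCoeff p)) := by
  have hF : F = fun z => ∑' k, PowerSeries.coeff k p * QQ L z ^ k :=
    funext fun z => (HasSum.tsum_eq (h z)).symm
  obtain ⟨z0⟩ : Nonempty ℍ := inferInstance
  have hs := (h z0).summable.norm
  have h0 : 0 < ‖QQ L z0‖ := norm_pos_iff.mpr (QQ_ne_zero L z0)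
  have hev : ∀ᶠ z in atImInfty, ‖QQ L z‖ < ‖QQ L z0‖ := (tendsto_norm_QQ hL).eventually_lt_const h0
  have hlim : ∀ k, Tendsto (fun z => PowerSeries.coeff k p * QQ L z ^ k) atImInfty
      (𝓝 (if k = 0 then PowerSeries.constantCoeff p else 0)) := by
    intro k
    split_ifs with hk
    · subst hk; simp
    · have := ((tendsto_QQ hL).pow k).const_mul (PowerSeries.coeff k p)
      simpa [zero_pow hk] using this
  have := tendsto_tsum_of_dominated_convergence hs hlim (by
    filter_upwards [hev] with z hz k
    rw [norm_mul, norm_mul, norm_pow, norm_pow]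
    gcongr)
  rw [tsum_ite_eq] at this
  rwa [hF]

lemma HasPS.mul {L : ℕ} {p p' : PowerSeries ℂ} {F F' : ℍ → ℂ} (h : HasPS L p F)
    (h' : HasPS L p' F') : HasPS L (p * p') (fun z => F z * F' z) := fun z => (h z).mul (h' z)
lemma HasPS.add {L : ℕ} {p p' : PowerSeries ℂ} {F F' : ℍ → ℂ} (h : HasPS L p F)
    (h' : HasPS L p' F') : HasPS L (p + p') (fun z => F z + F' z) := fun z => (h z).add (h' z)
lemma HasPS.pow {L : ℕ} {p : PowerSeries ℂ} {F : ℍ → ℂ} (h : HasPS L p F) (n : ℕ) :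
    HasPS L (p ^ n) (fun z => F z ^ n) := fun z => (h z).pow n
lemma HasPS.C {L : ℕ} (a : ℂ) : HasPS L (PowerSeries.C a) (fun _ => a) := fun _ => Ev.C a _
lemma HasPS.X_pow {L : ℕ} (m : ℕ) : HasPS L (PowerSeries.X ^ m) (fun z => QQ L z ^ m) :=
  fun _ => Ev.X_pow _ m
lemma HasPS.prod {L : ℕ} {ι : Type*} (s : Finset ι) {p : ι → PowerSeries ℂ} {F : ι → ℍ → ℂ}
    (h : ∀ i ∈ s, HasPS L (p i) (F i)) : HasPS L (∏ i ∈ s, p i) (fun z => ∏ i ∈ s, F i z) :=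
  fun z => Ev.prod s fun i hi => h i hi z
lemma HasPS.sum {L : ℕ} {ι : Type*} (s : Finset ι) {p : ι → PowerSeries ℂ} {F : ι → ℍ → ℂ}
    (h : ∀ i ∈ s, HasPS L (p i) (F i)) : HasPS L (∑ i ∈ s, p i) (fun z => ∑ i ∈ s, F i z) :=
  fun z => Ev.sum s fun i hi => h i hi z

lemma HasPS.eq_zero {L : ℕ} (hL : 0 < L) {p : PowerSeries ℂ} (h : HasPS L p (fun _ => 0)) :
    p = 0 := by
  ext m
  rw [map_zero]
  induction m using Nat.strong_induction_on with
  | _ m ih =>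
    have hd : p = PowerSeries.X ^ m * PowerSeries.mk (fun k => PowerSeries.coeff (k + m) p) := by
      ext k
      rw [PowerSeries.coeff_X_pow_mul']
      split_ifs with hk
      · rw [PowerSeries.coeff_mk, Nat.sub_add_cancel hk]
      · exact ih k (by omega)
    set p' := PowerSeries.mk (fun k => PowerSeries.coeff (k + m) p) with hp'
    have h' : HasPS L p' (fun _ => 0) := by
      intro z
      have h1 := h z
      unfold Ev at h1 ⊢
      have h2 := (hasSum_nat_add_iff' (f := fun k => PowerSeries.coeff k p * QQ L z ^ k) m).mpr h1
      rw [Finset.sum_eq_zero (fun i hi => by rw [ih i (Finset.mem_range.mp hi), zero_mul]),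
        sub_zero] at h2
      have h3 := h2.mul_right ((QQ L z ^ m)⁻¹)
      rw [zero_mul] at h3
      refine h3.congr_fun ?_ |> id
      intro k
      rw [hp', PowerSeries.coeff_mk, pow_add]
      have := pow_ne_zero m (QQ_ne_zero L z)
      field_simp
    have := tendsto_nhds_unique (Ev.tendsto hL h') tendsto_const_nhds
    rw [← PowerSeries.coeff_zero_eq_constantCoeff_apply, hp', PowerSeries.coeff_mk, zero_add] at this
    exact this

lemma HasPS.unique {L : ℕ} (hL : 0 < L) {p p' : PowerSeries ℂ} {F : ℍ → ℂ} (h : HasPS L p F)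
    (h' : HasPS L p' F) : p = p' := by
  rw [← sub_eq_zero]
  refine HasPS.eq_zero hL fun z => ?_
  simpa using (h z).sub (h' z)

end SU

namespace SU

/-- `∏ (1 - q^(n+1) w)` -/
def pp (q w : ℂ) : ℂ := ∏' n : ℕ, (1 + -(q ^ (n + 1) * w))

lemma summable_pp {q : ℂ} (hq : ‖q‖ < 1) (w : ℂ) : Summable fun n : ℕ => ‖-(q ^ (n + 1) * w)‖ := by
  simp_rw [norm_neg, norm_mul, norm_pow]
  exact (((summable_nat_add_iff 1).mpr (summable_geometric_of_lt_one (norm_nonneg q) hq))).mul_right _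

lemma multipliable_pp {q : ℂ} (hq : ‖q‖ < 1) (w : ℂ) :
    Multipliable fun n : ℕ => (1 + -(q ^ (n + 1) * w)) :=
  multipliable_one_add_of_summable (summable_pp hq w)

lemma pp_rec {q : ℂ} (hq : ‖q‖ < 1) (w : ℂ) : pp q w = (1 - q * w) * pp q (q * w) := by
  unfold pp
  rw [tprod_eq_zero_mul']
  · congr 1
    · ring
    · refine tprod_congr fun n => by ring
  · refine (multipliable_pp hq (q * w)).congr fun n => by ring

lemma pp_zero {q : ℂ} (hq : ‖q‖ < 1) {w : ℂ} (h : pp q w = 0) : ∃ n : ℕ, q ^ (n + 1) * w = 1 := by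
  by_contra! hn
  refine tprod_one_add_ne_zero_of_summable (fun n h0 => hn n ?_) (summable_pp hq w) h
  linear_combination -h0

lemma differentiable_pp {q : ℂ} (hq : ‖q‖ < 1) : Differentiable ℂ (pp q) := by
  have h1 : HasProdLocallyUniformlyOn (fun n w => 1 + -(q ^ (n + 1) * w)) (pp q) Set.univ := by
    apply hasProdLocallyUniformlyOn_of_forall_compact isOpen_univ
    intro K _ hK
    obtain ⟨C, hC⟩ := hK.isBounded.exists_norm_le
    refine (((summable_nat_add_iff 1).mpr (summable_geometric_of_lt_one (norm_nonneg q)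
      hq)).mul_right C).hasProdUniformlyOn_nat_one_add
      hK (.of_forall fun n x hx ↦ ?_) (fun _ ↦ by fun_prop)
    rw [norm_neg, norm_mul, norm_pow]
    exact mul_le_mul_of_nonneg_left (hC x hx) (by positivity)
  rw [← differentiableOn_univ]
  refine h1.differentiableOn (.of_forall fun s ↦ ?_) isOpen_univ
  simpa [Finset.prod_fn] using
    DifferentiableOn.finsetProd (u := s) (s := Set.univ) (𝕜 := ℂ)
      (f := fun n w => 1 + -(q ^ (n + 1) * w)) (fun _ _ ↦ by fun_prop)

lemma pp_ne_zero_one {q : ℂ} (hq : ‖q‖ < 1) : pp q 1 ≠ 0 := by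
  intro h
  obtain ⟨n, hn⟩ := pp_zero hq h
  have h2 : ‖q ^ (n + 1) * 1‖ < 1 := by
    rw [mul_one, norm_pow]; exact pow_lt_one₀ (norm_nonneg q) hq (Nat.succ_ne_zero n)
  rw [hn] at h2; simp at h2

/-- normalised theta -/
def P0 (τ x : ℂ) : ℂ :=
  (ee (-x / 2) - ee (x / 2)) * (pp (ee τ) (ee x) * pp (ee τ) (ee (-x)))

lemma norm_ee_lt {τ : ℂ} (hτ : 0 < τ.im) : ‖ee τ‖ < 1 := by
  rw [norm_ee, Real.exp_lt_one_iff]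
  have := Real.pi_pos
  rw [neg_lt_zero]; positivity

lemma ee_half : ee (1 / 2) = -1 := by
  rw [ee, ← Complex.exp_pi_mul_I]; congr 1; ring

lemma P0_add_one (τ x : ℂ) : P0 τ (x + 1) = -P0 τ x := by
  unfold P0
  have h1 : ee (x + 1) = ee x := by rw [ee_add, show ee 1 = 1 by simpa using ee_int 1, mul_one]
  have h2 : ee (-(x + 1)) = ee (-x) := by rw [ee_neg, ee_neg, h1]
  have h3 : ee ((x + 1) / 2) = - ee (x / 2) := by rw [add_div, ee_add, ee_half]; ring
  have h4 : ee (-(x + 1) / 2) = - ee (-x / 2) := by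
    rw [neg_div, neg_div, ee_neg, ee_neg, h3, inv_neg]
  rw [h1, h2, h3, h4]; ring

lemma P0_neg (τ x : ℂ) : P0 τ (-x) = -P0 τ x := by
  unfold P0; rw [neg_neg]; ring

lemma P0_add_tau {τ : ℂ} (hτ : 0 < τ.im) (x : ℂ) :
    P0 τ (x + τ) = -(ee (-x - τ / 2)) * P0 τ x := by
  have hq := norm_ee_lt hτ
  unfold P0
  have h1 : pp (ee τ) (ee x) = (1 - ee (x + τ)) * pp (ee τ) (ee (x + τ)) := by
    rw [pp_rec hq, ee_add, mul_comm (ee τ)]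
  have h2 : pp (ee τ) (ee (-(x + τ))) = (1 - ee (-x)) * pp (ee τ) (ee (-x)) := by
    rw [pp_rec hq, ← ee_add]; congr 3 <;> ring_nf
  have a1 : ee (-(x + τ) / 2) * (1 - ee (x + τ)) = ee (-(x + τ) / 2) - ee ((x + τ) / 2) := by
    rw [mul_sub, mul_one, ← ee_add]; congr 2; ring
  have a2 : ee (x / 2) * (1 - ee (-x)) = - (ee (-x / 2) - ee (x / 2)) := by
    rw [mul_sub, mul_one, ← ee_add, show x / 2 + -x = -x / 2 by ring]; ring
  have a3 : ee (-(x + τ) / 2) = ee (-x - τ / 2) * ee (x / 2) := by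
    rw [← ee_add]; congr 1; ring
  rw [h1, h2, ← a1]
  have : ee (-(x + τ) / 2) * (1 - ee (x + τ)) * (pp (ee τ) (ee (x + τ)) * ((1 - ee (-x)) *
     pp (ee τ) (ee (-x)))) = ee (-x - τ / 2) * (ee (x / 2) * (1 - ee (-x))) *
      ((1 - ee (x + τ)) * pp (ee τ) (ee (x + τ)) * pp (ee τ) (ee (-x))) := by
    rw [a3]; ring
  rw [this, a2]; ring

lemma P0_sub_tau {τ : ℂ} (hτ : 0 < τ.im) (x : ℂ) :
    P0 τ (x - τ) = -(ee (x - τ / 2)) * P0 τ x := by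
  have h := P0_add_tau hτ (x - τ)
  rw [sub_add_cancel] at h
  rw [h, ← mul_assoc, neg_mul_neg, ← ee_add]
  rw [show x - τ / 2 + (-(x - τ) - τ / 2) = 0 by ring, ee_zero, one_mul]

lemma differentiable_P0 {τ : ℂ} (hτ : 0 < τ.im) : Differentiable ℂ (P0 τ) := by
  have hq := norm_ee_lt hτ
  have h1 := differentiable_pp hq
  have h2 := differentiable_ee
  unfold P0
  refine Differentiable.mul (by fun_prop) (Differentiable.mul ?_ ?_)
  · exact h1.comp h2
  · exact h1.comp (h2.comp differentiable_neg)

lemma P0_zero (τ : ℂ) : P0 τ 0 = 0 := by simp [P0]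

lemma hasDerivAt_P0 {τ : ℂ} (hτ : 0 < τ.im) :
    HasDerivAt (P0 τ) (-(2 * π * Complex.I) * pp (ee τ) 1 ^ 2) 0 := by
  have hq := norm_ee_lt hτ
  have h1 := differentiable_pp hq
  have h2 := differentiable_ee
  have hA : HasDerivAt (fun x : ℂ => ee (-x / 2) - ee (x / 2)) (-(2 * π * Complex.I)) 0 := by
    unfold ee
    have e1 : HasDerivAt (fun x : ℂ => 2 * π * Complex.I * (-x / 2)) (2 * π * Complex.I * (-1 / 2)) 0 :=
      (((hasDerivAt_id (0:ℂ)).fun_neg).div_const 2).const_mul _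
    have e2 : HasDerivAt (fun x : ℂ => 2 * π * Complex.I * (x / 2)) (2 * π * Complex.I * (1 / 2)) 0 :=
      (((hasDerivAt_id (0:ℂ))).div_const 2).const_mul _
    refine (e1.cexp.fun_sub e2.cexp).congr_deriv ?_
    simp; ring
  have hB : DifferentiableAt ℂ (fun x => pp (ee τ) (ee x) * pp (ee τ) (ee (-x))) 0 := by
    refine (Differentiable.mul ?_ ?_) 0
    · exact h1.comp h2
    · exact h1.comp (h2.comp differentiable_neg)
  refine (hA.fun_mul hB.hasDerivAt).congr_deriv ?_
  simp [ee_zero]; ring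

lemma P0_eq_zero {τ : ℂ} (hτ : 0 < τ.im) {x : ℂ} (h : P0 τ x = 0) :
    ∃ m n : ℤ, x = m + n * τ := by
  have hq := norm_ee_lt hτ
  unfold P0 at h
  rcases mul_eq_zero.mp h with h | h
  · have : ee x = 1 := by
      have h1 : ee (x / 2) = ee (-x / 2) := by linear_combination -h
      rw [show x = x / 2 + x / 2 by ring, ee_add]
      nth_rw 1 [h1]
      rw [← ee_add, show -x / 2 + x / 2 = 0 by ring, ee_zero]
    obtain ⟨n, hn⟩ := (ee_eq_one_iff x).mp this
    exact ⟨n, 0, by simp [hn]⟩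
  · rcases mul_eq_zero.mp h with h | h
    · obtain ⟨n, hn⟩ := pp_zero hq h
      rw [ee_pow, ← ee_add] at hn
      obtain ⟨m, hm⟩ := (ee_eq_one_iff _).mp hn
      refine ⟨m, -(n + 1), ?_⟩
      push_cast at hm ⊢
      linear_combination hm
    · obtain ⟨n, hn⟩ := pp_zero hq h
      rw [ee_pow, ← ee_add] at hn
      obtain ⟨m, hm⟩ := (ee_eq_one_iff _).mp hn
      refine ⟨-m, (n + 1), ?_⟩
      push_cast at hm ⊢
      linear_combination -hm

/-- bounded periodic entire functions are constant -/
lemma elliptic_const {τ : ℂ} (hτ : 0 < τ.im) {R : ℂ → ℂ} (hR : Differentiable ℂ R)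
    (h1 : ∀ x, R (x + 1) = R x) (h2 : ∀ x, R (x + τ) = R x) (x : ℂ) : R x = R 0 := by
  have p1 : ∀ (n : ℤ) x, R (x + n) = R x := by
    intro n x
    have : Function.Periodic R 1 := h1
    simpa using this.int_mul n x
  have p2 : ∀ (n : ℤ) x, R (x + n * τ) = R x := by
    intro n x
    have : Function.Periodic R τ := h2
    simpa using this.int_mul n x
  have hK : IsCompact ((fun p : ℝ × ℝ => (p.1 : ℂ) + p.2 * τ) '' (Set.Icc 0 1 ×ˢ Set.Icc 0 1)) :=
    (isCompact_Icc.prod isCompact_Icc).image (by fun_prop)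
  obtain ⟨C, hC⟩ := (hK.image hR.continuous).isBounded.exists_norm_le
  refine hR.apply_eq_apply_of_bounded ?_ x 0
  rw [isBounded_iff_forall_norm_le]
  refine ⟨C, ?_⟩
  rintro _ ⟨y, rfl⟩
  apply hC
  have hτ' := hτ.ne'
  set v : ℝ := y.im / τ.im
  set u : ℝ := y.re - v * τ.re
  have hy : y = u + v * τ := by
    apply Complex.ext
    · simp [u]
    · simp [v]; field_simp
  refine ⟨(Int.fract u : ℝ) + (Int.fract v : ℝ) * τ, ⟨(Int.fract u, Int.fract v), ?_, rfl⟩, ?_⟩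
  · exact ⟨⟨Int.fract_nonneg _, (Int.fract_lt_one _).le⟩, ⟨Int.fract_nonneg _, (Int.fract_lt_one _).le⟩⟩
  · rw [← p2 ⌊v⌋, ← p1 ⌊u⌋]
    congr 1
    rw [hy]
    have e1 : (u : ℂ) = ⌊u⌋ + (Int.fract u : ℝ) := by
      rw [← Complex.ofReal_intCast, ← Complex.ofReal_add, Int.floor_add_fract]
    have e2 : (v : ℂ) = ⌊v⌋ + (Int.fract v : ℝ) := by
      rw [← Complex.ofReal_intCast, ← Complex.ofReal_add, Int.floor_add_fract]
    rw [e1, e2]; ring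

lemma theta_unique {τ : ℂ} (hτ : 0 < τ.im) {D : ℂ → ℂ} (hD : Differentiable ℂ D)
    (h1 : ∀ x, D (x + 1) = -D x) (h2 : ∀ x, D (x + τ) = -(ee (-x - τ / 2)) * D x)
    (h3 : HasDerivAt D 0 0) (h0 : D 0 = 0) : ∀ x, D x = 0 := by
  have hP := differentiable_P0 hτ
  set R : ℂ → ℂ := fun x => D x / P0 τ x with hRdef
  have R1 : ∀ x, R (x + 1) = R x := fun x => by
    simp only [R]; rw [h1, P0_add_one, neg_div_neg_eq]
  have R2 : ∀ x, R (x + τ) = R x := fun x => by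
    simp only [R]; rw [h2, P0_add_tau hτ, mul_div_mul_left _ _ (neg_ne_zero.mpr (ee_ne_zero _))]
  have hd0 : -(2 * π * Complex.I) * pp (ee τ) 1 ^ 2 ≠ 0 :=
    mul_ne_zero (neg_ne_zero.mpr Complex.two_pi_I_ne_zero) (pow_ne_zero _ (pp_ne_zero_one (norm_ee_lt hτ)))
  have hdP := hasDerivAt_P0 hτ
  have hne : ∀ᶠ x in 𝓝[≠] (0:ℂ), P0 τ x ≠ 0 := by
    have := hdP.eventually_ne hd0 (c := 0)
    exact this
  have hcont : ContinuousAt R 0 := by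
    have hR0 : R 0 = 0 := by simp [R, h0]
    rw [continuousAt_iff_punctured_nhds, hR0]
    have a1 := h3.tendsto_slope
    have a2 := hdP.tendsto_slope
    have a3 := a1.div a2 hd0
    rw [zero_div] at a3
    refine a3.congr' ?_
    filter_upwards [self_mem_nhdsWithin] with x hx
    have hx : x ≠ 0 := hx
    simp only [Pi.div_apply, slope_def_field, h0, P0_zero, sub_zero, R]
    rw [div_div_div_cancel_right₀ hx]
  have hdiff0 : DifferentiableAt ℂ R 0 := by
    refine (Complex.analyticAt_of_differentiable_on_punctured_nhds_of_continuousAt ?_ hcont).differentiableAt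
    filter_upwards [hne] with x hx
    exact (hD x).div (hP x) hx
  have hdiff : Differentiable ℂ R := by
    intro x
    by_cases hx : P0 τ x = 0
    · obtain ⟨m, n, rfl⟩ := P0_eq_zero hτ hx
      have p1 : Function.Periodic R 1 := R1
      have p2 : Function.Periodic R τ := R2
      have e : R = fun y => R (y - (m + n * τ)) := by
        funext y
        have a := p1.int_mul m (y - (m + n * τ))
        have b := p2.int_mul n (y - (m + n * τ) + m * 1)
        rw [← a, ← b]; congr 1; ring
      rw [e]
      have : DifferentiableAt ℂ R ((m + n * τ : ℂ) - (m + n * τ)) := by rw [sub_self]; exact hdiff0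
      exact this.fun_comp' (m + n * τ : ℂ) (f := fun y : ℂ => y - (m + n * τ)) (by fun_prop)
    · exact (hD x).div (hP x) hx
  have hz : ∀ x, R x = 0 := fun x => by
    rw [elliptic_const hτ hdiff R1 R2 x]; simp [R, h0]
  -- D = R * P0 off zeros, then by continuity
  intro x
  by_cases hx : P0 τ x = 0
  · obtain ⟨m, n, rfl⟩ := P0_eq_zero hτ hx
    have q1 : ∀ (m : ℤ) x, D x = 0 → D (x + m) = 0 := by
      have up : ∀ x, D x = 0 ↔ D (x + 1) = 0 := fun x => by rw [h1, neg_eq_zero]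
      intro m
      induction m using Int.induction_on with
      | zero => simp
      | succ k ih => intro x hx; have := (up _).mp (ih x hx); push_cast at this ⊢; rwa [← add_assoc]
      | pred k ih =>
        intro x hx; refine (up _).mpr ?_
        have := ih x hx; convert this using 2; push_cast; ring
    have q2 : ∀ (m : ℤ) x, D x = 0 → D (x + m * τ) = 0 := by
      have up : ∀ x, D x = 0 ↔ D (x + τ) = 0 := fun x => by
        rw [h2, mul_eq_zero, neg_eq_zero]; simp [ee_ne_zero]
      intro m
      induction m using Int.induction_on with
      | zero => simp
      | succ k ih =>
        intro x hx; have := (up _).mp (ih x hx); convert this using 2; push_cast; ring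
      | pred k ih =>
        intro x hx; refine (up _).mpr ?_
        have := ih x hx; convert this using 2; push_cast; ring
    have := q2 n _ (q1 m 0 h0)
    simpa using this
  · have := hz x
    simp only [R] at this
    exact (div_eq_zero_iff.mp this).resolve_right hx

lemma inv_im_pos {τ : ℂ} (hτ : 0 < τ.im) : 0 < (-1 / τ).im := by
  have h := UpperHalfPlane.im_inv_neg_coe_pos ⟨τ, hτ⟩
  have e : (-1 / τ) = (-τ)⁻¹ := by rw [neg_div, one_div, inv_neg]
  rw [e]; simpa using h

lemma theta_S {τ : ℂ} (hτ : 0 < τ.im) (x : ℂ) :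
    P0 (-1 / τ) (x / τ) * ee (-(x ^ 2 / (2 * τ))) * (τ * pp (ee τ) 1 ^ 2) =
      pp (ee (-1 / τ)) 1 ^ 2 * P0 τ x := by
  have hτ' := inv_im_pos hτ
  have hτ0 : τ ≠ 0 := by rintro rfl; simp at hτ
  set Ψ : ℂ → ℂ := fun x => P0 (-1 / τ) (x / τ) * ee (-(x ^ 2 / (2 * τ))) with hΨ
  have hΨd : Differentiable ℂ Ψ := by
    have a := differentiable_P0 hτ'
    have b := differentiable_ee
    refine Differentiable.mul ?_ ?_
    · exact a.comp (differentiable_id.div_const τ)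
    · exact b.comp (by fun_prop)
  have h1 : ∀ x, Ψ (x + 1) = -Ψ x := fun x => by
    simp only [Ψ]
    have e : (x + 1) / τ = x / τ - (-1 / τ) := by ring
    rw [e, P0_sub_tau hτ', mul_right_comm, neg_mul, ← ee_add]
    have : x / τ - -1 / τ / 2 + -((x + 1) ^ 2 / (2 * τ)) = -(x ^ 2 / (2 * τ)) := by
      field_simp; ring
    rw [this]; ring
  have h2 : ∀ x, Ψ (x + τ) = -(ee (-x - τ / 2)) * Ψ x := fun x => by
    simp only [Ψ]
    have e : (x + τ) / τ = x / τ + 1 := by field_simp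
    have : -((x + τ) ^ 2 / (2 * τ)) = (-x - τ / 2) + -(x ^ 2 / (2 * τ)) := by
      field_simp; ring
    rw [e, P0_add_one, this, ee_add]; ring
  have hΨ0 : Ψ 0 = 0 := by simp [Ψ, P0_zero]
  have hΨ' : HasDerivAt Ψ (-(2 * π * Complex.I) * pp (ee (-1 / τ)) 1 ^ 2 / τ) 0 := by
    have a := hasDerivAt_P0 hτ'
    have a' : HasDerivAt (P0 (-1 / τ)) (-(2 * π * Complex.I) * pp (ee (-1 / τ)) 1 ^ 2) ((0:ℂ) / τ) := by
      rwa [zero_div]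
    have b : HasDerivAt (fun x : ℂ => P0 (-1 / τ) (x / τ)) (-(2 * π * Complex.I) * pp (ee (-1 / τ)) 1 ^ 2 * (1 / τ)) 0 :=
      HasDerivAt.comp (h := fun x : ℂ => x / τ) (0:ℂ) a' ((hasDerivAt_id (0:ℂ)).div_const τ)
    have c : DifferentiableAt ℂ (fun x : ℂ => ee (-(x ^ 2 / (2 * τ)))) 0 := by
      exact (differentiable_ee.comp (show Differentiable ℂ (fun x : ℂ => -(x ^ 2 / (2 * τ))) by fun_prop)) 0
    refine (b.fun_mul c.hasDerivAt).congr_deriv ?_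
    simp [P0_zero, ee_zero]; ring
  have hP := hasDerivAt_P0 hτ
  have key := theta_unique hτ (D := fun x => Ψ x * (τ * pp (ee τ) 1 ^ 2) - pp (ee (-1 / τ)) 1 ^ 2 * P0 τ x)
    (by
      have := differentiable_P0 hτ
      exact (hΨd.mul_const _).sub (this.const_mul _))
    (fun x => by rw [h1, P0_add_one]; ring)
    (fun x => by rw [h2, P0_add_tau hτ]; ring)
    (by
      refine ((hΨ'.mul_const _).fun_sub (hP.const_mul _)).congr_deriv ?_
      field_simp; ring)
    (by simp [hΨ0, P0_zero]) x
  linear_combination key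

lemma pp_one_eq (q : ℂ) : pp q 1 = ∏' n : ℕ, (1 - q ^ (n + 1)) := by
  unfold pp; exact tprod_congr fun n => by ring

lemma disc_eq (z : ℍ) : ModularForm.discriminant z = ee z * pp (ee z) 1 ^ 24 := by
  rw [ModularForm.discriminant_eq_q_prod, pp_one_eq]
  have h : ∀ n, ModularForm.eta_q n z = ee z ^ (n + 1) := fun n => by
    rw [ModularForm.eta_q_eq_pow]; rfl
  simp_rw [h]
  rw [Multipliable.tprod_pow (ModularForm.multipliable_one_sub_pow (norm_ee_lt z.im_pos))]
  congr 1
  simp [Function.Periodic.qParam, ee]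

lemma theta_S12 (z : ℍ) (x : ℂ) :
    (P0 (-1 / z) (x / z) * ee (-(x ^ 2 / (2 * z)))) ^ 12 * ee (-1 / z) =
      P0 z x ^ 12 * ee z := by
  have h := theta_S z.im_pos x
  have hS := congrFun ModularForm.discriminant_S_invariant z
  rw [ModularForm.SL_slash_apply, UpperHalfPlane.modular_S_smul, disc_eq, disc_eq] at hS
  have hden : denom (ModularGroup.S : SL(2, ℤ)) z = z := by
    rw [ModularGroup.denom_S]
  rw [hden] at hS
  have hz : (z : ℂ) ≠ 0 := z.ne_zero
  have hc : ((UpperHalfPlane.mk (-(z : ℂ))⁻¹ z.im_inv_neg_coe_pos : ℍ) : ℂ) = -1 / z := by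
    show (-(z : ℂ))⁻¹ = _
    rw [neg_div, one_div, inv_neg]
  rw [hc] at hS
  have hz12 : (z : ℂ) ^ (-12 : ℤ) = ((z : ℂ) ^ 12)⁻¹ := by
    rw [_root_.zpow_neg]; norm_cast
  rw [hz12] at hS
  have hp := pp_ne_zero_one (norm_ee_lt z.im_pos)
  have hp : pp (ee z) 1 ≠ 0 := pp_ne_zero_one (norm_ee_lt z.im_pos)
  have hS' : ee (-1 / z) * pp (ee (-1 / (z:ℂ))) 1 ^ 24 = ee z * pp (ee z) 1 ^ 24 * (z : ℂ) ^ 12 := by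
    rw [← hS]; field_simp
  have h12 := congrArg (· ^ 12) h
  simp only [mul_pow] at h12
  have hne : ((z : ℂ) ^ 12 * pp (ee z) 1 ^ 24) ≠ 0 := by positivity
  apply mul_right_cancel₀ hne
  rw [mul_pow]
  linear_combination ee (-1 / (z:ℂ)) * h12 + P0 z x ^ 12 * hS'

end SU

namespace SU
set_option linter.unusedSectionVars false

/-- `12`-th power of the Siegel function -/
def GS (L : ℕ) (a b : ℤ) (z : ℂ) : ℂ :=
  (P0 z ((a * z + b) / L) * ee (a * ((a * z + b) / L) / (2 * L))) ^ 12 * ee z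

variable {L : ℕ} [NeZero L]

lemma Lne : (L : ℂ) ≠ 0 := by exact_mod_cast (NeZero.ne L)
lemma Lpos : 0 < L := Nat.pos_of_ne_zero (NeZero.ne L)

lemma GS_S (a b : ℤ) (z : ℍ) : GS L a b (-1 / z) = GS L b (-a) z := by
  have hz : (z : ℂ) ≠ 0 := z.ne_zero
  have hL : (L : ℂ) ≠ 0 := Lne
  unfold GS
  set y : ℂ := (b * z + (-a : ℤ)) / L with hy
  have h := theta_S12 z y
  have e1 : (a * (-1 / (z : ℂ)) + b) / L = y / z := by
    rw [hy]; push_cast; field_simp; ring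
  have e2 : (a : ℂ) * (y / z) / (2 * L) = -(y ^ 2 / (2 * z)) + b * y / (2 * L) := by
    rw [hy]; push_cast; field_simp; ring
  rw [e1, e2, ee_add, ← mul_assoc, mul_pow, mul_pow (P0 z y)]
  linear_combination (ee (b * y / (2 * L))) ^ 12 * h

lemma P0_tau_add_one (z x : ℂ) : P0 (z + 1) x = P0 z x := by
  unfold P0
  rw [ee_add, show ee 1 = 1 by simpa using ee_int 1, mul_one]

lemma GS_T (a b : ℤ) (z : ℂ) : GS L a b (z + 1) = GS L a (a + b) z := by
  unfold GS
  rw [P0_tau_add_one, ee_add z 1, show ee 1 = 1 by simpa using ee_int 1, mul_one]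
  rw [show (a : ℂ) * (z + 1) + b = a * z + ((a + b : ℤ) : ℂ) by push_cast; ring]

lemma GS_shift_b (a b : ℤ) (z : ℂ) : GS L a (b + L) z ^ L = GS L a b z ^ L := by
  have hL : (L : ℂ) ≠ 0 := Lne
  unfold GS
  have e1 : (a * z + ((b + L : ℤ) : ℂ)) / L = (a * z + b) / L + 1 := by
    push_cast; field_simp; ring
  have e2 : (a : ℂ) * ((a * z + b) / L + 1) / (2 * L) = a * ((a * z + b) / L) / (2 * L) + a / (2 * L) := by
    ring
  rw [e1, e2, P0_add_one, ee_add]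
  have e3 : (ee (a / (2 * L)) ^ 12) ^ L = 1 := by
    rw [ee_pow, ee_pow, show (L : ℂ) * ((12 : ℕ) * (a / (2 * L))) = ((6 * a : ℤ) : ℂ) by
      push_cast; field_simp; ring, ee_int]
  calc _ = ((P0 z ((a * z + b) / L) * ee (a * ((a * z + b) / L) / (2 * L))) ^ 12 * ee z) ^ L *
      (ee (a / (2 * L)) ^ 12) ^ L := by rw [← mul_pow]; congr 1; ring
    _ = _ := by rw [e3, mul_one]

lemma GS_shift_a (a b : ℤ) {z : ℂ} (hz : 0 < z.im) : GS L (a + L) b z ^ L = GS L a b z ^ L := by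
  have hL : (L : ℂ) ≠ 0 := Lne
  unfold GS
  have e1 : (((a + L : ℤ) : ℂ) * z + b) / L = (a * z + b) / L + z := by
    push_cast; field_simp; ring
  rw [e1, P0_add_tau hz]
  set x := (a * z + b) / L with hx
  have e2 : -ee (-x - z / 2) * P0 z x * ee (((a + L : ℤ) : ℂ) * (x + z) / (2 * L)) =
      -(P0 z x * ee (a * x / (2 * L)) * ee (- b / (2 * L))) := by
    have : -x - z / 2 + ((a + L : ℤ) : ℂ) * (x + z) / (2 * L) = a * x / (2 * L) + - b / (2 * L) := by
      rw [hx]; push_cast; field_simp; ring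
    have h2 : ee (-x - z / 2) * ee (((a + L : ℤ) : ℂ) * (x + z) / (2 * L)) =
      ee (a * x / (2 * L)) * ee (- b / (2 * L)) := by rw [← ee_add, ← ee_add, this]
    linear_combination (-P0 z x) * h2
  rw [e2]
  have e3 : (ee (-b / (2 * L)) ^ 12) ^ L = 1 := by
    rw [ee_pow, ee_pow, show (L : ℂ) * ((12 : ℕ) * (-b / (2 * L))) = ((-6 * b : ℤ) : ℂ) by
      push_cast; field_simp; ring, ee_int]
  calc _ = ((P0 z x * ee (a * x / (2 * L))) ^ 12 * ee z) ^ L *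
      (ee (-b / (2 * L)) ^ 12) ^ L := by rw [← mul_pow]; congr 1; ring
    _ = _ := by rw [e3, mul_one]

lemma GS_congr {a b a' b' : ℤ} (ha : (a : ZMod L) = a') (hb : (b : ZMod L) = b') {z : ℂ}
    (hz : 0 < z.im) : GS L a b z ^ L = GS L a' b' z ^ L := by
  have A : ∀ (n : ℤ) (a b : ℤ), GS L (a + n * L) b z ^ L = GS L a b z ^ L := by
    intro n
    induction n using Int.induction_on with
    | zero => simp
    | succ k ih => intro a b; rw [add_mul, one_mul, ← add_assoc, GS_shift_a _ _ hz, ih]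
    | pred k ih =>
      intro a b
      rw [← ih a b, ← GS_shift_a _ _ hz]; congr 2; ring
  have B : ∀ (n : ℤ) (a b : ℤ), GS L a (b + n * L) z ^ L = GS L a b z ^ L := by
    intro n
    induction n using Int.induction_on with
    | zero => simp
    | succ k ih => intro a b; rw [add_mul, one_mul, ← add_assoc, GS_shift_b, ih]
    | pred k ih =>
      intro a b
      rw [← ih a b, ← GS_shift_b]; congr 2; ring
  rw [ZMod.intCast_eq_intCast_iff, Int.modEq_iff_dvd] at ha hb
  obtain ⟨m, hm⟩ := ha
  obtain ⟨n, hn⟩ := hb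
  rw [show a' = a + m * L by linear_combination hm, show b' = b + n * L by linear_combination hn, A, B]

/-- reduction mod `L` of a matrix of `SL(2, ℤ)` -/
def red (L : ℕ) (A : SL(2, ℤ)) : Matrix (Fin 2) (Fin 2) (ZMod L) :=
  (A : Matrix (Fin 2) (Fin 2) ℤ).map (Int.cast : ℤ → ZMod L)

lemma red_mul (A B : SL(2, ℤ)) : red L (A * B) = red L A * red L B := by
  have h : ((A * B : SL(2, ℤ)) : Matrix (Fin 2) (Fin 2) ℤ) = A * B := Matrix.SpecialLinearGroup.coe_mul A B
  unfold red
  rw [h]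
  exact Matrix.map_mul (f := Int.castRingHom (ZMod L))

lemma red_one : red L 1 = 1 := by
  have h : ((1 : SL(2, ℤ)) : Matrix (Fin 2) (Fin 2) ℤ) = 1 := Matrix.SpecialLinearGroup.coe_one
  unfold red
  rw [h]
  exact Matrix.map_one _ (by simp) (by simp)

/-- `X_u` for `u ≠ 0` -/
def GG (L : ℕ) (u : Fin 2 → ZMod L) (z : ℂ) : ℂ := GS L (u 0).val (u 1).val z ^ L

lemma GG_eq {u : Fin 2 → ZMod L} {a b : ℤ} (ha : u 0 = a) (hb : u 1 = b) {z : ℂ}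
    (hz : 0 < z.im) : GG L u z = GS L a b z ^ L := by
  unfold GG
  exact GS_congr (by simp [ha]) (by simp [hb]) hz

lemma GG_smul (A : SL(2, ℤ)) : ∀ (u : Fin 2 → ZMod L) (z : ℍ),
    GG L u (A • z : ℍ) = GG L (u ᵥ* red L A) z := by
  have hA : A ∈ Subgroup.closure {ModularGroup.S, ModularGroup.T} := by
    rw [_root_.SpecialLinearGroup.SL2Z_generators]; trivial
  induction hA using Subgroup.closure_induction with
  | mem x hx =>
    intro u z
    rcases hx with rfl | rfl
    · rw [UpperHalfPlane.modular_S_smul]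
      have hc : ((UpperHalfPlane.mk (-(z : ℂ))⁻¹ z.im_inv_neg_coe_pos : ℍ) : ℂ) = -1 / z := by
        show (-(z : ℂ))⁻¹ = _
        rw [neg_div, one_div, inv_neg]
      rw [hc, GG, GS_S]
      symm
      apply GG_eq _ _ z.im_pos
      · simp [red, ModularGroup.S, Matrix.vecMul, dotProduct]
      · simp [red, ModularGroup.S, Matrix.vecMul, dotProduct]
    · have hc : ((ModularGroup.T • z : ℍ) : ℂ) = z + 1 := by
        rw [UpperHalfPlane.modular_T_smul]; simp [add_comm]
      rw [hc, GG, GS_T]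
      symm
      apply GG_eq _ _ z.im_pos
      · simp [red, ModularGroup.T, Matrix.vecMul, dotProduct]
      · simp [red, ModularGroup.T, Matrix.vecMul, dotProduct]
  | one => intro u z; simp [red_one]
  | mul x y _ _ hx hy =>
    intro u z
    rw [mul_smul, hx, hy, red_mul, Matrix.vecMul_vecMul]
  | inv x _ hx =>
    intro u z
    have := hx (u ᵥ* red L x⁻¹) (x⁻¹ • z)
    rw [smul_inv_smul, Matrix.vecMul_vecMul, ← red_mul, inv_mul_cancel, red_one, Matrix.vecMul_one] at this
    exact this.symm

lemma GG_ne_zero {u : Fin 2 → ZMod L} (hu : u ≠ 0) (z : ℍ) : GG L u z ≠ 0 := by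
  have hL : (L : ℂ) ≠ 0 := Lne
  unfold GG GS
  refine pow_ne_zero _ (mul_ne_zero (pow_ne_zero _ (mul_ne_zero (fun h => hu ?_) (ee_ne_zero _))) (ee_ne_zero _))
  obtain ⟨m, n, h⟩ := P0_eq_zero z.im_pos h
  have h' : ((u 0).val : ℂ) * z + (u 1).val = L * (m + n * z) := by
    rw [← h]; push_cast; field_simp
  generalize hA : (u 0).val = a at *
  generalize hB : (u 1).val = b at *
  have him := congrArg Complex.im h'
  simp at him
  have hzim : z.im ≠ 0 := z.im_pos.ne'
  have e1 : (a : ℝ) = L * n := by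
    apply mul_right_cancel₀ hzim
    linear_combination him
  have hre := congrArg Complex.re h'
  simp at hre
  have e2 : (b : ℝ) = L * m := by
    rw [e1] at hre; linear_combination hre
  have e1' : (((u 0).val : ℤ)) = L * n := by rw [hA]; exact_mod_cast e1
  have e2' : (((u 1).val : ℤ)) = L * m := by rw [hB]; exact_mod_cast e2
  funext i
  fin_cases i
  · have := congrArg (Int.cast : ℤ → ZMod L) e1'
    simpa using this
  · have := congrArg (Int.cast : ℤ → ZMod L) e2'
    simpa using this

/-- the functions `X_u` -/
def XX (L : ℕ) (u : Fin 2 → ZMod L) (z : ℍ) : ℂ :=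
  open Classical in if u = 0 then ModularForm.discriminant z ^ L else GG L u z

lemma XX_ne_zero (u : Fin 2 → ZMod L) (z : ℍ) : XX L u z ≠ 0 := by
  unfold XX
  split_ifs with h
  · exact pow_ne_zero _ (ModularForm.discriminant_ne_zero z)
  · exact GG_ne_zero h z

lemma vecMul_red_eq_zero {A : SL(2, ℤ)} {u : Fin 2 → ZMod L} : u ᵥ* red L A = 0 ↔ u = 0 := by
  refine ⟨fun h => ?_, fun h => by rw [h, Matrix.zero_vecMul]⟩
  have := congrArg (fun v => v ᵥ* red L A⁻¹) h
  simpa only [Matrix.vecMul_vecMul, ← red_mul, mul_inv_cancel, red_one, Matrix.vecMul_one,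
    Matrix.zero_vecMul] using this

lemma disc_smul (A : SL(2, ℤ)) (z : ℍ) :
    ModularForm.discriminant (A • z) = denom A z ^ 12 * ModularForm.discriminant z := by
  have h := congrFun (SlashInvariantForm.slash_action_generators_SL2Z
    ModularForm.discriminant_S_invariant ModularForm.discriminant_T_invariant A) z
  rw [ModularForm.SL_slash_apply] at h
  have hd : denom A z ≠ 0 := denom_ne_zero A z
  generalize denom A z = d at h hd ⊢
  rw [← h, show ((-12 : ℤ)) = -((12 : ℕ) : ℤ) by norm_num, _root_.zpow_neg, zpow_natCast]
  generalize ModularForm.discriminant (A • z) = e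
  rw [mul_comm e, ← mul_assoc, mul_inv_cancel₀ (pow_ne_zero _ hd), one_mul]

lemma XX_smul (A : SL(2, ℤ)) (u : Fin 2 → ZMod L) (z : ℍ) :
    XX L u (A • z) = (open Classical in if u = 0 then denom A z ^ (12 * L) else 1) * XX L (u ᵥ* red L A) z := by
  unfold XX
  by_cases hu : u = 0
  · subst hu
    rw [Matrix.zero_vecMul, if_pos rfl, if_pos rfl, disc_smul, mul_pow, pow_mul]; simp
  · rw [if_neg hu, if_neg hu, if_neg (by rwa [vecMul_red_eq_zero]), one_mul, GG_smul]

/-- order of `X_u` at infinity -/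
def ordX (L : ℕ) (u : Fin 2 → ZMod L) : ℤ :=
  6 * ((u 0).val : ℤ) ^ 2 - 6 * (u 0).val * L + (L : ℤ) ^ 2

lemma tprod_reindex (w Q : ℂ) {r : ℕ} (h1 : 1 ≤ r) (h2 : r ≤ L) :
    ∏' n : ℕ, (1 - (if ((n + 1 : ℕ) : ZMod L) = (r : ZMod L) then w else 0) * Q ^ (n + 1)) =
      ∏' j : ℕ, (1 - w * Q ^ (r + L * j)) := by
  have hL : 0 < L := Lpos
  have hinj : Function.Injective (fun j : ℕ => r + L * j - 1) := by
    intro i j h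
    simp only at h
    have : L * i = L * j := by omega
    exact Nat.eq_of_mul_eq_mul_left hL this
  rw [← hinj.tprod_eq]
  · refine tprod_congr fun j => ?_
    rw [show r + L * j - 1 + 1 = r + L * j by omega, if_pos (by simp)]
  · intro n hn
    rw [Function.mem_mulSupport] at hn
    have hc : ((n + 1 : ℕ) : ZMod L) = (r : ZMod L) := by
      by_contra hc; rw [if_neg hc] at hn; simp at hn
    rw [ZMod.natCast_eq_natCast_iff] at hc
    have hle : r ≤ n + 1 := by
      by_contra hlt
      push Not at hlt
      have h3 := (Nat.modEq_iff_dvd' hlt.le).mp hc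
      have := Nat.le_of_dvd (by omega) h3
      omega
    obtain ⟨j, hj⟩ := (Nat.modEq_iff_dvd' hle).mp hc.symm
    exact ⟨j, by simp only; omega⟩

/-- coefficient sequence for the formal products -/
def cc {R : Type*} [CommRing R] {L : ℕ} (a : ZMod L) (w : R) (n : ℕ) : R :=
  if ((n + 1 : ℕ) : ZMod L) = a then w else 0

/-- the constant factor -/
def kap {R : Type*} [CommRing R] {L : ℕ} (ζ : R) (u : Fin 2 → ZMod L) : R :=
  if u 0 = 0 ∧ u 1 ≠ 0 then 1 - ζ ^ (u 1).val else 1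

/-- power series of `Q^(-ord u) X_u`. -/
def YY {R : Type*} [CommRing R] {L : ℕ} (ζ : R) (u : Fin 2 → ZMod L) : PowerSeries R :=
  PowerSeries.C (ζ ^ (6 * ((u 0).val * (u 1).val)) * kap ζ u ^ (12 * L)) *
    (prodPS (cc (u 0) (ζ ^ (u 1).val)) * prodPS (cc (-u 0) (ζ ^ (L - (u 1).val)))) ^ (12 * L)

lemma map_YY {R R' : Type*} [CommRing R] [CommRing R'] (σ : R →+* R') (ζ : R)
    (u : Fin 2 → ZMod L) : PowerSeries.map σ (YY ζ u) = YY (σ ζ) u := by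
  have h : ∀ (a : ZMod L) (w : R), (fun n => σ (cc a w n)) = cc a (σ w) := by
    intro a w; funext n; unfold cc; split_ifs <;> simp
  have hk : σ (kap ζ u) = kap (σ ζ) u := by
    unfold kap; split_ifs <;> simp
  unfold YY
  rw [map_mul, map_pow, map_mul (PowerSeries.map σ) (prodPS _), map_prodPS, map_prodPS, h, h,
    PowerSeries.map_C, map_mul σ, map_pow, map_pow, map_pow, map_pow, hk]

/-- primitive root -/
def zt (L : ℕ) : ℂ := ee (1 / L)

lemma zt_pow (n : ℕ) : zt L ^ n = ee (n / L) := by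
  rw [zt, ee_pow]; congr 1; ring

lemma norm_zt_pow (n : ℕ) : ‖zt L ^ n‖ = 1 := by
  rw [zt_pow, norm_ee]
  rw [show ((n : ℂ) / L) = ((n / L : ℝ) : ℂ) by push_cast; rfl, Complex.ofReal_im]; simp

lemma zt_pow_ne_one {n : ℕ} (h : n < L) (h0 : n ≠ 0) : zt L ^ n ≠ 1 := by
  rw [zt_pow]
  intro h1
  obtain ⟨m, hm⟩ := (ee_eq_one_iff _).mp h1
  have hL : (L : ℂ) ≠ 0 := Lne
  rw [div_eq_iff hL] at hm
  have hm' : (n : ℤ) = m * L := by exact_mod_cast hm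
  have : m = 0 ∨ 1 ≤ m ∨ m ≤ -1 := by omega
  rcases this with rfl | h2 | h2
  · simp at hm'; exact h0 hm'
  · nlinarith
  · nlinarith

lemma zt_primitive : IsPrimitiveRoot (zt L) L := by
  have h := Complex.isPrimitiveRoot_exp L (NeZero.ne L)
  unfold zt ee
  convert h using 2
  ring

lemma kap_ne_zero (u : Fin 2 → ZMod L) : kap (zt L) u ≠ 0 := by
  unfold kap
  split_ifs with h
  · rw [sub_ne_zero]
    refine (zt_pow_ne_one (ZMod.val_lt _) ?_).symm
    rw [Ne, ZMod.val_eq_zero]; exact h.2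
  · exact one_ne_zero

lemma constantCoeff_YY_ne_zero (u : Fin 2 → ZMod L) :
    PowerSeries.constantCoeff (YY (zt L) u) ≠ 0 := by
  unfold YY
  rw [map_mul, map_pow, map_mul _ (prodPS _), constantCoeff_prodPS, constantCoeff_prodPS, PowerSeries.constantCoeff_C]
  simp only [mul_one, one_pow]
  refine mul_ne_zero (pow_ne_zero _ (ee_ne_zero _)) (pow_ne_zero _ (kap_ne_zero u))

lemma norm_cc_le (a : ZMod L) {w : ℂ} (hw : ‖w‖ = 1) (n : ℕ) : ‖cc a w n‖ ≤ 1 := by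
  unfold cc; split_ifs <;> simp [hw]

/-- analytic function represented by `YY` -/
def Yf (L : ℕ) (u : Fin 2 → ZMod L) (z : ℍ) : ℂ :=
  (zt L ^ (6 * ((u 0).val * (u 1).val)) * kap (zt L) u ^ (12 * L)) *
    ((∏' n, (1 - cc (u 0) (zt L ^ (u 1).val) n * QQ L z ^ (n + 1))) *
      ∏' n, (1 - cc (-u 0) (zt L ^ (L - (u 1).val)) n * QQ L z ^ (n + 1))) ^ (12 * L)

lemma hasPS_Yf (u : Fin 2 → ZMod L) : HasPS L (YY (zt L) u) (Yf L u) := by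
  intro z
  refine (Ev.C _ _).mul (Ev.pow (Ev.mul ?_ ?_) _)
  · exact Ev_prodPS (norm_cc_le _ (norm_zt_pow _)) (norm_QQ_lt Lpos z)
  · exact Ev_prodPS (norm_cc_le _ (norm_zt_pow _)) (norm_QQ_lt Lpos z)

lemma Yf_ne_zero (u : Fin 2 → ZMod L) (z : ℍ) : Yf L u z ≠ 0 := by
  unfold Yf
  refine mul_ne_zero (mul_ne_zero (pow_ne_zero _ (ee_ne_zero _)) (pow_ne_zero _ (kap_ne_zero u)))
    (pow_ne_zero _ (mul_ne_zero ?_ ?_))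
  · exact tprod_c_ne_zero (norm_cc_le _ (norm_zt_pow _)) (norm_QQ_lt Lpos z)
  · exact tprod_c_ne_zero (norm_cc_le _ (norm_zt_pow _)) (norm_QQ_lt Lpos z)

end SU

namespace SU
set_option linter.unusedSectionVars false
variable {L : ℕ} [NeZero L]

lemma QQ_pow_L (z : ℍ) : QQ L z ^ L = ee z := by
  have hL : (L : ℂ) ≠ 0 := Lne
  rw [QQ, ee_pow]; congr 1; field_simp

lemma val_cast (a : ZMod L) : ((a.val : ℕ) : ZMod L) = a := by simp

lemma prodA (u : Fin 2 → ZMod L) (hu : u ≠ 0) (z : ℍ) :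
    (1 - QQ L z ^ (u 0).val * zt L ^ (u 1).val) * pp (ee z) (QQ L z ^ (u 0).val * zt L ^ (u 1).val) =
      kap (zt L) u * ∏' n, (1 - cc (u 0) (zt L ^ (u 1).val) n * QQ L z ^ (n + 1)) := by
  have hq : ‖ee z‖ < 1 := norm_ee_lt z.im_pos
  have hQ := QQ_ne_zero L z
  unfold cc
  by_cases h0 : u 0 = 0
  · have h1 : u 1 ≠ 0 := fun h1 => hu (by funext i; fin_cases i <;> assumption)
    have e : (1 - zt L ^ (u 1).val) = kap (zt L) u := by rw [kap, if_pos ⟨h0, h1⟩]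
    rw [h0, ZMod.val_zero, pow_zero, one_mul, e]
    congr 1
    have := tprod_reindex (L := L) (zt L ^ (u 1).val) (QQ L z) (r := L) Lpos le_rfl
    rw [ZMod.natCast_self] at this
    rw [this, pp]
    refine tprod_congr fun n => ?_
    rw [← QQ_pow_L (L := L), ← pow_mul, show L * (n + 1) = L + L * n by ring]; ring
  · have e : kap (zt L) u = 1 := by rw [kap, if_neg (fun h => h0 h.1)]
    have hval : 1 ≤ (u 0).val := Nat.one_le_iff_ne_zero.mpr (by rwa [Ne, ZMod.val_eq_zero])
    rw [e, one_mul]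
    have := tprod_reindex (L := L) (zt L ^ (u 1).val) (QQ L z) (r := (u 0).val) hval (ZMod.val_lt _).le
    rw [val_cast] at this
    rw [this]
    set w := QQ L z ^ (u 0).val * zt L ^ (u 1).val with hw
    have hr := pp_rec hq (w / ee z)
    rw [mul_div_cancel₀ _ (ee_ne_zero _)] at hr
    rw [← hr, pp]
    refine tprod_congr fun n => ?_
    rw [pow_succ, mul_assoc, mul_div_cancel₀ _ (ee_ne_zero _), hw, ← QQ_pow_L (L := L), ← pow_mul, pow_add]
    ring

lemma prodB (u : Fin 2 → ZMod L) (z : ℍ) :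
    pp (ee z) (QQ L z ^ (u 0).val * zt L ^ (u 1).val)⁻¹ =
      ∏' n, (1 - cc (-u 0) (zt L ^ (L - (u 1).val)) n * QQ L z ^ (n + 1)) := by
  have hQ := QQ_ne_zero L z
  have h0 : (u 0).val < L := ZMod.val_lt _
  have h1 : (u 1).val < L := ZMod.val_lt _
  unfold cc
  have := tprod_reindex (L := L) (zt L ^ (L - (u 1).val)) (QQ L z) (r := L - (u 0).val) (by omega) (by omega)
  rw [Nat.cast_sub h0.le, ZMod.natCast_self, val_cast, zero_sub] at this
  rw [this, pp]
  refine tprod_congr fun n => ?_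
  have hz : zt L ^ (L - (u 1).val) = (zt L ^ (u 1).val)⁻¹ := by
    have hzt : zt L ≠ 0 := ee_ne_zero _
    apply eq_inv_of_mul_eq_one_left
    rw [← pow_add, Nat.sub_add_cancel h1.le, zt_primitive.pow_eq_one]
  have hQ2 : QQ L z ^ (L - (u 0).val + L * n) = QQ L z ^ (L * (n + 1)) * (QQ L z ^ (u 0).val)⁻¹ := by
    rw [eq_mul_inv_iff_mul_eq₀ (pow_ne_zero _ hQ), ← pow_add]; congr 1
    rw [mul_add]; omega
  rw [hz, hQ2, mul_inv, ← QQ_pow_L (L := L), ← pow_mul]; ring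

lemma XX_eq (u : Fin 2 → ZMod L) (z : ℍ) : XX L u z = QQ L z ^ ordX L u * Yf L u z := by
  have hL : (L : ℂ) ≠ 0 := Lne
  by_cases hu : u = 0
  · have hp := prodB u z
    have hk : kap (zt L) u = 1 := by rw [kap, if_neg]; simp [hu]
    unfold XX ordX Yf
    rw [if_pos hu, ← hp, hk]
    have h1 : ∏' n, (1 - cc (u 0) (zt L ^ (u 1).val) n * QQ L z ^ (n + 1)) = pp (ee z) 1 := by
      have := prodB (L := L) 0 z
      simp [zt_primitive.pow_eq_one] at this
      rw [hu]; simp [this]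
    rw [h1, disc_eq]
    subst hu
    simp only [Pi.zero_apply, ZMod.val_zero]
    simp only [Nat.cast_zero, mul_zero, pow_zero, one_pow, zero_mul, sub_zero, mul_one, inv_one, one_mul]
    rw [show (6 * 0 ^ 2 + (L:ℤ) ^ 2) = ((L ^ 2 : ℕ) : ℤ) by push_cast; ring, zpow_natCast, mul_pow,
      ← QQ_pow_L (L := L)]
    ring
  · have hA := prodA u hu z
    have hB := prodB u z
    unfold XX
    rw [if_neg hu]
    unfold GG GS Yf
    set a := (u 0).val with ha
    set b := (u 1).val with hb
    set x : ℂ := (((a : ℤ) : ℂ) * z + ((b : ℤ) : ℂ)) / L with hx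
    have hw : ee x = QQ L z ^ a * zt L ^ b := by
      rw [QQ, ee_pow, zt_pow, ← ee_add, hx]; congr 1; push_cast; field_simp
    have hP : P0 z x = ee (-x / 2) * ((1 - ee x) * pp (ee z) (ee x) * pp (ee z) (ee (-x))) := by
      rw [P0, ← mul_assoc, ← mul_assoc, ← mul_assoc, mul_sub, mul_one, ← ee_add,
        show -x / 2 + x = x / 2 by ring]
    rw [ee_neg, hw, hA, hB] at hP
    rw [hP]
    set T1 := ∏' n, (1 - cc (u 0) (zt L ^ b) n * QQ L z ^ (n + 1))
    set T2 := ∏' n, (1 - cc (-u 0) (zt L ^ (L - b)) n * QQ L z ^ (n + 1))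
    have hexp : ((ee (-x / 2) * ee (((a : ℤ) : ℂ) * x / (2 * L))) ^ 12 * ee z) ^ L =
        QQ L z ^ ordX L u * zt L ^ (6 * (a * b)) := by
      rw [QQ, ee_zpow, zt_pow, ← ee_add, ee_pow, ← ee_add, ee_pow, ← ee_add]
      have h6 : ee (-(6 * b : ℤ)) = 1 := by
        have := ee_int (-(6 * b)); push_cast at this ⊢; exact this
      rw [← mul_one (ee (_ + ((6 * (a * b) : ℕ) : ℂ) / L)), ← h6, ← ee_add]
      congr 1
      rw [hx, ordX, ← ha]; push_cast; field_simp; ring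
    calc _ = ((ee (-x / 2) * ee (((a : ℤ) : ℂ) * x / (2 * L))) ^ 12 * ee z) ^ L *
          (kap (zt L) u ^ (12 * L) * (T1 * T2) ^ (12 * L)) := by
          rw [← mul_pow, pow_mul, ← mul_pow]; congr 1; ring
      _ = _ := by rw [hexp]; ring

lemma ordX_eq_of {u v : Fin 2 → ZMod L} (h : u 0 = v 0) : ordX L u = ordX L v := by
  unfold ordX; rw [h]

lemma tendsto_XX (u : Fin 2 → ZMod L) : Tendsto (fun z => XX L u z * QQ L z ^ (-ordX L u)) atImInfty
    (𝓝 (PowerSeries.constantCoeff (YY (zt L) u))) := by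
  refine (Ev.tendsto Lpos (hasPS_Yf u)).congr fun z => ?_
  rw [XX_eq, mul_right_comm, ← zpow_add₀ (QQ_ne_zero L z)]; simp

lemma HasPS.differentiableOn {p : PowerSeries ℂ} {F : ℍ → ℂ} (h : HasPS L p F) :
    MDifferentiable 𝓘(ℂ) 𝓘(ℂ) F := by
  have hd : DifferentiableOn ℂ (fun q => ∑' k, PowerSeries.coeff k p * q ^ k) (Metric.ball 0 1) := by
    intro q hq
    rw [Metric.mem_ball, dist_zero_right] at hq
    obtain ⟨ρ, hρ1, hρ2⟩ := exists_between hq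
    have hρ0 : 0 < ρ := (norm_nonneg _).trans_lt hρ1
    -- choose z with ‖QQ z‖ = ρ
    have hL : (0:ℝ) < L := by exact_mod_cast Lpos (L := L)
    have hlog : Real.log ρ < 0 := Real.log_neg hρ0 hρ2
    have him : 0 < -(Real.log ρ) * L / (2 * π) := by
      have := Real.pi_pos
      apply div_pos (mul_pos (by linarith) hL) (by positivity)
    let z0 : ℍ := ⟨((-(Real.log ρ) * L / (2 * π) : ℝ) : ℂ) * Complex.I, by
      generalize -(Real.log ρ) * L / (2 * π) = y at him
      simpa using him⟩
    have hz0 : ‖QQ L z0‖ = ρ := by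
      rw [norm_QQ]
      have : z0.im = -(Real.log ρ) * L / (2 * π) := by
        show (((-(Real.log ρ) * L / (2 * π) : ℝ) : ℂ) * Complex.I).im = _
        generalize -(Real.log ρ) * L / (2 * π) = y
        simp
      rw [this, show -(2 * π * (-(Real.log ρ) * L / (2 * π) / L)) = Real.log ρ by
        have := Real.pi_pos; field_simp, Real.exp_log hρ0]
    have hs := (h z0).summable.norm
    have hdd := Complex.differentiableOn_tsum_of_summable_norm (F := fun k q => PowerSeries.coeff k p * q ^ k)
      (u := fun k => ‖PowerSeries.coeff k p * QQ L z0 ^ k‖) (U := Metric.ball 0 ρ) hs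
      (fun k => by fun_prop) Metric.isOpen_ball (fun k w hw => by
        rw [Metric.mem_ball, dist_zero_right] at hw
        rw [norm_mul, norm_mul, norm_pow, norm_pow, hz0]; gcongr)
    exact (hdd.differentiableAt (Metric.isOpen_ball.mem_nhds (by simpa using hρ1))).differentiableWithinAt
  rw [UpperHalfPlane.mdifferentiable_iff]
  have hF : ∀ w ∈ {w : ℂ | 0 < w.im}, (F ∘ ofComplex) w = ∑' k, PowerSeries.coeff k p * (ee (w / L)) ^ k := by
    intro w hw
    have hw' : 0 < w.im := hw
    simp only [Function.comp]
    rw [ofComplex_apply_of_im_pos hw']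
    exact (HasSum.tsum_eq (h ⟨w, hw'⟩)).symm
  refine DifferentiableOn.congr ?_ hF
  refine DifferentiableOn.comp (t := Metric.ball 0 1) hd ?_ ?_
  · exact (differentiable_ee.comp (by fun_prop)).differentiableOn
  · intro w hw
    have hw' : 0 < w.im := hw
    have := norm_QQ_lt (L := L) Lpos ⟨w, hw'⟩
    simpa [QQ] using this

lemma mdiff_QQ_zpow (n : ℤ) : MDifferentiable 𝓘(ℂ) 𝓘(ℂ) (fun z => QQ L z ^ n) := by
  rw [UpperHalfPlane.mdifferentiable_iff]
  have hF : ∀ w ∈ {w : ℂ | 0 < w.im}, ((fun z => QQ L z ^ n) ∘ ofComplex) w = ee (n * (w / L)) := by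
    intro w hw
    have hw' : 0 < w.im := hw
    simp only [Function.comp]
    rw [ofComplex_apply_of_im_pos hw', QQ, ee_zpow]
  exact DifferentiableOn.congr (differentiable_ee.comp (by fun_prop)).differentiableOn hF

lemma mdiff_mul {F G : ℍ → ℂ} (hF : MDifferentiable 𝓘(ℂ) 𝓘(ℂ) F)
    (hG : MDifferentiable 𝓘(ℂ) 𝓘(ℂ) G) : MDifferentiable 𝓘(ℂ) 𝓘(ℂ) (fun z => F z * G z) := by
  rw [UpperHalfPlane.mdifferentiable_iff] at *
  exact hF.mul hG

lemma mdiff_zpow {F : ℍ → ℂ} (hF : MDifferentiable 𝓘(ℂ) 𝓘(ℂ) F) (h0 : ∀ z, F z ≠ 0) (n : ℤ) :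
    MDifferentiable 𝓘(ℂ) 𝓘(ℂ) (fun z => F z ^ n) := by
  rw [UpperHalfPlane.mdifferentiable_iff] at *
  exact hF.zpow (Or.inl fun _ _ => h0 _)

lemma mdiff_prod {ι : Type*} (s : Finset ι) {F : ι → ℍ → ℂ} (hF : ∀ i, MDifferentiable 𝓘(ℂ) 𝓘(ℂ) (F i)) :
    MDifferentiable 𝓘(ℂ) 𝓘(ℂ) (fun z => ∏ i ∈ s, F i z) := by
  classical
  induction s using Finset.induction_on with
  | empty => simpa using mdifferentiable_const
  | insert a s ha ih =>
    simp_rw [Finset.prod_insert ha]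
    exact mdiff_mul (hF a) ih

lemma mdiff_XX (u : Fin 2 → ZMod L) : MDifferentiable 𝓘(ℂ) 𝓘(ℂ) (XX L u) := by
  rw [show XX L u = fun z => QQ L z ^ ordX L u * Yf L u z from funext (XX_eq u)]
  exact mdiff_mul (mdiff_QQ_zpow _) (hasPS_Yf u).differentiableOn

end SU

namespace SU
set_option linter.unusedSectionVars false
variable {L : ℕ} [NeZero L]
open scoped ModularForm

/-- order at infinity in the variable `QQ L` -/
def HasOrd (L : ℕ) (F : ℍ → ℂ) (n : ℤ) : Prop :=
  ∃ κ : ℂ, κ ≠ 0 ∧ Tendsto (fun z => F z * QQ L z ^ (-n)) atImInfty (𝓝 κ)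

lemma HasOrd.mul {F G : ℍ → ℂ} {m n : ℤ} (hF : HasOrd L F m) (hG : HasOrd L G n) :
    HasOrd L (fun z => F z * G z) (m + n) := by
  obtain ⟨k, hk, h⟩ := hF
  obtain ⟨k', hk', h'⟩ := hG
  refine ⟨k * k', mul_ne_zero hk hk', (h.mul h').congr fun z => ?_⟩
  rw [neg_add, zpow_add₀ (QQ_ne_zero L z)]; ring

lemma HasOrd.zpow {F : ℍ → ℂ} {m : ℤ} (hF : HasOrd L F m) (n : ℤ) :
    HasOrd L (fun z => F z ^ n) (n * m) := by
  obtain ⟨k, hk, h⟩ := hF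
  refine ⟨k ^ n, zpow_ne_zero _ hk, (h.zpow₀ n (Or.inl hk)).congr fun z => ?_⟩
  rw [mul_zpow, ← _root_.zpow_mul]; congr 2; ring

lemma HasOrd.one : HasOrd L (fun _ => 1) 0 := ⟨1, one_ne_zero, by simp⟩

lemma HasOrd.prod {ι : Type*} (s : Finset ι) {F : ι → ℍ → ℂ} {m : ι → ℤ}
    (h : ∀ i, HasOrd L (F i) (m i)) : HasOrd L (fun z => ∏ i ∈ s, F i z) (∑ i ∈ s, m i) := by
  classical
  induction s using Finset.induction_on with
  | empty => simpa using HasOrd.one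
  | insert a s ha ih =>
    simp_rw [Finset.prod_insert ha, Finset.sum_insert ha]
    exact (h a).mul ih

lemma HasOrd.unique {F : ℍ → ℂ} {m n : ℤ} (hF : HasOrd L F m) (hG : HasOrd L F n) : m = n := by
  have key : ∀ {m n : ℤ}, HasOrd L F m → HasOrd L F n → ¬ m < n := by
    intro m n ⟨k, hk, h⟩ ⟨k', hk', h'⟩ hlt
    have h1 : Tendsto (fun z => (F z * QQ L z ^ (-n)) * QQ L z ^ (n - m).toNat) atImInfty (𝓝 (k' * 0)) := by
      refine h'.mul ?_
      have := (tendsto_QQ (L := L) Lpos).pow (n - m).toNat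
      rwa [zero_pow (by omega)] at this
    have h2 : Tendsto (fun z => (F z * QQ L z ^ (-n)) * QQ L z ^ (n - m).toNat) atImInfty (𝓝 k) := by
      refine h.congr fun z => ?_
      rw [mul_assoc, ← zpow_natCast, ← zpow_add₀ (QQ_ne_zero L z)]
      congr 2; omega
    rw [mul_zero] at h1
    exact hk (tendsto_nhds_unique h2 h1)
  have := key hF hG
  have := key hG hF
  omega

lemma hasOrd_XX (u : Fin 2 → ZMod L) : HasOrd L (XX L u) (ordX L u) :=
  ⟨_, constantCoeff_YY_ne_zero u, tendsto_XX u⟩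

lemma HasOrd.congr {F G : ℍ → ℂ} {m n : ℤ} (hF : HasOrd L F m) (h : ∀ z, F z = G z) (hmn : m = n) :
    HasOrd L G n := by
  obtain rfl : F = G := funext h
  exact hmn ▸ hF

lemma HasOrd.bdd {F : ℍ → ℂ} (hF : HasOrd L F 0) : IsBoundedAtImInfty F := by
  obtain ⟨k, hk, h⟩ := hF
  have hk2 : Tendsto F atImInfty (𝓝 k) := by simpa using h
  exact hk2.isBigO_one ℝ

/-- build a modular form for a finite index subgroup of `SL₂(ℤ)` -/
def mkMF (G : Subgroup SL(2, ℤ)) [G.FiniteIndex] (k : ℤ) (F : ℍ → ℂ)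
    (hd : MDifferentiable 𝓘(ℂ) 𝓘(ℂ) F) (hs : ∀ A ∈ G, F ∣[k] A = F)
    (hb : ∀ A : SL(2, ℤ), IsBoundedAtImInfty (F ∣[k] A)) :
    ModularForm (G.map (Matrix.SpecialLinearGroup.mapGL ℝ)) k where
  toFun := F
  slash_action_eq' := by
    rintro _ ⟨A, hA, rfl⟩
    exact hs A hA
  holo' := hd
  bdd_at_cusps' := by
    intro c hc
    rw [OnePoint.isBoundedAt_iff_forall_SL2Z]
    · intro A _
      exact hb A
    · exact (Subgroup.IsArithmetic.isCusp_iff_isCusp_SL2Z _).mp hc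

/-- properties of `f`  -/
structure Good (L : ℕ) (f : ℍ → ℂ) (n : SL(2, ℤ) → ℤ) : Prop where
  md : MDifferentiable 𝓘(ℂ) 𝓘(ℂ) f
  ne : ∀ z, f z ≠ 0
  inv : ∀ A ∈ CongruenceSubgroup.Gamma L, ∀ z, f (A • z) = f z
  ord : ∀ A : SL(2, ℤ), HasOrd L (fun z => f (A • z)) (n A)

lemma red_eq_one {A : SL(2, ℤ)} (hA : A ∈ CongruenceSubgroup.Gamma L) : red L A = 1 := by
  rw [CongruenceSubgroup.Gamma_mem] at hA
  obtain ⟨h1, h2, h3, h4⟩ := hA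
  ext i j
  fin_cases i <;> fin_cases j <;> simp [red, h1, h2, h3, h4]

section key
variable {f : ℍ → ℂ} {n : SL(2, ℤ) → ℤ} (hf : Good L f n) (M : (Fin 2 → ZMod L) → ℤ) (N : ℤ)

def FF (f : ℍ → ℂ) (M : (Fin 2 → ZMod L) → ℤ) (N : ℤ) (z : ℍ) : ℂ := f z ^ N * ∏ u, XX L u z ^ (-M u)

include hf in
lemma FF_ne (z : ℍ) : FF f M N z ≠ 0 := by
  unfold FF
  refine mul_ne_zero (zpow_ne_zero _ (hf.ne z)) (Finset.prod_ne_zero_iff.mpr fun u _ => zpow_ne_zero _ (XX_ne_zero _ _))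

lemma FF_smul (A : SL(2, ℤ)) : FF f M N ∣[-(12 * L * M 0)] A = fun z => f (A • z) ^ N * ∏ u, XX L (u ᵥ* red L A) z ^ (-M u) := by
  classical
  funext z
  rw [ModularForm.SL_slash_apply]
  unfold FF
  have h1 : ∀ u, XX L u (A • z) ^ (-M u) = (if u = 0 then (denom A z ^ (12 * L)) ^ (-M 0) else 1) * XX L (u ᵥ* red L A) z ^ (-M u) := by
    intro u
    rw [XX_smul, mul_zpow]
    by_cases hu : u = 0
    · subst hu; simp
    · simp [hu]
  simp_rw [h1]
  rw [Finset.prod_mul_distrib, Finset.prod_ite_eq' Finset.univ (0 : Fin 2 → ZMod L)]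
  have hd : denom A z ≠ 0 := denom_ne_zero _ _
  simp only [Finset.mem_univ, if_true]
  generalize denom A z = d at hd ⊢
  rw [neg_neg, ← zpow_natCast, ← _root_.zpow_mul]
  push_cast
  rw [show (12 * (L : ℤ) * -M 0) = -(12 * L * M 0) by ring, _root_.zpow_neg]
  have : d ^ (12 * (L : ℤ) * M 0) ≠ 0 := zpow_ne_zero _ hd
  field_simp

include hf in
lemma FF_md : MDifferentiable 𝓘(ℂ) 𝓘(ℂ) (FF f M N) := by
  unfold FF
  refine mdiff_mul (mdiff_zpow hf.md hf.ne N) (mdiff_prod _ fun u => mdiff_zpow (mdiff_XX u) (fun z => XX_ne_zero _ _) _)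

variable (hM : ∀ A, ∑ u, M u * ordX L (u ᵥ* red L A) = N * n A)

/-- the quotient as a modular form -/
def FFM : ModularForm ((CongruenceSubgroup.Gamma L).map (Matrix.SpecialLinearGroup.mapGL ℝ)) (-(12 * L * M 0)) :=
  mkMF (CongruenceSubgroup.Gamma L) _ (FF f M N) (FF_md hf M N) (by
    intro A hA
    rw [FF_smul]
    funext z
    rw [red_eq_one hA, hf.inv A hA]; simp [FF]) (by
    intro A
    rw [FF_smul]
    apply HasOrd.bdd (L := L)
    refine (((hf.ord A).zpow N).mul (HasOrd.prod Finset.univ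
      (fun u => (hasOrd_XX (u ᵥ* red L A)).zpow (-M u)))).congr (fun z => rfl) ?_
    rw [← hM A, ← Finset.sum_add_distrib]
    simp)

include hf hM in
lemma M0_le : M 0 ≤ 0 := by
  by_contra h
  have h0 : (0:ℤ) < L := by exact_mod_cast Lpos (L := L)
  have := ModularForm.isZero_of_neg_weight (k := -(12 * L * M 0)) (by
    have : 0 < 12 * (L:ℤ) * M 0 := by push Not at h; positivity
    omega) (FFM hf M N hM)
  have h2 : FF f M N UpperHalfPlane.I = 0 := by
    have := DFunLike.congr_fun this UpperHalfPlane.I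
    exact this
  exact FF_ne hf M N _ h2

include hf hM in
lemma M0_eq : M 0 = 0 := by
  have h1 := M0_le hf M N hM
  have h2 := M0_le hf (-M) (-N) (fun A => by simp [← hM A])
  simp at h2
  omega

include hf hM in
lemma key_lemma : ∃ c : ℂ, c ≠ 0 ∧ ∀ z, f z ^ N = c * ∏ u, XX L u z ^ M u := by
  have h0 := M0_eq hf M N hM
  have hk : -(12 * (L:ℤ) * M 0) = 0 := by rw [h0]; simp
  obtain ⟨c, hc⟩ := ModularForm.eq_const_of_weight_zero (ModularForm.mcast hk (FFM hf M N hM))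
  have hc' : ∀ z, FF f M N z = c := fun z => congrFun hc z
  refine ⟨c, ?_, fun z => ?_⟩
  · rw [← hc' UpperHalfPlane.I]; exact FF_ne hf M N _
  · rw [← hc' z, FF, mul_assoc, ← Finset.prod_mul_distrib]
    rw [Finset.prod_eq_one, mul_one]
    intro u _
    rw [← zpow_add₀ (XX_ne_zero _ _)]; simp

end key
end SU

namespace SU
set_option linter.unusedSectionVars false
variable {L : ℕ} [NeZero L]

/-- `6 L² B₂(a/L)` -/
def oo (a : ZMod L) : ℤ := 6 * (a.val : ℤ) ^ 2 - 6 * a.val * L + (L : ℤ) ^ 2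

lemma ordX_eq_oo (u : Fin 2 → ZMod L) : ordX L u = oo (u 0) := rfl

lemma oo_neg (a : ZMod L) : oo (-a) = oo a := by
  unfold oo
  by_cases h : a = 0
  · simp [h]
  · rw [ZMod.neg_val, if_neg h, Nat.cast_sub (ZMod.val_lt a).le]; ring

abbrev ch (a : ZMod L) : ℂ := ZMod.stdAddChar a

lemma ch_eq (a : ZMod L) : ch a = ee (a.val / L) := by
  rw [ch, ZMod.stdAddChar_apply, ZMod.toCircle_apply, ee]; congr 1; ring

lemma ch_nat (n : ℕ) (a : ZMod L) : ch ((n : ZMod L) * a) = ee (n * (a.val / L)) := by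
  rw [← ee_pow, ← ch_eq, ch, ← nsmul_eq_mul, AddChar.map_nsmul_eq_pow]

lemma cos_eq (n : ℕ) (a : ZMod L) : ((Real.cos (2 * π * n * (a.val / L)) : ℝ) : ℂ) =
    (ch ((n : ZMod L) * a) + ch (-((n : ZMod L) * a))) / 2 := by
  rw [show ch (-((n : ZMod L) * a)) = (ch ((n : ZMod L) * a))⁻¹ from AddChar.map_neg_eq_inv _ _, ch_nat,
    ← ee_neg, Complex.ofReal_cos, Complex.cos, ee, ee]
  push_cast
  congr 3 <;> ring_nf

lemma hasSum_oo (a : ZMod L) : HasSum (fun n : ℕ => 1 / (n : ℂ) ^ 2 *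
    ((ch ((n : ZMod L) * a) + ch (-((n : ZMod L) * a))) / 2)) ((π : ℂ) ^ 2 / (6 * L ^ 2) * oo a) := by
  have hL : (0:ℝ) < L := by exact_mod_cast Lpos (L := L)
  have hx : (a.val : ℝ) / L ∈ Set.Icc (0:ℝ) 1 := by
    refine ⟨by positivity, (div_le_one hL).mpr ?_⟩
    exact_mod_cast (ZMod.val_lt a).le
  have h := hasSum_one_div_nat_pow_mul_cos (k := 1) one_ne_zero hx
  have hB : Polynomial.bernoulli 2 = Polynomial.X ^ 2 - Polynomial.X + Polynomial.C (1/6 : ℚ) := by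
    rw [Polynomial.bernoulli]
    simp only [Finset.sum_range_succ, Finset.sum_range_zero]
    norm_num [bernoulli_one, bernoulli_two, ← Polynomial.C_mul_X_pow_eq_monomial]
    ring
  have e : (-1 : ℝ) ^ (1 + 1) * (2 * π) ^ (2 * 1) / 2 / (Nat.factorial (2 * 1)) *
        (Polynomial.map (algebraMap ℚ ℝ) (Polynomial.bernoulli (2 * 1))).eval ((a.val : ℝ) / L) =
        π ^ 2 / (6 * L ^ 2) * oo a := by
    rw [show 2 * 1 = 2 from rfl, hB]
    simp [oo, Nat.factorial]
    field_simp
  rw [e] at h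
  have h2 := Complex.hasSum_ofReal.mpr h
  have e2 : ((π ^ 2 / (6 * L ^ 2) * oo a : ℝ) : ℂ) = (π : ℂ) ^ 2 / (6 * L ^ 2) * oo a := by push_cast; rfl
  rw [e2] at h2
  refine h2.congr_fun ?_ |> id
  intro n
  rw [← cos_eq]; push_cast; ring

section inversion
variable {ι : Type*} [Fintype ι] [DecidableEq ι]

/-- Fourier transform -/
def FT (m : (ι → ZMod L) → ℚ) (x : ι → ZMod L) : ℂ := ∑ u, (m u : ℂ) * ch (u ⬝ᵥ x)

lemma sum_ch (w : ι → ZMod L) : ∑ x : ι → ZMod L, ch (w ⬝ᵥ x) = if w = 0 then (Fintype.card (ι → ZMod L) : ℂ) else 0 := by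
  split_ifs with h
  · subst h; simp
  · obtain ⟨i, hi⟩ := Function.ne_iff.mp h
    have hne : ch (w i) ≠ 1 := by
      intro h1
      apply hi
      apply ZMod.injective_stdAddChar
      rw [show ZMod.stdAddChar (w i) = ch (w i) from rfl, h1]; simp
    have := Equiv.sum_comp (Equiv.addRight (Pi.single i 1 : ι → ZMod L)) (fun x => ch (w ⬝ᵥ x))
    simp only [Equiv.coe_addRight, dotProduct_add, dotProduct_single, mul_one] at this
    simp_rw [ch, AddChar.map_add_eq_mul, ← Finset.sum_mul] at this
    have h2 : (∑ x : ι → ZMod L, ch (w ⬝ᵥ x)) * (ch (w i) - 1) = 0 := by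
      rw [mul_sub, mul_one, sub_eq_zero]; exact this
    exact (mul_eq_zero.mp h2).resolve_right (sub_ne_zero.mpr hne)

lemma FT_inj (m : (ι → ZMod L) → ℚ) (h : ∀ x, FT m x = 0) : m = 0 := by
  funext v
  have : ∑ x, FT m x * ch (-(v ⬝ᵥ x)) = 0 := by simp [h]
  have h2 : ∑ x, FT m x * ch (-(v ⬝ᵥ x)) = ∑ u, (m u : ℂ) * ∑ x, ch ((u - v) ⬝ᵥ x) := by
    simp_rw [FT, Finset.sum_mul, Finset.mul_sum]
    rw [Finset.sum_comm]
    refine Finset.sum_congr rfl fun u _ => Finset.sum_congr rfl fun x _ => ?_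
    rw [sub_dotProduct, sub_eq_add_neg, mul_assoc, ch, ch, ← AddChar.map_add_eq_mul]
  rw [this] at h2
  simp_rw [sum_ch, sub_eq_zero] at h2
  simp at h2
  exact h2.resolve_right (fun h => NeZero.ne L h.1)

lemma FT_vanish (m : (ι → ZMod L) → ℚ) (hev : ∀ u, m (-u) = m u)
    (h : ∀ x, ∑ u, m u * (oo (u ⬝ᵥ x) : ℚ) = 0) (x : ι → ZMod L) : FT m x = 0 := by
  -- the series identity
  have hser : ∀ x, HasSum (fun n : ℕ => 1 / (n : ℂ) ^ 2 * FT m ((n : ZMod L) • x)) 0 := by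
    intro x
    have h1 := hasSum_sum (s := Finset.univ) (f := fun (u : ι → ZMod L) (n : ℕ) => (m u : ℂ) * (1 / (n : ℂ) ^ 2 *
      ((ch ((n : ZMod L) * (u ⬝ᵥ x)) + ch (-((n : ZMod L) * (u ⬝ᵥ x)))) / 2)))
      (fun u _ => (hasSum_oo (u ⬝ᵥ x)).mul_left (m u : ℂ))
    have e0 : ∑ u, (m u : ℂ) * ((π : ℂ) ^ 2 / (6 * L ^ 2) * oo (u ⬝ᵥ x)) = 0 := by
      have := congrArg (Rat.cast : ℚ → ℂ) (h x)
      push_cast at this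
      calc _ = (π : ℂ) ^ 2 / (6 * L ^ 2) * ∑ u, (m u : ℂ) * oo (u ⬝ᵥ x) := by
            rw [Finset.mul_sum]; refine Finset.sum_congr rfl fun u _ => by ring
        _ = 0 := by rw [this, mul_zero]
    rw [e0] at h1
    refine h1.congr_fun ?_ |> id
    intro n
    have hneg : ∑ u, (m u : ℂ) * ch (-((n : ZMod L) * (u ⬝ᵥ x))) = ∑ u, (m u : ℂ) * ch ((n : ZMod L) * (u ⬝ᵥ x)) := by
      rw [← Equiv.sum_comp (Equiv.neg _)]
      refine Finset.sum_congr rfl fun u _ => ?_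
      simp [hev]
    have : FT m ((n : ZMod L) • x) = ∑ u, (m u : ℂ) * ch ((n : ZMod L) * (u ⬝ᵥ x)) := by
      unfold FT; simp [dotProduct_smul]
    rw [this]
    calc _ = 1 / (n : ℂ) ^ 2 * ((∑ u, (m u : ℂ) * ch ((n : ZMod L) * (u ⬝ᵥ x)) + ∑ u, (m u : ℂ) * ch (-((n : ZMod L) * (u ⬝ᵥ x)))) / 2) := by
          rw [hneg]; ring
      _ = _ := by
          rw [← Finset.sum_add_distrib, Finset.sum_div, Finset.mul_sum]
          refine Finset.sum_congr rfl fun u _ => by ring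
  obtain ⟨y, hy⟩ := Finite.exists_max (fun x => ‖FT m x‖)
  suffices hy0 : ‖FT m y‖ ≤ 0 by
    have := (hy x).trans hy0
    simpa using this
  have hz := hasSum_zeta_two
  have h1 : HasSum (fun n : ℕ => 1 / (n : ℂ) ^ 2 * FT m ((n : ZMod L) • y) - if n = 1 then FT m y else 0) (0 - FT m y) :=
    (hser y).sub (hasSum_ite_eq 1 (FT m y))
  have h2 : HasSum (fun n : ℕ => (1 / (n : ℝ) ^ 2 - if n = 1 then 1 else 0) * ‖FT m y‖) ((π ^ 2 / 6 - 1) * ‖FT m y‖) :=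
    (hz.sub (hasSum_ite_eq 1 1)).mul_right _
  have h3 := tsum_of_norm_bounded h2 (f := fun n : ℕ => 1 / (n : ℂ) ^ 2 * FT m ((n : ZMod L) • y) - if n = 1 then FT m y else 0) (by
    intro n
    by_cases hn : n = 1
    · subst hn; simp
    · simp only [if_neg hn, sub_zero, norm_mul]
      have : ‖1 / (n : ℂ) ^ 2‖ = 1 / (n : ℝ) ^ 2 := by simp
      rw [this]
      gcongr
      exact hy _)
  rw [h1.tsum_eq, zero_sub, norm_neg] at h3
  have hpi : π ^ 2 / 6 - 1 < 0.7 := by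
    have := Real.pi_lt_d2
    have := Real.pi_pos
    nlinarith
  nlinarith [norm_nonneg (FT m y)]

/-- even functions -/
def Evn (ι : Type*) (L : ℕ) : Submodule ℚ ((ι → ZMod L) → ℚ) where
  carrier := {m | ∀ u, m (-u) = m u}
  add_mem' := by intro a b ha hb u; simp only [Set.mem_ofPred_eq, Pi.add_apply] at *; rw [ha, hb]
  zero_mem' := by intro u; rfl
  smul_mem' := by intro c a ha u; simp only [Set.mem_ofPred_eq, Pi.smul_apply] at *; rw [ha]

/-- the Bernoulli transform -/
def BT (ι : Type*) [Fintype ι] [DecidableEq ι] (L : ℕ) [NeZero L] : Evn ι L →ₗ[ℚ] Evn ι L where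
  toFun m := ⟨fun x => ∑ u, m.1 u * (oo (u ⬝ᵥ x) : ℚ), by
    intro x; simp [dotProduct_neg, oo_neg]⟩
  map_add' a b := by
    apply Subtype.ext; funext x; simp [add_mul, Finset.sum_add_distrib]
  map_smul' c a := by
    apply Subtype.ext; funext x; simp [Finset.mul_sum, mul_assoc]

lemma BT_surj : Function.Surjective (BT ι L) := by
  rw [← LinearMap.injective_iff_surjective]
  rw [← LinearMap.ker_eq_bot, LinearMap.ker_eq_bot']
  intro m hm
  apply Subtype.ext
  apply FT_inj
  apply FT_vanish _ m.2
  intro x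
  exact congrFun (congrArg Subtype.val hm) x

/-- B₂ inversion with integral coefficients -/
lemma bern_inversion (g : (ι → ZMod L) → ℚ) (hg : ∀ x, g (-x) = g x) :
    ∃ (N : ℕ) (M : (ι → ZMod L) → ℤ), 0 < N ∧ 
      ∀ x, ∑ u, (M u : ℚ) * (oo (u ⬝ᵥ x) : ℚ) = N * g x := by
  obtain ⟨m, hm⟩ := BT_surj (ι := ι) (L := L) ⟨g, hg⟩
  have hm' : ∀ x, ∑ u, m.1 u * (oo (u ⬝ᵥ x) : ℚ) = g x := fun x => congrFun (congrArg Subtype.val hm) x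
  refine ⟨∏ u, (m.1 u).den, fun u => (m.1 u).num * ∏ v ∈ Finset.univ.erase u, ((m.1 v).den : ℤ),
    Finset.prod_pos fun u _ => (m.1 u).den_pos, ?_⟩
  · intro x
    rw [← hm' x, Finset.mul_sum]
    refine Finset.sum_congr rfl fun u _ => ?_
    rw [← Finset.mul_prod_erase _ _ (Finset.mem_univ u)]
    have : ((m.1 u).num : ℚ) = m.1 u * (m.1 u).den := (Rat.mul_den_eq_num _).symm
    push_cast
    rw [this]; ring
end inversion

end SU

namespace SU
set_option linter.unusedSectionVars false
variable {L : ℕ} [NeZero L]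
open ModularGroup

lemma tendsto_T (k : ℤ) : Tendsto (fun z : ℍ => T ^ k • z) atImInfty atImInfty := by
  rw [atImInfty, tendsto_comap_iff]
  refine tendsto_comap.congr fun z => ?_
  simp only [Function.comp]
  rw [im_T_zpow_smul]

lemma QQ_T (k : ℤ) (z : ℍ) : QQ L (T ^ k • z) = QQ L z * ee (k / L) := by
  rw [QQ, coe_T_zpow_smul_eq, add_div, ee_add, QQ]

lemma HasOrd.T {F : ℍ → ℂ} {n : ℤ} (h : HasOrd L F n) (k : ℤ) : HasOrd L (fun z => F (T ^ k • z)) n := by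
  obtain ⟨κ, hκ, h⟩ := h
  refine ⟨κ * ee (k / L) ^ n, mul_ne_zero hκ (zpow_ne_zero _ (ee_ne_zero _)),
    ((h.comp (tendsto_T k)).mul_const (ee (k / L) ^ n)).congr fun z => ?_⟩
  simp only [Function.comp]
  rw [QQ_T, mul_zpow, _root_.zpow_neg (ee _), mul_assoc, mul_assoc, inv_mul_cancel₀ (zpow_ne_zero _ (ee_ne_zero _)), mul_one]

lemma red_T (k : ℤ) : red L (T ^ k) = !![1, (k : ZMod L); 0, 1] := by
  rw [red, coe_T_zpow]
  ext i j; fin_cases i <;> fin_cases j <;> simp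

lemma gamma_iff {A : SL(2, ℤ)} : A ∈ CongruenceSubgroup.Gamma L ↔ red L A = 1 := by
  refine ⟨red_eq_one, fun h => ?_⟩
  rw [CongruenceSubgroup.Gamma_mem]
  refine ⟨?_, ?_, ?_, ?_⟩
  · simpa [red] using congrFun (congrFun h 0) 0
  · simpa [red] using congrFun (congrFun h 0) 1
  · simpa [red] using congrFun (congrFun h 1) 0
  · simpa [red] using congrFun (congrFun h 1) 1

lemma gamma_of_red_eq {A B : SL(2, ℤ)} (h : red L A = red L B) : A * B⁻¹ ∈ CongruenceSubgroup.Gamma L := by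
  rw [gamma_iff, red_mul, h, ← red_mul, mul_inv_cancel, red_one]

lemma good_of {f : ℍ → ℂ} (hf : IsModularUnit f)
    (hinv : ∀ A ∈ CongruenceSubgroup.Gamma L, ∀ z : ℍ, f (A • z) = f z) : ∃ n, Good L f n := by
  obtain ⟨h1, h2, _, h4⟩ := hf
  have : ∀ A : SL(2, ℤ), ∃ n : ℤ, HasOrd L (fun z => f (A • z)) n := by
    intro A
    obtain ⟨α, κ, hκ, h⟩ := h4 A
    have h' : Tendsto (fun z : ℍ => f (A • z) * ee (-(α * z))) atImInfty (𝓝 κ) := by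
      refine h.congr fun z => ?_
      rw [ee]; congr 2; ring
    have hper : ∀ z, f (A • (T ^ (L : ℤ) • z)) = f (A • z) := by
      intro z
      rw [← hinv (A * T ^ (L : ℤ) * A⁻¹) _ (A • z), ← mul_smul, ← mul_smul]
      · congr 2; group
      · rw [gamma_iff, red_mul, red_mul, red_T]
        simp only [Int.cast_natCast, CharP.cast_eq_zero]
        rw [show (!![1, 0; 0, 1] : Matrix (Fin 2) (Fin 2) (ZMod L)) = 1 from Matrix.one_fin_two.symm, mul_one, ← red_mul, mul_inv_cancel, red_one]
    have h'' : Tendsto (fun z : ℍ => f (A • z) * ee (-(α * z))) atImInfty (𝓝 (κ * ee (α * L))) := by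
      refine ((h'.comp (tendsto_T L)).mul_const (ee (α * L))).congr fun z => ?_
      simp only [Function.comp]
      rw [hper, coe_T_zpow_smul_eq, mul_assoc, ← ee_add]; congr 2; push_cast; ring
    have hu := tendsto_nhds_unique h' h''
    have : ee (α * L) = 1 := by
      have := mul_left_cancel₀ hκ ((mul_one κ).trans hu); exact this.symm
    obtain ⟨n, hn⟩ := (ee_eq_one_iff _).mp this
    refine ⟨n, κ, hκ, h'.congr fun z => ?_⟩
    congr 1
    rw [QQ, ee_zpow]; congr 1
    have hL : (L : ℂ) ≠ 0 := Lne
    push_cast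
    rw [← hn]; field_simp
  choose n hn using this
  exact ⟨n, h1, h2, hinv, hn⟩

/-- first column mod L -/
def col (L : ℕ) (A : SL(2, ℤ)) : Fin 2 → ZMod L := fun i => red L A i 0

lemma vecMul_col (u : Fin 2 → ZMod L) (A : SL(2, ℤ)) : (u ᵥ* red L A) 0 = u ⬝ᵥ col L A := rfl

lemma ordX_vecMul (u : Fin 2 → ZMod L) (A : SL(2, ℤ)) : ordX L (u ᵥ* red L A) = oo (u ⬝ᵥ col L A) := rfl

lemma red_det (A : SL(2, ℤ)) : red L A 0 0 * red L A 1 1 - red L A 0 1 * red L A 1 0 = 1 := by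
  have h := A.det_coe
  rw [Matrix.det_fin_two] at h
  have := congrArg (Int.cast : ℤ → ZMod L) h
  push_cast at this
  exact this

section
variable {f : ℍ → ℂ} {n : SL(2, ℤ) → ℤ} (hf : Good L f n)
include hf

lemma Good.n_red {A B : SL(2, ℤ)} (h : red L A = red L B) : n A = n B := by
  refine (hf.ord A).unique ((hf.ord B).congr (fun z => ?_) rfl)
  rw [← hf.inv _ (gamma_of_red_eq h) (B • z), ← mul_smul]; simp

lemma Good.n_T (A : SL(2, ℤ)) (k : ℤ) : n (A * T ^ k) = n A := by
  refine (hf.ord _).unique (((hf.ord A).T k).congr (fun z => ?_) rfl)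
  rw [mul_smul]

lemma Good.n_neg (A : SL(2, ℤ)) : n (-A) = n A := by
  refine (hf.ord _).unique ((hf.ord A).congr (fun z => ?_) rfl)
  rw [ModularGroup.SL_neg_smul]

lemma Good.n_col {A B : SL(2, ℤ)} (h : col L A = col L B) : n A = n B := by
  have h0 : red L A 0 0 = red L B 0 0 := congrFun h 0
  have h1 : red L A 1 0 = red L B 1 0 := congrFun h 1
  have dA := red_det (L := L) A
  have dB := red_det (L := L) B
  set k : ℤ := A 1 1 * B 0 1 - A 0 1 * B 1 1 with hk
  have hk' : (k : ZMod L) = red L A 1 1 * red L B 0 1 - red L A 0 1 * red L B 1 1 := by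
    simp [hk, red]
  rw [← hf.n_T A k]
  apply hf.n_red
  rw [red_mul, red_T, hk']
  ext i j
  fin_cases i <;> fin_cases j <;> simp [Matrix.mul_apply, Fin.sum_univ_two, h0, h1]
  · rw [h0, h1] at dA
    linear_combination red L B 0 1 * dA - red L A 0 1 * dB
  · rw [h0, h1] at dA
    linear_combination red L B 1 1 * dA - red L A 1 1 * dB

lemma Good.n_shift (hs : ∃ κ : ℂ, κ ≠ 0 ∧ ∀ z, f (T • z) = κ * f z) (A : SL(2, ℤ)) (k : ℕ) : n (T ^ k * A) = n A := by
  obtain ⟨κ, hκ, h⟩ := hs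
  induction k with
  | zero => simp
  | succ k ih =>
    rw [← ih]
    obtain ⟨c, hc, h'⟩ := hf.ord (T ^ k * A)
    refine (hf.ord _).unique ⟨κ * c, mul_ne_zero hκ hc, (h'.const_mul κ).congr fun z => ?_⟩
    rw [pow_succ', mul_assoc T]
    simp only []
    rw [mul_smul T, h, mul_assoc]

/-- 2D inversion -/
lemma Good.exists_pow : ∃ (N : ℕ) (M : (Fin 2 → ZMod L) → ℤ), 0 < N ∧
    ∀ A, ∑ u, M u * oo (u ⬝ᵥ col L A) = N * n A := by
  classical
  let g : (Fin 2 → ZMod L) → ℚ := fun x => if h : ∃ A, col L A = x then n h.choose else 0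
  have hg : ∀ A, g (col L A) = n A := by
    intro A
    have h : ∃ B, col L B = col L A := ⟨A, rfl⟩
    simp only [g, dif_pos h]
    rw [hf.n_col h.choose_spec]
  have hneg : ∀ A, col L (-A) = -col L A := by
    intro A; funext i; simp [col, red]
  obtain ⟨N, M, hN, hM⟩ := bern_inversion g (by
    intro x
    by_cases h : ∃ A, col L A = x
    · obtain ⟨A, rfl⟩ := h
      rw [← hneg, hg, hg, hf.n_neg]
    · have h' : ¬ ∃ A, col L A = -x := by
        rintro ⟨A, hA⟩
        exact h ⟨-A, by rw [hneg, hA, neg_neg]⟩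
      simp only [g, dif_neg h, dif_neg h'])
  refine ⟨N, M, hN, fun A => ?_⟩
  have := hM (col L A)
  rw [hg] at this
  exact_mod_cast this

end
end SU

namespace SU
set_option linter.unusedSectionVars false
variable {L : ℕ} [NeZero L]
open ModularGroup

lemma QQ_one (z : ℍ) : QQ 1 z = ee z := by simp [QQ]

lemma Ev.expand {p : PowerSeries ℂ} {Q v : ℂ} (h : Ev p (Q ^ L) v) :
    Ev (PowerSeries.expand L (NeZero.ne L) p) Q v := by
  unfold Ev at *
  have hinj : Function.Injective (fun k : ℕ => L * k) := fun a b h => Nat.eq_of_mul_eq_mul_left Lpos h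
  rw [← hinj.hasSum_iff]
  · refine h.congr_fun ?_ |> id
    intro k
    simp only [Function.comp]
    rw [PowerSeries.coeff_expand_mul, pow_mul]
  · intro k hk
    rw [PowerSeries.coeff_expand_of_not_dvd, zero_mul]
    rintro ⟨j, rfl⟩
    exact hk ⟨j, rfl⟩

lemma HasPS.expand {p : PowerSeries ℂ} {F : ℍ → ℂ} (h : HasPS 1 p F) :
    HasPS L (PowerSeries.expand L (NeZero.ne L) p) F := by
  intro z
  apply Ev.expand
  rw [QQ_pow_L, ← QQ_one]; exact h z

lemma ord_int {f : ℍ → ℂ} {n : SL(2, ℤ) → ℤ} (hf : Good L f n) {α κ : ℂ} (hκ : κ ≠ 0)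
    (h' : Tendsto (fun z : ℍ => f z * ee (-(α * z))) atImInfty (𝓝 κ)) : α * L = n 1 := by
  have hper : ∀ z, f (T ^ (L : ℤ) • z) = f z := by
    intro z
    apply hf.inv
    rw [gamma_iff, red_T]
    simp only [Int.cast_natCast, CharP.cast_eq_zero]
    exact Matrix.one_fin_two.symm
  have h'' : Tendsto (fun z : ℍ => f z * ee (-(α * z))) atImInfty (𝓝 (κ * ee (α * L))) := by
    refine ((h'.comp (tendsto_T L)).mul_const (ee (α * L))).congr fun z => ?_
    simp only [Function.comp]
    rw [hper, coe_T_zpow_smul_eq, mul_assoc, ← ee_add]; congr 2; push_cast; ring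
  have hu := tendsto_nhds_unique h' h''
  have : ee (α * L) = 1 := by
    have := mul_left_cancel₀ hκ ((mul_one κ).trans hu); exact this.symm
  obtain ⟨m, hm⟩ := (ee_eq_one_iff _).mp this
  have h1 : HasOrd L f m := by
    refine ⟨κ, hκ, h'.congr fun z => ?_⟩
    congr 1
    rw [QQ, ee_zpow]; congr 1
    have hL : (L : ℂ) ≠ 0 := Lne
    push_cast
    rw [← hm]; field_simp
  rw [hm, h1.unique ((hf.ord 1).congr (fun z => by rw [one_smul]) rfl)]

/-- normalised rational expansion -/
structure RExp (L : ℕ) (f : ℍ → ℂ) (n1 : ℤ) (p : PowerSeries ℚ) : Prop where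
  c0 : PowerSeries.constantCoeff p ≠ 0
  ps : HasPS 1 (PowerSeries.map (algebraMap ℚ ℂ) p) (fun z => f z * QQ L z ^ (-n1))

lemma exists_rexp {f : ℍ → ℂ} {n : SL(2, ℤ) → ℤ} (hf : Good L f n)
    (hexp : ∃ (s : ℚ) (c : ℕ → ℚ), ∀ z : UpperHalfPlane,
      f z * Complex.exp (-(2 * (π : ℂ) * Complex.I * (s : ℂ) * (z : ℂ))) =
        ∑' n : ℕ, (c n : ℂ) * Complex.exp (2 * (π : ℂ) * Complex.I * (n : ℂ) * (z : ℂ))) :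
    ∃ p, RExp L f (n 1) p := by
  classical
  obtain ⟨s, c, h⟩ := hexp
  have hE : ∀ z : ℍ, HasSum (fun k : ℕ => (c k : ℂ) * ee z ^ k) (f z * ee (-(s * z))) := by
    intro z
    have e1 : Complex.exp (-(2 * (π : ℂ) * Complex.I * (s : ℂ) * (z : ℂ))) = ee (-(s * z)) := by
      rw [ee]; congr 1; ring
    have e2 : ∀ k : ℕ, (c k : ℂ) * Complex.exp (2 * (π : ℂ) * Complex.I * (k : ℂ) * (z : ℂ)) = c k * ee z ^ k := by
      intro k; rw [ee_pow, ee]; congr 2; ring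
    have hz := h z
    rw [e1] at hz
    simp_rw [e2] at hz
    rw [hz]
    apply Summable.hasSum
    by_contra hs
    rw [tsum_eq_zero_of_not_summable hs] at hz
    exact mul_ne_zero (hf.ne z) (ee_ne_zero _) hz
  have hex : ∃ k, c k ≠ 0 := by
    by_contra hc
    push Not at hc
    have := hE UpperHalfPlane.I
    simp only [hc, Rat.cast_zero, zero_mul] at this
    exact mul_ne_zero (hf.ne _) (ee_ne_zero _) (this.unique hasSum_zero)
  set k0 := Nat.find hex with hk0
  have hk1 : c k0 ≠ 0 := Nat.find_spec hex
  have hk2 : ∀ k < k0, c k = 0 := fun k hk => by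
    by_contra h; exact Nat.find_min hex hk h
  set p : PowerSeries ℚ := PowerSeries.mk fun k => c (k + k0) with hp
  have hps : HasPS 1 (PowerSeries.map (algebraMap ℚ ℂ) p) (fun z => f z * ee (-((s + k0) * z))) := by
    intro z
    have h1 := hE z
    rw [← hasSum_nat_add_iff' k0] at h1
    rw [Finset.sum_eq_zero (fun i hi => by rw [hk2 i (Finset.mem_range.mp hi)]; simp), sub_zero] at h1
    have h2 := h1.mul_right (ee (-(k0 * z)))
    rw [mul_assoc, ← ee_add, show -(s * (z:ℂ)) + -(k0 * z) = -((s + k0) * z) by ring] at h2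
    refine h2.congr_fun ?_ |> id
    intro k
    rw [PowerSeries.coeff_map, hp, PowerSeries.coeff_mk, QQ_one, eq_ratCast, mul_assoc, pow_add, ee_neg, ← ee_pow z k0]
    rw [mul_assoc, mul_inv_cancel₀ (pow_ne_zero _ (ee_ne_zero _)), mul_one]
  have hc0 : PowerSeries.constantCoeff p ≠ 0 := by
    rw [hp, ← PowerSeries.coeff_zero_eq_constantCoeff_apply, PowerSeries.coeff_mk]; simpa using hk1
  have ht := Ev.tendsto one_pos hps
  have hi := ord_int hf (α := s + k0) (by
    rw [← PowerSeries.coeff_zero_eq_constantCoeff_apply, PowerSeries.coeff_map,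
      PowerSeries.coeff_zero_eq_constantCoeff_apply]
    simpa using hc0) ht
  refine ⟨p, hc0, ?_⟩
  intro z
  have := hps z
  have e : QQ L z ^ (-n 1) = ee (-((s + k0) * z)) := by
    rw [QQ, ee_zpow]; congr 1
    have hL : (L : ℂ) ≠ 0 := Lne
    push_cast
    rw [← hi]; field_simp
  simp only [e]
  exact this

lemma RExp.shift {f : ℍ → ℂ} {n1 : ℤ} {p : PowerSeries ℚ} (h : RExp L f n1 p) :
    ∃ κ : ℂ, κ ≠ 0 ∧ ∀ z, f (T • z) = κ * f z := by
  refine ⟨ee (1 / L) ^ n1, zpow_ne_zero _ (ee_ne_zero _), fun z => ?_⟩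
  have h1 := h.ps z
  have h2 := h.ps (T • z)
  have hq : QQ 1 (T • z) = QQ 1 z := by
    have := QQ_T (L := 1) 1 z
    rw [zpow_one] at this
    rw [this]
    have h1 : ee ((1:ℤ) / (1:ℕ)) = 1 := by
      have := ee_int 1
      simpa using this
    rw [h1, mul_one]
  have hQ : QQ L (T • z) = QQ L z * ee (1 / L) := by
    have := QQ_T (L := L) 1 z
    rw [zpow_one] at this
    rw [this]; simp
  rw [hq] at h2
  have h3 : f z * QQ L z ^ (-n1) = f (T • z) * QQ L (T • z) ^ (-n1) := h1.unique h2
  rw [hQ, mul_zpow] at h3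
  have hz := zpow_ne_zero (-n1) (QQ_ne_zero L z)
  rw [_root_.zpow_neg (ee _)] at h3
  have he := zpow_ne_zero n1 (ee_ne_zero (1 / L))
  have h4 : f z = f (T • z) * (ee (1 / L) ^ n1)⁻¹ := by
    apply mul_right_cancel₀ hz; rw [h3]; ring
  rw [h4]; field_simp

/-- twist -/
def tw (d : ℕ) (u : Fin 2 → ZMod L) : Fin 2 → ZMod L := ![u 0, d * u 1]

lemma YY_tw {d : ℕ} (hd : Nat.Coprime d L) (u : Fin 2 → ZMod L) : YY (zt L ^ d) u = YY (zt L) (tw d u) := by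
  have hprim := zt_primitive (L := L)
  have hval : ∀ k m : ℕ, (k : ZMod L) = m → zt L ^ k = zt L ^ m := by
    intro k m hkm
    rw [ZMod.natCast_eq_natCast_iff] at hkm
    exact pow_eq_pow_of_modEq hkm hprim.pow_eq_one
  have hu0 : tw d u 0 = u 0 := rfl
  have hu1 : tw d u 1 = d * u 1 := rfl
  have hunit : IsUnit (d : ZMod L) := (ZMod.isUnit_iff_coprime d L).mpr hd
  have e1 : (zt L ^ d) ^ (6 * ((u 0).val * (u 1).val)) = zt L ^ (6 * ((tw d u 0).val * (tw d u 1).val)) := by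
    rw [← pow_mul]; apply hval; push_cast; rw [hu0, hu1]; simp; ring
  have e2 : (zt L ^ d) ^ (u 1).val = zt L ^ (tw d u 1).val := by
    rw [← pow_mul]; apply hval; push_cast; rw [hu1]; simp
  have e3 : (zt L ^ d) ^ (L - (u 1).val) = zt L ^ (L - (tw d u 1).val) := by
    rw [← pow_mul]; apply hval; rw [Nat.cast_mul, Nat.cast_sub (ZMod.val_lt _).le, Nat.cast_sub (ZMod.val_lt _).le, hu1]; simp
  have e4 : kap (zt L ^ d) u = kap (zt L) (tw d u) := by
    unfold kap
    rw [e2, hu0]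
    have : tw d u 1 ≠ 0 ↔ u 1 ≠ 0 := by
      rw [hu1, Ne, hunit.mul_right_eq_zero]
    simp only [this]
  unfold YY
  rw [e1, e2, e3, e4, hu0]

section galois
variable (N : ℕ) (M : (Fin 2 → ZMod L) → ℤ)

def G1 {R : Type*} [CommRing R] (ζ : R) (p : PowerSeries R) : PowerSeries R :=
  (PowerSeries.expand L (NeZero.ne L) p) ^ N * ∏ u, YY ζ u ^ (-M u).toNat
def G2 {R : Type*} [CommRing R] (ζ : R) : PowerSeries R := ∏ u, YY ζ u ^ (M u).toNat

lemma map_G1 {R R' : Type*} [CommRing R] [CommRing R'] (σ : R →+* R') (ζ : R) (p : PowerSeries R) :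
    PowerSeries.map σ (G1 N M ζ p) = G1 N M (σ ζ) (PowerSeries.map σ p) := by
  unfold G1
  rw [map_mul, map_pow, map_prod, PowerSeries.map_expand]
  simp_rw [map_pow, map_YY]

lemma map_G2 {R R' : Type*} [CommRing R] [CommRing R'] (σ : R →+* R') (ζ : R) :
    PowerSeries.map σ (G2 M ζ) = G2 M (σ ζ) := by
  unfold G2
  rw [map_prod]
  simp_rw [map_pow, map_YY]

variable {f : ℍ → ℂ} {n1 : ℤ} {p : PowerSeries ℚ} (hp : RExp L f n1 p)

lemma zpow_split (x : ℂ) (hx : x ≠ 0) (m : ℤ) : x ^ m * x ^ (-m).toNat = x ^ m.toNat := by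
  rw [← zpow_natCast, ← zpow_natCast, ← zpow_add₀ hx]; congr 1; omega

lemma prod_zpow_sum {ι : Type*} (s : Finset ι) {x : ℂ} (hx : x ≠ 0) (m : ι → ℤ) :
    ∏ i ∈ s, x ^ m i = x ^ ∑ i ∈ s, m i := by
  classical
  induction s using Finset.induction_on with
  | empty => simp
  | insert a s ha ih => rw [Finset.prod_insert ha, Finset.sum_insert ha, ih, zpow_add₀ hx]

lemma cc_map {R R' : Type*} [CommRing R] [CommRing R'] (σ : R →+* R') (p : PowerSeries R) :
    PowerSeries.constantCoeff (PowerSeries.map σ p) = σ (PowerSeries.constantCoeff p) := by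
  rw [← PowerSeries.coeff_zero_eq_constantCoeff_apply, PowerSeries.coeff_map, PowerSeries.coeff_zero_eq_constantCoeff_apply]

/-- transfer between function and power series identity -/
lemma fun_identity (hord : ∑ u, M u * ordX L u = N * n1) (t : (Fin 2 → ZMod L) → (Fin 2 → ZMod L))
    (ht : ∀ u, t u 0 = u 0) (c : ℂ) (z : ℍ) :
    (f z ^ N = c * ∏ u, XX L (t u) z ^ M u) ↔
    (f z * QQ L z ^ (-n1)) ^ N * ∏ u, Yf L (t u) z ^ (-M u).toNat = c * ∏ u, Yf L (t u) z ^ (M u).toNat := by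
  have hY : ∀ u, Yf L u z ≠ 0 := fun u => Yf_ne_zero u z
  have h1 : ∏ u, XX L (t u) z ^ M u = QQ L z ^ (N * n1) * ∏ u, Yf L (t u) z ^ M u := by
    simp_rw [XX_eq, mul_zpow, Finset.prod_mul_distrib, ← _root_.zpow_mul]
    rw [prod_zpow_sum _ (QQ_ne_zero L z), ← hord]
    congr 2
    exact Finset.sum_congr rfl fun u _ => by rw [ordX_eq_of (ht u), mul_comm]
  have h2 : ∏ u, Yf L (t u) z ^ (M u).toNat = (∏ u, Yf L (t u) z ^ M u) * ∏ u, Yf L (t u) z ^ (-M u).toNat := by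
    rw [← Finset.prod_mul_distrib]
    exact Finset.prod_congr rfl fun u _ => (zpow_split _ (hY _) _).symm
  have h3 : ∏ u, Yf L (t u) z ^ (-M u).toNat ≠ 0 := Finset.prod_ne_zero_iff.mpr fun u _ => pow_ne_zero _ (hY _)
  have hQ := zpow_ne_zero (N * n1) (QQ_ne_zero L z)
  rw [h1, h2, ← mul_assoc c (∏ u, Yf L (t u) z ^ M u), mul_left_inj' h3, mul_pow, ← zpow_natCast (QQ L z ^ (-n1)), ← _root_.zpow_mul,
    show -n1 * (N : ℤ) = -(N * n1) by ring, _root_.zpow_neg, ← div_eq_mul_inv, div_eq_iff hQ]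
  constructor <;> intro h <;> rw [h] <;> ring

include hp in
lemma galois_aux (K : Type*) [Field K] [Algebra ℚ K] [IsCyclotomicExtension {L} ℚ K] {d : ℕ} (hd : Nat.Coprime d L) (hord : ∑ u, M u * ordX L u = N * n1) {c : ℂ}
    (hf : ∀ z, f z ^ N = c * ∏ u, XX L u z ^ M u) :
    ∃ c' : ℂ, c' ≠ 0 ∧ ∀ z, f z ^ N = c' * ∏ u, XX L (tw d u) z ^ M u := by
  set pC := PowerSeries.map (algebraMap ℚ ℂ) p with hpC
  -- power series for twisted functions
  have hG1 : ∀ t : (Fin 2 → ZMod L) → (Fin 2 → ZMod L), HasPS L ((PowerSeries.expand L (NeZero.ne L) pC) ^ N * ∏ u, YY (zt L) (t u) ^ (-M u).toNat)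
      (fun z => (f z * QQ L z ^ (-n1)) ^ N * ∏ u, Yf L (t u) z ^ (-M u).toNat) := fun t =>
    (hp.ps.expand.pow N).mul (HasPS.prod _ fun u _ => (hasPS_Yf (t u)).pow _)
  have hG2 : ∀ t : (Fin 2 → ZMod L) → (Fin 2 → ZMod L), HasPS L (∏ u, YY (zt L) (t u) ^ (M u).toNat)
      (fun z => ∏ u, Yf L (t u) z ^ (M u).toNat) := fun t => HasPS.prod _ fun u _ => (hasPS_Yf (t u)).pow _
  have e1 : G1 N M (zt L) pC = PowerSeries.C c * G2 M (zt L) := by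
    refine HasPS.unique Lpos (hG1 id) ?_
    have := (HasPS.C (L := L) c).mul (hG2 id)
    intro z
    have h := this z
    have h' := (fun_identity N M hord id (fun _ => rfl) c z).mp (hf z)
    show Ev _ _ ((f z * QQ L z ^ (-n1)) ^ N * ∏ u, Yf L (id u) z ^ (-M u).toNat)
    rw [h']
    exact h
  have e2 : G1 N M (zt L) pC * PowerSeries.C (PowerSeries.constantCoeff (G2 M (zt L))) =
      G2 M (zt L) * PowerSeries.C (PowerSeries.constantCoeff (G1 N M (zt L) pC)) := by
    rw [e1]; simp; ring
  set ζ : K := IsCyclotomicExtension.zeta L ℚ K with hζdef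
  have hζ : IsPrimitiveRoot ζ L := IsCyclotomicExtension.zeta_spec L ℚ K
  have hirr : Irreducible (Polynomial.cyclotomic L ℚ) := Polynomial.cyclotomic.irreducible_rat Lpos
  have hemb : ∀ w : ℂ, IsPrimitiveRoot w L → ∃ φ : K →ₐ[ℚ] ℂ, φ ζ = w := by
    intro w hw
    obtain ⟨φ, hφ⟩ := (hζ.embeddingsEquivPrimitiveRoots ℂ hirr).surjective ⟨w, (mem_primitiveRoots Lpos).mpr hw⟩
    exact ⟨φ, congrArg Subtype.val hφ⟩
  obtain ⟨φ, hφ⟩ := hemb (zt L) zt_primitive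
  obtain ⟨ψ, hψ⟩ := hemb (zt L ^ d) (zt_primitive.pow_of_coprime d hd)
  set pK := PowerSeries.map (algebraMap ℚ K) p with hpK
  have hmapφ : ∀ χ : K →ₐ[ℚ] ℂ, PowerSeries.map (χ : K →+* ℂ) pK = pC := by
    intro χ
    ext k
    simp [hpK, hpC, PowerSeries.coeff_map]
  have e3 : G1 N M ζ pK * PowerSeries.C (PowerSeries.constantCoeff (G2 M ζ)) =
      G2 M ζ * PowerSeries.C (PowerSeries.constantCoeff (G1 N M ζ pK)) := by
    have hinj : Function.Injective (PowerSeries.map (φ : K →+* ℂ)) := PowerSeries.map_injective _ (φ : K →+* ℂ).injective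
    apply hinj
    rw [map_mul, map_mul, PowerSeries.map_C, PowerSeries.map_C, ← cc_map (φ : K →+* ℂ), ← cc_map (φ : K →+* ℂ),
      map_G1, map_G2, hmapφ]
    simp only [RingHom.coe_coe, hφ]
    exact e2
  have e4 := congrArg (PowerSeries.map (ψ : K →+* ℂ)) e3
  rw [map_mul, map_mul, PowerSeries.map_C, PowerSeries.map_C, ← cc_map (ψ : K →+* ℂ), ← cc_map (ψ : K →+* ℂ),
      map_G1, map_G2, hmapφ] at e4
  simp only [RingHom.coe_coe, hψ] at e4
  have f1 : G1 N M (zt L ^ d) pC = (PowerSeries.expand L (NeZero.ne L) pC) ^ N * ∏ u, YY (zt L) (tw d u) ^ (-M u).toNat := by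
    unfold G1; simp_rw [YY_tw hd]
  have f2 : G2 M (zt L ^ d) = ∏ u, YY (zt L) (tw d u) ^ (M u).toNat := by
    unfold G2; simp_rw [YY_tw hd]
  rw [f1, f2] at e4
  set k1 := PowerSeries.constantCoeff ((PowerSeries.expand L (NeZero.ne L) pC) ^ N * ∏ u, YY (zt L) (tw d u) ^ (-M u).toNat) with hk1
  set k2 := PowerSeries.constantCoeff (∏ u, YY (zt L) (tw d u) ^ (M u).toNat) with hk2
  have hk1' : k1 ≠ 0 := by
    rw [hk1, map_mul, map_pow, map_prod, PowerSeries.constantCoeff_expand]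
    refine mul_ne_zero (pow_ne_zero _ ?_) (Finset.prod_ne_zero_iff.mpr fun u _ => ?_)
    · rw [hpC, cc_map]; simpa using hp.c0
    · rw [map_pow]; exact pow_ne_zero _ (constantCoeff_YY_ne_zero _)
  have hk2' : k2 ≠ 0 := by
    rw [hk2, map_prod]
    refine (Finset.prod_ne_zero_iff.mpr fun u _ => ?_)
    rw [map_pow]; exact pow_ne_zero _ (constantCoeff_YY_ne_zero _)
  refine ⟨k1 / k2, div_ne_zero hk1' hk2', fun z => ?_⟩
  rw [fun_identity N M hord (tw d) (fun _ => rfl)]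
  have h1 := ((hG1 (tw d)).mul (HasPS.C k2)) z
  have h2 := ((hG2 (tw d)).mul (HasPS.C k1)) z
  rw [e4] at h1
  have h3 := h1.unique h2
  simp only [] at h3
  field_simp
  rw [h3]; ring

include hp in
lemma galois {d : ℕ} (hd : Nat.Coprime d L) (hord : ∑ u, M u * ordX L u = N * n1) {c : ℂ}
    (hf : ∀ z, f z ^ N = c * ∏ u, XX L u z ^ M u) :
    ∃ c' : ℂ, c' ≠ 0 ∧ ∀ z, f z ^ N = c' * ∏ u, XX L (tw d u) z ^ M u :=
  haveI : NeZero ((L : ℕ) : ℚ) := ⟨Nat.cast_ne_zero.mpr (NeZero.ne L)⟩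
  haveI : IsCyclotomicExtension {L} ℚ (CyclotomicField L ℚ) := CyclotomicField.isCyclotomicExtension L ℚ
  galois_aux N M hp (CyclotomicField L ℚ) hd hord hf

end galois
end SU

namespace SU
set_option linter.unusedSectionVars false
variable {L : ℕ} [NeZero L]
open ModularGroup

section P5
variable {f : ℍ → ℂ} {n : SL(2, ℤ) → ℤ} (hf : Good L f n) {p : PowerSeries ℚ} (hp : RExp L f (n 1) p)

include hf hp in
lemma n_twist {A B : SL(2, ℤ)} {d : ℕ} (hd : Nat.Coprime d L) (h0 : col L B 0 = col L A 0)
    (h1 : col L B 1 = d * col L A 1) : n A = n B := by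
  classical
  obtain ⟨N, M, hN, hM⟩ := hf.exists_pow
  have hM' : ∀ A, ∑ u, M u * ordX L (u ᵥ* red L A) = (N : ℤ) * n A := hM
  have hM0 := M0_eq hf M N hM'
  obtain ⟨c, hc, hfc⟩ := key_lemma hf M N hM'
  have hord : ∑ u, M u * ordX L u = (N : ℤ) * n 1 := by
    have := hM' 1
    simpa only [red_one, Matrix.vecMul_one] using this
  obtain ⟨c', hc', hfc'⟩ := galois N M hp hd hord (c := c) (fun z => by
    have := hfc z; rwa [zpow_natCast] at this)
  have hA : HasOrd L (fun z => f (A • z) ^ (N : ℤ)) (N * n A) := (hf.ord A).zpow N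
  have hB : HasOrd L (fun z => f (A • z) ^ (N : ℤ)) (0 + ∑ u, M u * ordX L (tw d u ᵥ* red L A)) := by
    have hcst : HasOrd L (fun _ => c') 0 := ⟨c', hc', by simp⟩
    refine (hcst.mul (HasOrd.prod Finset.univ fun u => (hasOrd_XX (tw d u ᵥ* red L A)).zpow (M u))).congr (fun z => ?_) rfl
    rw [zpow_natCast, hfc']
    congr 1
    refine Finset.prod_congr rfl fun u _ => ?_
    by_cases hu : u = 0
    · subst hu; rw [hM0]; simp
    · rw [XX_smul, if_neg, one_mul]
      intro h
      apply hu
      have e0 : u 0 = 0 := congrFun h 0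
      have e1 : (d : ZMod L) * u 1 = 0 := congrFun h 1
      rw [((ZMod.isUnit_iff_coprime d L).mpr hd).mul_right_eq_zero] at e1
      funext i; fin_cases i
      · exact e0
      · exact e1
  have e := hA.unique hB
  have e2 : ∑ u, M u * ordX L (tw d u ᵥ* red L A) = N * n B := by
    rw [← hM B]
    refine Finset.sum_congr rfl fun u _ => ?_
    rw [ordX_vecMul]
    congr 2
    simp only [dotProduct, Fin.sum_univ_two]
    rw [h0, h1]; simp only [tw, Matrix.cons_val_zero, Matrix.cons_val_one]; ring
  rw [e2, zero_add] at e
  exact mul_left_cancel₀ (by exact_mod_cast hN.ne') e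

/-- gcd of lower left entry -/
def tg (L : ℕ) (A : SL(2, ℤ)) : ℕ := Nat.gcd (col L A 1).val L

def xg (L : ℕ) (A : SL(2, ℤ)) : ZMod L := col L A 0 * ((L / tg L A : ℕ) : ZMod L)

lemma tg_dvd (A : SL(2, ℤ)) : tg L A ∣ L := Nat.gcd_dvd_right _ _
lemma tg_pos (A : SL(2, ℤ)) : 0 < tg L A := Nat.gcd_pos_of_pos_right _ Lpos

lemma unit_val_coprime {u : ZMod L} (hu : IsUnit u) : Nat.Coprime u.val L := by
  have h := (ZMod.isUnit_iff_coprime u.val L).mp (by rwa [ZMod.natCast_zmod_val])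
  exact h

lemma val_gcd {k : ℕ} {x : ZMod L} (h : x = k) : Nat.gcd x.val L = Nat.gcd k L := by
  rw [h, ZMod.val_natCast]
  conv_rhs => rw [Nat.gcd_comm, Nat.gcd_rec, Nat.gcd_comm]
  rw [Nat.gcd_comm, Nat.gcd_comm]

lemma exists_unit (A : SL(2, ℤ)) : ∃ u : ZMod L, IsUnit u ∧ col L A 1 = u * (tg L A : ℕ) := by
  obtain ⟨d, hd, u, hu, h⟩ := ZMod.eq_unit_mul_divisor (col L A 1)
  have : tg L A = d := by
    unfold tg
    have h' : col L A 1 = ((u.val * d : ℕ) : ZMod L) := by rw [h]; simp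
    rw [val_gcd h', Nat.Coprime.gcd_mul_left_cancel _ (unit_val_coprime hu)]
    exact Nat.gcd_eq_left hd
  exact ⟨u, hu, by rw [this, h]⟩

lemma col_coprime (A : SL(2, ℤ)) : Nat.Coprime (col L A 0).val (tg L A) := by
  have h := red_det (L := L) A
  change col L A 0 * red L A 1 1 - red L A 0 1 * col L A 1 = 1 at h
  rw [Nat.coprime_iff_gcd_eq_one]
  set g := Nat.gcd (col L A 0).val (tg L A) with hg
  have hgL : g ∣ L := (Nat.gcd_dvd_right _ _).trans (tg_dvd A)
  have h0 : (ZMod.castHom hgL (ZMod g)) (col L A 0) = 0 := by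
    rw [ZMod.castHom_apply, ZMod.cast_eq_val]
    exact (ZMod.natCast_eq_zero_iff _ _).mpr (Nat.gcd_dvd_left _ _)
  have h1 : (ZMod.castHom hgL (ZMod g)) (col L A 1) = 0 := by
    rw [ZMod.castHom_apply, ZMod.cast_eq_val]
    exact (ZMod.natCast_eq_zero_iff _ _).mpr ((Nat.gcd_dvd_right _ _).trans (Nat.gcd_dvd_left _ _))
  have := congrArg (ZMod.castHom hgL (ZMod g)) h
  rw [map_sub, map_mul, map_mul, h0, h1, map_one] at this
  simp only [zero_mul, mul_zero, sub_zero] at this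
  have h2 : ((1 : ℕ) : ZMod g) = 0 := by rw [Nat.cast_one, this]
  rw [ZMod.natCast_eq_zero_iff] at h2
  exact Nat.dvd_one.mp h2

lemma xg_gcd (A : SL(2, ℤ)) : Nat.gcd (xg L A).val L = L / tg L A := by
  have h : xg L A = (((col L A 0).val * (L / tg L A) : ℕ) : ZMod L) := by
    unfold xg; push_cast; simp
  rw [val_gcd h]
  have h2 : Nat.gcd ((col L A 0).val * (L / tg L A)) (tg L A * (L / tg L A)) = L / tg L A := by
    rw [Nat.gcd_mul_right, (col_coprime A), one_mul]
  rwa [Nat.mul_div_cancel' (tg_dvd (L := L) A)] at h2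

include hf hp in
lemma n_xg {A B : SL(2, ℤ)} (h : xg L A = xg L B) : n A = n B := by
  have ht : tg L A = tg L B := by
    have h1 : L / tg L A = L / tg L B := by rw [← xg_gcd, ← xg_gcd, h]
    have h2 := Nat.div_mul_cancel (tg_dvd (L := L) A)
    have h3 := Nat.div_mul_cancel (tg_dvd (L := L) B)
    have hpos : 0 < L / tg L A := Nat.div_pos (Nat.le_of_dvd Lpos (tg_dvd A)) (tg_pos A)
    rw [← h1] at h3
    exact Nat.eq_of_mul_eq_mul_left hpos (h2.trans h3.symm)
  obtain ⟨dA, hdA, hA⟩ := exists_unit (L := L) A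
  obtain ⟨dB, hdB, hB⟩ := exists_unit (L := L) B
  rw [← ht] at hB
  set t := tg L A with htt
  -- a_A - a_B = j t
  have hj : ∃ j : ZMod L, col L A 0 = col L B 0 + j * (t : ℕ) := by
    unfold xg at h
    rw [← ht, ← htt, ← sub_eq_zero, ← sub_mul] at h
    set y := col L A 0 - col L B 0 with hy
    have hdvd : L ∣ y.val * (L / t) := by
      rw [← ZMod.natCast_eq_zero_iff]; push_cast; simpa using h
    have hpos : 0 < L / t := Nat.div_pos (Nat.le_of_dvd Lpos (tg_dvd A)) (tg_pos A)
    have hdvd' : t ∣ y.val := by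
      have h2 : t * (L / t) = L := Nat.mul_div_cancel' (tg_dvd (L := L) A)
      exact Nat.dvd_of_mul_dvd_mul_right hpos (by rw [h2]; exact hdvd)
    obtain ⟨j, hj⟩ := hdvd'
    refine ⟨j, ?_⟩
    have : y = ((t * j : ℕ) : ZMod L) := by rw [← hj]; simp
    push_cast at this
    linear_combination this
  obtain ⟨j, hj⟩ := hj
  obtain ⟨uA, rfl⟩ := hdA
  obtain ⟨uB, rfl⟩ := hdB
  set k : ℕ := (j * ((uB⁻¹ : (ZMod L)ˣ) : ZMod L)).val with hk
  have hkz : (k : ZMod L) = j * ((uB⁻¹ : (ZMod L)ˣ) : ZMod L) := by rw [hk]; simp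
  rw [← hf.n_shift hp.shift B k]
  have hcol0 : col L (T ^ k * B) 0 = col L B 0 + k * col L B 1 := by
    have := red_mul (L := L) (T ^ (k : ℤ)) B
    rw [red_T, zpow_natCast] at this
    have e := congrFun (congrFun this 0) 0
    rw [Matrix.mul_apply, Fin.sum_univ_two] at e
    simpa [col] using e
  have hcol1 : col L (T ^ k * B) 1 = col L B 1 := by
    have := red_mul (L := L) (T ^ (k : ℤ)) B
    rw [red_T, zpow_natCast] at this
    have e := congrFun (congrFun this 1) 0
    rw [Matrix.mul_apply, Fin.sum_univ_two] at e
    simpa [col] using e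
  have hBi : ((uB⁻¹ : (ZMod L)ˣ) : ZMod L) * uB = 1 := by simp
  have hAi : ((uA⁻¹ : (ZMod L)ˣ) : ZMod L) * uA = 1 := by simp
  refine n_twist hf hp (d := ((uB * uA⁻¹ : (ZMod L)ˣ) : ZMod L).val) (unit_val_coprime (Units.isUnit _)) ?_ ?_
  · rw [hcol0, hj, hB, hkz]; linear_combination j * (t : ℕ) * hBi
  · rw [hcol1, ZMod.natCast_zmod_val, hA, hB, Units.val_mul]; linear_combination -(uB : ZMod L) * t * hAi

lemma sum_ch1 (w : ZMod L) : ∑ b : ZMod L, ch (w * b) = if w = 0 then (L : ℂ) else 0 := by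
  have := sum_ch (L := L) (ι := Unit) (fun _ => w)
  have e : ∑ x : Unit → ZMod L, ch ((fun _ => w) ⬝ᵥ x) = ∑ b : ZMod L, ch (w * b) := by
    refine Fintype.sum_equiv (Equiv.funUnique Unit (ZMod L)) _ _ fun x => ?_
    simp [dotProduct]
  rw [e] at this
  rw [this]
  simp [funext_iff, ZMod.card]

lemma distribution (y c u : ZMod L) (hu : IsUnit u) (t : ℕ) (ht : t ∣ L) (htp : 0 < t) (hc : c = u * t) :
    (L : ℤ) * ∑ b : ZMod L, oo (y + c * b) = t ^ 2 * oo (y * ((L / t : ℕ) : ZMod L)) := by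
  set v := L / t with hv
  have hvt : v * t = L := Nat.div_mul_cancel ht
  have hvp : 0 < v := Nat.div_pos (Nat.le_of_dvd Lpos ht) htp
  have h1 : HasSum (fun n : ℕ => ∑ b : ZMod L, 1 / (n : ℂ) ^ 2 *
    ((ch ((n : ZMod L) * (y + c * b)) + ch (-((n : ZMod L) * (y + c * b)))) / 2)) (∑ b : ZMod L, (π : ℂ) ^ 2 / (6 * L ^ 2) * oo (y + c * b)) :=
    hasSum_sum fun b _ => hasSum_oo _
  have hzero : ∀ n : ℕ, (n : ZMod L) * c = 0 ↔ v ∣ n := by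
    intro n
    rw [hc, mul_comm u, ← mul_assoc, hu.mul_left_eq_zero, ← Nat.cast_mul, ZMod.natCast_eq_zero_iff]
    nth_rw 1 [← hvt]
    exact ⟨fun h => Nat.dvd_of_mul_dvd_mul_right htp h, fun h => Nat.mul_dvd_mul_right h t⟩
  have h2 : ∀ n : ℕ, ∑ b : ZMod L, 1 / (n : ℂ) ^ 2 *
    ((ch ((n : ZMod L) * (y + c * b)) + ch (-((n : ZMod L) * (y + c * b)))) / 2) =
      if v ∣ n then L * (1 / (n : ℂ) ^ 2 * ((ch ((n : ZMod L) * y) + ch (-((n : ZMod L) * y))) / 2)) else 0 := by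
    intro n
    have e1 : ∀ b : ZMod L, ch ((n : ZMod L) * (y + c * b)) = ch ((n : ZMod L) * y) * ch (((n : ZMod L) * c) * b) := by
      intro b
      rw [ch, ch, ch, ← AddChar.map_add_eq_mul]; congr 1; ring
    have e2 : ∀ b : ZMod L, ch (-((n : ZMod L) * (y + c * b))) = ch (-((n : ZMod L) * y)) * ch (-((n : ZMod L) * c) * b) := by
      intro b
      rw [ch, ch, ch, ← AddChar.map_add_eq_mul]; congr 1; ring
    rw [← Finset.mul_sum, ← Finset.sum_div, Finset.sum_add_distrib]
    simp_rw [e1, e2, ← Finset.mul_sum, sum_ch1, neg_eq_zero, hzero]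
    split_ifs <;> ring
  simp_rw [h2] at h1
  have hinj : Function.Injective (fun k : ℕ => v * k) := fun a b h => Nat.eq_of_mul_eq_mul_left hvp h
  rw [← hinj.hasSum_iff] at h1
  swap
  · intro x hx
    rw [if_neg]
    rintro ⟨j, rfl⟩; exact hx ⟨j, rfl⟩
  have h3 := (hasSum_oo (y * (v : ZMod L))).mul_left ((L : ℂ) / v ^ 2)
  have hvc : (v : ℂ) ≠ 0 := by exact_mod_cast hvp.ne'
  have h4 := h1.unique (h3.congr_fun (fun k => by
    simp only [Function.comp]
    rw [if_pos (Dvd.intro _ rfl)]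
    have : ((v * k : ℕ) : ZMod L) * y = k * (y * v) := by push_cast; ring
    rw [this]
    by_cases hk : (k : ℂ) = 0
    · push_cast; simp [hk]
    · push_cast; field_simp) |> id)
  rw [← Finset.mul_sum] at h4
  have hL : (L : ℂ) ≠ 0 := Lne
  have hvt' : (v : ℂ) * t = L := by exact_mod_cast hvt
  have hpi : (π : ℂ) ≠ 0 := by exact_mod_cast Real.pi_ne_zero
  have h5 : (L : ℂ) * ∑ b : ZMod L, (oo (y + c * b) : ℂ) = t ^ 2 * oo (y * (v : ZMod L)) := by
    have h6 : (v : ℂ) ^ 2 * ∑ b : ZMod L, (oo (y + c * b) : ℂ) = L * oo (y * (v : ZMod L)) := by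
      field_simp at h4
      rw [mul_comm]; exact h4
    apply mul_left_cancel₀ (pow_ne_zero 2 hvc)
    linear_combination (L : ℂ) * h6 - (oo (y * (v : ZMod L)) : ℂ) * (v * t + L) * hvt'
  exact_mod_cast h5

include hf hp in
lemma exists_m : ∃ (N : ℕ) (m : ZMod L → ℤ), 0 < N ∧ m 0 = 0 ∧
    ∑ r, m r * (L * oo r) = (N : ℤ) * n 1 ∧
    ∃ c : ℂ, c ≠ 0 ∧ ∀ z, f z ^ N = c * ∏ u : Fin 2 → ZMod L, XX L u z ^ m (u 0) := by
  classical
  let g : (Unit → ZMod L) → ℚ := fun x => if h : ∃ A, xg L A = x () then (L : ℚ) / (tg L h.choose : ℚ) ^ 2 * n h.choose else 0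
  have hgA : ∀ A, g (fun _ => xg L A) = (L : ℚ) / (tg L A : ℚ) ^ 2 * n A := by
    intro A
    have h : ∃ B, xg L B = xg L A := ⟨A, rfl⟩
    simp only [g]
    rw [dif_pos h]
    have ht : tg L h.choose = tg L A := by
      have h1 : L / tg L h.choose = L / tg L A := by rw [← xg_gcd, ← xg_gcd, h.choose_spec]
      have h2 := Nat.div_mul_cancel (tg_dvd (L := L) h.choose)
      have h3 := Nat.div_mul_cancel (tg_dvd (L := L) A)
      have hpos : 0 < L / tg L A := Nat.div_pos (Nat.le_of_dvd Lpos (tg_dvd A)) (tg_pos A)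
      rw [h1] at h2
      exact Nat.eq_of_mul_eq_mul_left hpos (h2.trans h3.symm)
    rw [ht, n_xg hf hp h.choose_spec]
  have hcolneg : ∀ A i, col L (-A) i = - col L A i := by
    intro A i
    simp [col, red]
  have htneg : ∀ A, tg L (-A) = tg L A := by
    intro A
    unfold tg
    rw [hcolneg]
    by_cases h : col L A 1 = 0
    · rw [h]; simp
    · rw [ZMod.neg_val, if_neg h]
      exact Nat.gcd_self_sub_left (ZMod.val_lt _).le
  have hxneg : ∀ A, xg L (-A) = - xg L A := by
    intro A
    unfold xg
    rw [htneg, hcolneg]; ring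
  have hgev : ∀ x, g (-x) = g x := by
    intro x
    by_cases h : ∃ A, xg L A = x ()
    · obtain ⟨A, hA⟩ := h
      have e1 : x = fun _ => xg L A := by funext; exact hA.symm
      have e2 : -x = fun _ => xg L (-A) := by funext; rw [hxneg, hA]; rfl
      rw [e2, hgA, e1, hgA, htneg, hf.n_neg]
    · have h' : ¬ ∃ A, xg L A = (-x) () := by
        rintro ⟨A, hA⟩
        exact h ⟨-A, by rw [hxneg, hA]; simp⟩
      simp only [g]
      rw [dif_neg h, dif_neg h']
  obtain ⟨N, M, hN, hM⟩ := bern_inversion g hgev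
  set m : ZMod L → ℤ := fun r => M (fun _ => r) with hm
  have hm1 : ∀ x : ZMod L, ∑ r, (m r : ℚ) * (oo (r * x) : ℚ) = N * g (fun _ => x) := by
    intro x
    rw [← hM (fun _ => x)]
    symm
    refine Fintype.sum_equiv (Equiv.funUnique Unit (ZMod L)) _ _ fun u => ?_
    rw [hm]
    simp only [dotProduct, Equiv.funUnique_apply]
    congr 2
    simp
  have hA : ∀ A, ∑ u : Fin 2 → ZMod L, m (u 0) * ordX L (u ᵥ* red L A) = (N : ℤ) * n A := by
    intro A
    obtain ⟨u, hu, hc⟩ := exists_unit (L := L) A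
    have e1 : ∑ u : Fin 2 → ZMod L, m (u 0) * ordX L (u ᵥ* red L A) = ∑ r, m r * ∑ b, oo (r * col L A 0 + col L A 1 * b) := by
      simp_rw [Finset.mul_sum]
      rw [← Fintype.sum_prod_type']
      refine Fintype.sum_equiv (finTwoArrowEquiv (ZMod L)) _ _ fun w => ?_
      rw [ordX_vecMul]
      simp only [dotProduct, Fin.sum_univ_two]
      show m (w 0) * _ = m (w 0) * oo (w 0 * _ + _ * w 1)
      congr 2
      ring
    have e2 : ∀ r, (L : ℤ) * ∑ b, oo (r * col L A 0 + col L A 1 * b) = tg L A ^ 2 * oo (r * xg L A) := by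
      intro r
      rw [distribution _ _ u hu (tg L A) (tg_dvd A) (tg_pos A) hc, xg, mul_assoc]
    have e3 : (L : ℤ) * ∑ u : Fin 2 → ZMod L, m (u 0) * ordX L (u ᵥ* red L A) = L * (N * n A) := by
      rw [e1, Finset.mul_sum]
      have : ∀ r, (L : ℤ) * (m r * ∑ b, oo (r * col L A 0 + col L A 1 * b)) = tg L A ^ 2 * (m r * oo (r * xg L A)) := by
        intro r; rw [mul_left_comm, e2]; ring
      simp_rw [this]
      rw [← Finset.mul_sum]
      have h := hm1 (xg L A)
      rw [hgA] at h
      have ht : (tg L A : ℚ) ≠ 0 := by exact_mod_cast (tg_pos A).ne'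
      have : ((tg L A ^ 2 * ∑ r, m r * oo (r * xg L A) : ℤ) : ℚ) = ((L * (N * n A) : ℤ) : ℚ) := by
        push_cast
        rw [h]; field_simp
      exact_mod_cast this
    exact mul_left_cancel₀ (by exact_mod_cast NeZero.ne L) e3
  have hm0 : m 0 = 0 := M0_eq hf (fun u => m (u 0)) N hA
  obtain ⟨c, hc, h⟩ := key_lemma hf (fun u => m (u 0)) N hA
  refine ⟨N, m, hN, hm0, ?_, c, hc, fun z => by rw [← h z, zpow_natCast]⟩
  rw [← hA 1]
  simp_rw [red_one, Matrix.vecMul_one, ordX_eq_oo]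
  symm
  rw [Fintype.sum_equiv (finTwoArrowEquiv (ZMod L)) (fun u => m (u 0) * oo (u 0)) (fun w => m w.1 * oo w.1) (fun u => rfl),
    Fintype.sum_prod_type]
  simp only [Finset.sum_const, Finset.card_univ, ZMod.card, nsmul_eq_mul]
  exact Finset.sum_congr rfl fun r _ => by ring

end P5
end SU

namespace SU
set_option linter.unusedSectionVars false
variable {L : ℕ} [NeZero L]
open ModularGroup

/-- `∏_{n ≡ r (mod L)} (1 - q^n)`. -/
def qp (L : ℕ) (r : ZMod L) (z : ℍ) : ℂ := ∏' n : ℕ, (1 - cc r (1 : ℂ) n * QQ 1 z ^ (n + 1))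

lemma qp_ne_zero (r : ZMod L) (z : ℍ) : qp L r z ≠ 0 :=
  tprod_c_ne_zero (norm_cc_le _ (by simp)) (norm_QQ_lt one_pos z)

lemma hasPS_qp (r : ZMod L) : HasPS 1 (prodPS (cc r (1 : ℂ))) (qp L r) := fun z =>
  Ev_prodPS (norm_cc_le _ (by simp)) (norm_QQ_lt one_pos z)

lemma prod_roots (w : ℂ) : ∏ b : ZMod L, (1 - zt L ^ b.val * w) = 1 - w ^ L := by
  have h := (zt_primitive (L := L)).pow_sub_pow_eq_prod_sub_mul 1 w Lpos
  rw [one_pow] at h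
  rw [h]
  refine Finset.prod_nbij (fun b => zt L ^ b.val) ?_ ?_ ?_ ?_
  · intro b _
    rw [Polynomial.mem_nthRootsFinset Lpos, ← pow_mul, mul_comm, pow_mul, zt_primitive.pow_eq_one, one_pow]
  · intro a _ b _ hab
    have := zt_primitive.pow_inj (ZMod.val_lt a) (ZMod.val_lt b) hab
    exact ZMod.val_injective L this
  · intro ζ hζ
    rw [Finset.mem_coe, Polynomial.mem_nthRootsFinset Lpos] at hζ
    obtain ⟨i, hi, rfl⟩ := zt_primitive.eq_pow_of_pow_eq_one hζ
    exact ⟨(i : ZMod L), by simp, by simp [ZMod.val_natCast_of_lt hi]⟩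
  · intro b _; rfl

lemma zt_neg (b : ZMod L) : zt L ^ (L - b.val) = zt L ^ (-b).val := by
  have hprim := zt_primitive (L := L)
  rw [ZMod.neg_val]
  split_ifs with h
  · subst h; simp [hprim.pow_eq_one]
  · rfl

lemma prod_roots' (w : ℂ) : ∏ b : ZMod L, (1 - zt L ^ (L - b.val) * w) = 1 - w ^ L := by
  rw [← prod_roots (L := L) w]
  refine Fintype.prod_equiv (Equiv.neg _) _ _ fun b => ?_
  rw [zt_neg]; rfl

lemma prod_tprod (r : ZMod L) (w : ZMod L → ℂ) (hw : ∀ b, ‖w b‖ = 1)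
    (hpr : ∀ x : ℂ, ∏ b, (1 - w b * x) = 1 - x ^ L) (z : ℍ) :
    ∏ b, ∏' n, (1 - cc r (w b) n * QQ L z ^ (n + 1)) = qp L r z := by
  rw [← Multipliable.tprod_finsetProd (fun b _ => multipliable_c (norm_cc_le _ (hw b)) (norm_QQ_lt Lpos z)), qp]
  refine tprod_congr fun n => ?_
  unfold cc
  split_ifs with h
  · rw [hpr, one_mul, ← pow_mul, mul_comm (n + 1), pow_mul, QQ_pow_L, QQ_one]
  · simp

lemma prod_Yf (r : ZMod L) (hr : r ≠ 0) : ∃ c : ℂ, c ≠ 0 ∧ ∀ z, ∏ b : ZMod L, Yf L ![r, b] z =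
    c * (qp L r z * qp L (-r) z) ^ (12 * L) := by
  refine ⟨∏ b : ZMod L, zt L ^ (6 * (r.val * b.val)), Finset.prod_ne_zero_iff.mpr fun b _ => pow_ne_zero _ (ee_ne_zero _), fun z => ?_⟩
  rw [← prod_tprod r (fun b => zt L ^ b.val) (fun b => norm_zt_pow _) prod_roots z,
    ← prod_tprod (-r) (fun b => zt L ^ (L - b.val)) (fun b => norm_zt_pow _) prod_roots' z,
    ← Finset.prod_mul_distrib, ← Finset.prod_pow, ← Finset.prod_mul_distrib]
  refine Finset.prod_congr rfl fun b _ => ?_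
  unfold Yf kap
  simp [hr]

section
variable {f : ℍ → ℂ} {n : SL(2, ℤ) → ℤ} (hf : Good L f n) {p : PowerSeries ℚ} (hp : RExp L f (n 1) p)

include hf hp in
lemma exists_b : ∃ (N : ℕ) (b : ZMod L → ℤ), 0 < N ∧ b 0 = 0 ∧ (∀ r, b (-r) = b r) ∧
    ∑ r, b r * oo r = 24 * (N * n 1) ∧
    ∃ c : ℂ, c ≠ 0 ∧ ∀ z, (f z * QQ L z ^ (-n 1)) ^ N = c * ∏ r, qp L r z ^ b r := by
  classical
  obtain ⟨N, m, hN, hm0, hord, c, hc, h⟩ := exists_m hf hp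
  refine ⟨N, fun r => 12 * L * (m r + m (-r)), hN, by simp [hm0], fun r => by simp only [neg_neg]; ring, ?_, ?_⟩
  · have e : ∑ r, m (-r) * oo r = ∑ r, m r * oo r :=
      Fintype.sum_equiv (Equiv.neg (ZMod L)) _ _ fun r => by
        rw [Equiv.neg_apply, oo_neg]
    have e1 : ∑ r, 12 * (L : ℤ) * (m r + m (-r)) * oo r = 12 * L * (∑ r, m r * oo r + ∑ r, m (-r) * oo r) := by
      rw [← Finset.sum_add_distrib, Finset.mul_sum]
      exact Finset.sum_congr rfl fun r _ => by ring
    rw [e1, e, ← hord]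
    have : ∑ r, m r * (L * oo r) = L * ∑ r, m r * oo r := by
      rw [Finset.mul_sum]; exact Finset.sum_congr rfl fun r _ => by ring
    rw [this]; ring
  · have hch : ∀ r : ZMod L, ∃ c : ℂ, c ≠ 0 ∧ ∀ z, (∏ b : ZMod L, Yf L ![r, b] z) ^ m r =
        c * (qp L r z ^ (12 * L * m r) * qp L (-r) z ^ (12 * L * m r)) := by
      intro r
      by_cases hr : r = 0
      · subst hr; exact ⟨1, one_ne_zero, fun z => by simp [hm0]⟩
      · obtain ⟨c, hc, h⟩ := prod_Yf r hr
        refine ⟨c ^ m r, zpow_ne_zero _ hc, fun z => ?_⟩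
        rw [h, mul_zpow, ← zpow_natCast, ← _root_.zpow_mul, mul_zpow]
        push_cast; rfl
    choose k hk hk' using hch
    refine ⟨c * ∏ r, k r, mul_ne_zero hc (Finset.prod_ne_zero_iff.mpr fun r _ => hk r), fun z => ?_⟩
    have e1 : ∏ u : Fin 2 → ZMod L, XX L u z ^ m (u 0) = QQ L z ^ (N * n 1) * ∏ r, (∏ b, Yf L ![r, b] z) ^ m r := by
      simp_rw [XX_eq, mul_zpow, Finset.prod_mul_distrib, ← _root_.zpow_mul]
      rw [prod_zpow_sum _ (QQ_ne_zero L z)]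
      refine congrArg₂ (· * ·) (congrArg _ ?_) ?_
      · rw [← hord]
        simp_rw [ordX_eq_oo]
        rw [Fintype.sum_equiv (finTwoArrowEquiv (ZMod L)) (fun u => oo (u 0) * m (u 0)) (fun w => oo w.1 * m w.1) (fun u => rfl),
          Fintype.sum_prod_type]
        simp only [Finset.sum_const, Finset.card_univ, ZMod.card, nsmul_eq_mul]
        exact Finset.sum_congr rfl fun r _ => by ring
      · simp_rw [← Finset.prod_zpow]
        rw [← Fintype.prod_prod_type']
        refine Fintype.prod_equiv (finTwoArrowEquiv (ZMod L)) _ _ fun w => ?_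
        show _ = Yf L ![w 0, w 1] z ^ m (w 0)
        congr 2
        funext i; fin_cases i <;> rfl
    have e2 : ∏ r, (∏ b, Yf L ![r, b] z) ^ m r = (∏ r, k r) * ∏ r, qp L r z ^ (12 * L * (m r + m (-r))) := by
      simp_rw [hk', Finset.prod_mul_distrib]
      congr 1
      have : ∏ r, qp L (-r) z ^ (12 * L * m r) = ∏ r, qp L r z ^ (12 * L * m (-r)) :=
        Fintype.prod_equiv (Equiv.neg (ZMod L)) _ _ fun r => by simp
      rw [this, ← Finset.prod_mul_distrib]
      refine Finset.prod_congr rfl fun r _ => ?_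
      rw [← zpow_add₀ (qp_ne_zero r z), mul_add]
    rw [mul_pow, h, e1, e2, ← zpow_natCast, ← _root_.zpow_mul, show -n 1 * (N : ℤ) = -(N * n 1) by ring, _root_.zpow_neg]
    have := zpow_ne_zero (N * n 1) (QQ_ne_zero L z)
    field_simp
end
end SU

namespace SU
set_option linter.unusedSectionVars false

/-- Power series over `ℂ` all of whose coefficients are algebraic integers. -/
def Oser : Subring (PowerSeries ℂ) :=
  (PowerSeries.map (algebraMap (integralClosure ℤ ℂ) ℂ)).range

lemma mem_Oser {p : PowerSeries ℂ} : p ∈ Oser ↔ ∀ n, IsIntegral ℤ (PowerSeries.coeff n p) := by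
  constructor
  · rintro ⟨q, rfl⟩ n
    rw [PowerSeries.coeff_map]
    exact (PowerSeries.coeff n q).2
  · intro h
    refine ⟨PowerSeries.mk fun n => ⟨PowerSeries.coeff n p, h n⟩, ?_⟩
    ext n
    simp [PowerSeries.coeff_map]

lemma X_mem_Oser : (PowerSeries.X : PowerSeries ℂ) ∈ Oser :=
  ⟨PowerSeries.X, by simp⟩

/-- The `ℂ`-algebra generated by `Oser`. -/
def WW : Subalgebra ℂ (PowerSeries ℂ) := Algebra.adjoin ℂ (Oser : Set (PowerSeries ℂ))

lemma Oser_le_WW {p : PowerSeries ℂ} (h : p ∈ Oser) : p ∈ WW := Algebra.subset_adjoin h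

lemma WW_eq_span : Subalgebra.toSubmodule WW = Submodule.span ℂ (Oser : Set (PowerSeries ℂ)) := by
  refine Algebra.adjoin_eq_span_of_subset _ ?_
  have : Submonoid.closure (Oser : Set (PowerSeries ℂ)) = Oser.toSubmonoid :=
    Submonoid.closure_eq Oser.toSubmonoid
  rw [this]
  exact Submodule.subset_span

lemma expand_mem_Oser {L : ℕ} (hL : L ≠ 0) {p : PowerSeries ℂ} (h : p ∈ Oser) :
    PowerSeries.expand L hL p ∈ Oser := by
  rw [mem_Oser] at *
  intro n
  rw [PowerSeries.coeff_expand]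
  split_ifs
  · exact h _
  · exact isIntegral_zero

lemma expand_mem_WW {L : ℕ} (hL : L ≠ 0) {p : PowerSeries ℂ} (h : p ∈ WW) :
    PowerSeries.expand L hL p ∈ WW := by
  unfold WW at h
  induction h using Algebra.adjoin_induction with
  | mem x hx => exact Oser_le_WW (expand_mem_Oser hL hx)
  | algebraMap r =>
    rw [AlgHom.commutes]; exact WW.algebraMap_mem r
  | add x y _ _ hx hy => rw [map_add]; exact WW.add_mem hx hy
  | mul x y _ _ hx hy => rw [map_mul]; exact WW.mul_mem hx hy

lemma exists_den {a : ℂ} (ha : IsAlgebraic ℚ a) : ∃ D : ℕ, 0 < D ∧ IsIntegral ℤ ((D : ℂ) * a) := by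
  have h : IsAlgebraic ℤ a := (IsFractionRing.isAlgebraic_iff ℤ ℚ ℂ).mpr ha
  obtain ⟨y, hy, hy2⟩ := h.exists_integral_multiple
  refine ⟨y.natAbs, Int.natAbs_pos.mpr hy, ?_⟩
  rw [zsmul_eq_mul] at hy2
  rcases Int.natAbs_eq y with h | h
  · have e : (y : ℂ) = ((y.natAbs : ℕ) : ℂ) := by
      conv_lhs => rw [h, Int.cast_natCast]
    rwa [e] at hy2
  · have e : (y : ℂ) = -((y.natAbs : ℕ) : ℂ) := by
      conv_lhs => rw [h, Int.cast_neg, Int.cast_natCast]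
    rw [e] at hy2
    have := hy2.neg; simpa using this

lemma exists_proj : ∃ φ : ℂ →+ ℂ, (∀ x, IsAlgebraic ℚ (φ x)) ∧
    (∀ a x, IsAlgebraic ℚ a → φ (a * x) = a * φ x) ∧ ∀ a, IsAlgebraic ℚ a → φ a = a := by
  let K := algebraicClosure ℚ ℂ
  obtain ⟨g, hg⟩ := LinearMap.exists_leftInverse_of_injective (Algebra.linearMap K ℂ)
    (LinearMap.ker_eq_bot.mpr (FaithfulSMul.algebraMap_injective K ℂ))
  refine ⟨(algebraMap K ℂ).toAddMonoidHom.comp g.toAddMonoidHom, fun x => ?_, fun a x ha => ?_, fun a ha => ?_⟩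
  · exact (mem_algebraicClosure_iff).mp (g x).2
  · have h := g.map_smul (⟨a, mem_algebraicClosure_iff.mpr ha⟩ : K) x
    have h2 : (⟨a, mem_algebraicClosure_iff.mpr ha⟩ : K) • x = a * x := rfl
    rw [h2] at h
    show ((g (a * x) : K) : ℂ) = a * ((g x : K) : ℂ)
    rw [h]; rfl
  · have := LinearMap.congr_fun hg (⟨a, mem_algebraicClosure_iff.mpr ha⟩ : K)
    show ((g a : K) : ℂ) = a
    have h2 : g a = ⟨a, mem_algebraicClosure_iff.mpr ha⟩ := this
    rw [h2]

lemma WW_den {w : PowerSeries ℂ} (hw : w ∈ WW) (halg : ∀ n, IsAlgebraic ℚ (PowerSeries.coeff n w)) :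
    ∃ D : ℕ, 0 < D ∧ (D : PowerSeries ℂ) * w ∈ Oser := by
  obtain ⟨φ, h1, h2, h3⟩ := exists_proj
  have key : ∀ t : ℂ, ∃ D : ℕ, 0 < D ∧ ∀ n, IsIntegral ℤ ((D : ℂ) * φ (t * PowerSeries.coeff n w)) := by
    have hw' : w ∈ Submodule.span ℂ (Oser : Set (PowerSeries ℂ)) := by
      rw [← WW_eq_span]; exact hw
    clear halg hw
    induction hw' using Submodule.span_induction with
    | mem x hx =>
      intro t
      obtain ⟨D, hD, hD2⟩ := exists_den (h1 t)
      refine ⟨D, hD, fun n => ?_⟩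
      have hc := mem_Oser.mp hx n
      have hc' : IsAlgebraic ℚ (PowerSeries.coeff n x) :=
        (IsFractionRing.isAlgebraic_iff ℤ ℚ ℂ).mp hc.isAlgebraic
      rw [mul_comm t, h2 _ _ hc', mul_left_comm]
      exact hc.mul hD2
    | zero => intro t; exact ⟨1, one_pos, fun n => by simpa using isIntegral_zero⟩
    | add x y _ _ hx hy =>
      intro t
      obtain ⟨D, hD, hD2⟩ := hx t
      obtain ⟨E, hE, hE2⟩ := hy t
      refine ⟨D * E, Nat.mul_pos hD hE, fun n => ?_⟩
      have e : ((D * E : ℕ) : ℂ) * φ (t * PowerSeries.coeff n (x + y)) =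
        (E : ℂ) * (D * φ (t * PowerSeries.coeff n x)) + D * (E * φ (t * PowerSeries.coeff n y)) := by
        rw [map_add, mul_add, map_add]; push_cast; ring
      rw [e]
      have hn : ∀ k : ℕ, IsIntegral ℤ (k : ℂ) := fun k => by
        simpa using (isIntegral_algebraMap (R := ℤ) (A := ℂ) (x := (k : ℤ)))
      exact ((hn E).mul (hD2 n)).add ((hn D).mul (hE2 n))
    | smul a x _ hx =>
      intro t
      obtain ⟨D, hD, hD2⟩ := hx (t * a)
      refine ⟨D, hD, fun n => ?_⟩
      have := hD2 n
      rwa [mul_assoc] at this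
  obtain ⟨D, hD, hD2⟩ := key 1
  refine ⟨D, hD, mem_Oser.mpr fun n => ?_⟩
  have := hD2 n
  rw [one_mul, h3 _ (halg n)] at this
  have e : (D : PowerSeries ℂ) = PowerSeries.C (D : ℂ) := by simp
  rw [e, PowerSeries.coeff_C_mul]
  exact this

end SU

namespace SU
set_option linter.unusedSectionVars false
variable {L : ℕ} [NeZero L]
open ModularGroup
open scoped ModularForm

lemma zt_integral : IsIntegral ℤ (zt L) := by
  refine IsIntegral.of_pow (n := L) Lpos ?_
  rw [zt_primitive.pow_eq_one]; exact isIntegral_one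

lemma YY_mem_Oser (u : Fin 2 → ZMod L) : YY (zt L) u ∈ Oser := by
  refine ⟨YY (⟨zt L, zt_integral⟩ : integralClosure ℤ ℂ) u, ?_⟩
  rw [map_YY]; rfl

lemma hasPS_qExp {k : ℤ} (F : ModularForm 𝒮ℒ k) : HasPS 1 (qExpansion 1 F) F := by
  intro z
  have h := ModularForm.hasSum_qExpansion F one_pos one_mem_strictPeriods_SL z
  unfold Ev
  refine h.congr_fun ?_ |> id
  intro n
  rw [QQ_one]
  simp [ee, Function.Periodic.qParam]

lemma qExp_disc : qExpansion 1 ModularForm.discriminant ∈ Oser := by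
  have h1 : HasPS 1 (qExpansion 1 ModularForm.discriminant) ModularForm.discriminant := by
    intro z
    have h := ModularForm.hasSum_qExpansion CuspForm.discriminant one_pos one_mem_strictPeriods_SL z
    unfold Ev
    refine h.congr_fun ?_ |> id
    intro n
    rw [QQ_one]
    simp [ee, Function.Periodic.qParam]
  have h2 : HasPS 1 (PowerSeries.X ^ 1 * YY (L := 1) (zt 1) 0) ModularForm.discriminant := by
    intro z
    have h := (HasPS.X_pow (L := 1) 1).mul (hasPS_Yf (L := 1) 0) z
    have e := XX_eq (L := 1) 0 z
    have e2 : ordX 1 0 = 1 := by unfold ordX; simp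
    rw [e2] at e
    simp only [XX, if_true, pow_one, zpow_one] at e
    rw [e]
    simpa using h
  rw [h1.unique one_pos h2]
  exact Oser.mul_mem (Oser.pow_mem X_mem_Oser 1) (YY_mem_Oser 0)

/-- the Eisenstein series of weight 4 -/
abbrev E4 : ModularForm 𝒮ℒ 4 := ModularForm.E (k := 4) (by norm_num)

lemma qExp_E4 : qExpansion 1 E4 ∈ WW := by
  have e : qExpansion 1 E4 = 1 + (-(2 * (4 : ℕ) / bernoulli 4 : ℂ)) • (PowerSeries.mk fun m => if m = 0 then (0 : ℂ) else (ArithmeticFunction.sigma 3 m : ℂ)) := by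
    ext m
    rw [EisensteinSeries.E_qExpansion_coeff (k := 4) (by norm_num) (by decide), map_add, PowerSeries.coeff_one,
      PowerSeries.coeff_smul, PowerSeries.coeff_mk]
    by_cases h : m = 0
    · simp [h]
    · simp [h]
  rw [e]
  refine WW.add_mem WW.one_mem (WW.smul_mem (Oser_le_WW (mem_Oser.mpr fun n => ?_)) _)
  rw [PowerSeries.coeff_mk]
  split_ifs
  · exact isIntegral_zero
  · simpa using (isIntegral_algebraMap (R := ℤ) (A := ℂ) (x := (ArithmeticFunction.sigma 3 n : ℤ)))

lemma level_one (K : ℕ) : ∀ {k : ℤ} (_ : k = 12 * K) (F : ModularForm 𝒮ℒ k), qExpansion 1 F ∈ WW := by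
  induction K with
  | zero =>
    intro k hk F
    obtain rfl : k = 0 := by simpa using hk
    obtain ⟨c, hc⟩ := ModularFormClass.levelOne_weight_zero_const F
    have h1 := hasPS_qExp F
    have h2 : HasPS 1 (PowerSeries.C c) F := by
      rw [hc]; exact HasPS.C c
    rw [h1.unique one_pos h2]
    exact WW.algebraMap_mem c
  | succ K ih =>
    intro k hk F
    let a := (qExpansion 1 F).coeff 0
    let E : ModularForm 𝒮ℒ k := ModularForm.mcast (by rw [hk]; push_cast; ring) (E4.pow (3 * (K + 1)))
    have hE : qExpansion 1 E = (qExpansion 1 E4) ^ (3 * (K + 1)) := by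
      unfold E
      rw [ModularForm.qExpansion_mcast]
      exact ModularForm.qExpansion_pow one_pos one_mem_strictPeriods_SL E4 _
    have hE0 : (qExpansion 1 E).coeff 0 = 1 := by
      rw [hE, PowerSeries.coeff_zero_eq_constantCoeff_apply, map_pow, ← PowerSeries.coeff_zero_eq_constantCoeff_apply,
        EisensteinSeries.E_qExpansion_coeff_zero (k := 4) (by norm_num) (by decide), one_pow]
    let H : ModularForm 𝒮ℒ k := F - a • E
    have hq : qExpansion 1 H = qExpansion 1 F - a • qExpansion 1 E := by
      unfold H
      rw [FunLike.coe_sub, ModularForm.qExpansion_sub one_pos one_mem_strictPeriods_SL, FunLike.coe_smul,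
        ModularForm.qExpansion_smul one_pos one_mem_strictPeriods_SL]
    have hH : (qExpansion 1 H).coeff 0 = 0 := by
      rw [hq, map_sub, PowerSeries.coeff_smul, hE0]; simp [a]
    have h3 := ModularForm.qExpansion_eq_qExpansion_discriminant_mul H hH
    have h4 := ih (k := k - 12) (by rw [hk]; push_cast; ring) (CuspForm.discriminantEquiv (ModularForm.toCuspForm H hH))
    have h5 : qExpansion 1 F = qExpansion 1 H + a • qExpansion 1 E := by rw [hq]; ring
    rw [h5, h3, hE]
    exact WW.add_mem (WW.mul_mem (Oser_le_WW qExp_disc) h4) (WW.smul_mem (WW.pow_mem qExp_E4 _) _)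

lemma level_one_ps {F : ℍ → ℂ} (hd : MDifferentiable 𝓘(ℂ) 𝓘(ℂ) F) (hi : ∀ (A : SL(2, ℤ)) z, F (A • z) = F z)
    (K : ℕ) (hb : IsBoundedAtImInfty (fun z => F z * XX L 0 z ^ K)) :
    ∃ p ∈ WW, HasPS L p (fun z => F z * XX L 0 z ^ K) := by
  have hs : ∀ A : SL(2, ℤ), (fun z => F z * XX L 0 z ^ K) ∣[((12 * (L * K : ℕ) : ℤ))] A = (fun z => F z * XX L 0 z ^ K) := by
    intro A
    funext z
    rw [ModularForm.SL_slash_apply]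
    simp only [hi, XX_smul, if_true, Matrix.zero_vecMul]
    have hd : denom A z ≠ 0 := denom_ne_zero _ _
    generalize denom A z = d at hd ⊢
    rw [_root_.zpow_neg]
    have e : d ^ (12 * ((L * K : ℕ) : ℤ)) = (d ^ (12 * L)) ^ K := by
      rw [← pow_mul, ← zpow_natCast]; congr 1; push_cast; ring
    rw [e]
    have : (d ^ (12 * L)) ^ K ≠ 0 := pow_ne_zero _ (pow_ne_zero _ hd)
    field_simp
    rw [mul_pow]; ring
  have hmd : MDifferentiable 𝓘(ℂ) 𝓘(ℂ) (fun z => F z * XX L 0 z ^ K) := by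
    refine mdiff_mul hd ?_
    simpa using mdiff_zpow (mdiff_XX (L := L) 0) (XX_ne_zero 0) K
  let M0 := mkMF ⊤ (12 * (L * K : ℕ) : ℤ) _ hmd (fun A _ => hs A) (fun A => by rw [hs A]; exact hb)
  let M1 : ModularForm 𝒮ℒ (12 * (L * K : ℕ) : ℤ) := ModularForm.mcast rfl M0 (MonoidHom.range_eq_map _)
  refine ⟨_, expand_mem_WW (NeZero.ne L) (level_one (L * K) rfl M1), ?_⟩
  exact HasPS.expand (hasPS_qExp M1)

end SU

namespace SU
set_option linter.unusedSectionVars false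
variable {L : ℕ} [NeZero L]
open ModularGroup
open scoped ModularForm

/-- functions with a Laurent expansion in `R` -/
def Mer (L : ℕ) (R : Subring (PowerSeries ℂ)) (hX : PowerSeries.X ∈ R) : Subring (ℍ → ℂ) where
  carrier := {F | ∃ K : ℕ, ∃ p ∈ R, HasPS L p (fun z => F z * QQ L z ^ K)}
  mul_mem' := by
    rintro F G ⟨K, p, hp, h⟩ ⟨K', p', hp', h'⟩
    refine ⟨K + K', p * p', R.mul_mem hp hp', fun z => ?_⟩
    have := h.mul h' z
    simp only [Pi.mul_apply, pow_add] at this ⊢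
    rwa [mul_mul_mul_comm]
  one_mem' := ⟨0, 1, R.one_mem, fun z => by simpa using Ev.one _⟩
  add_mem' := by
    rintro F G ⟨K, p, hp, h⟩ ⟨K', p', hp', h'⟩
    refine ⟨K + K', p * PowerSeries.X ^ K' + p' * PowerSeries.X ^ K, R.add_mem (R.mul_mem hp (R.pow_mem hX _)) (R.mul_mem hp' (R.pow_mem hX _)), fun z => ?_⟩
    have := (h.mul (HasPS.X_pow K')).add (h'.mul (HasPS.X_pow K)) z
    simp only [Pi.add_apply, pow_add] at this ⊢
    have e : (F z + G z) * (QQ L z ^ K * QQ L z ^ K') = F z * QQ L z ^ K * QQ L z ^ K' + G z * QQ L z ^ K' * QQ L z ^ K := by ring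
    rwa [e]
  zero_mem' := ⟨0, 0, R.zero_mem, fun z => by simpa using Ev.zero _⟩
  neg_mem' := by
    rintro F ⟨K, p, hp, h⟩
    refine ⟨K, -p, R.neg_mem hp, fun z => ?_⟩
    have := (h z).neg
    simpa using this

instance (R : Subring (PowerSeries ℂ)) (hX : PowerSeries.X ∈ R) : NoZeroDivisors (Mer L R hX) where
  eq_zero_or_eq_zero_of_mul_eq_zero := by
    rintro ⟨F, K, p, hp, h⟩ ⟨G, K', p', hp', h'⟩ h0
    have h0' : ∀ z, F z * G z = 0 := fun z => congrFun (congrArg Subtype.val h0) z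
    have h1 : HasPS L (p * p') (fun _ => 0) := by
      intro z
      have := h.mul h' z
      simp only at this
      rwa [mul_mul_mul_comm, h0', zero_mul] at this
    have key : ∀ {F : ℍ → ℂ} {K : ℕ} {p : PowerSeries ℂ}, HasPS L p (fun z => F z * QQ L z ^ K) → p = 0 → F = 0 := by
      intro F K p h hp
      subst hp
      funext z
      have h2 : F z * QQ L z ^ K = 0 := (h z).unique (Ev.zero _)
      exact (mul_eq_zero.mp h2).resolve_right (pow_ne_zero _ (QQ_ne_zero L z))
    rcases mul_eq_zero.mp (HasPS.eq_zero Lpos h1) with hh | hh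
    · left; exact Subtype.ext (key h hh)
    · right
      have hkey := key h' hh
      exact Subtype.ext hkey

/-- integral ones -/
abbrev MO (L : ℕ) : Subring (ℍ → ℂ) := Mer L Oser X_mem_Oser
/-- `W` ones -/
abbrev MW (L : ℕ) : Subring (ℍ → ℂ) := Mer L WW.toSubring (Oser_le_WW X_mem_Oser)

lemma MO_le_MW {F : ℍ → ℂ} (h : F ∈ MO L) : F ∈ MW L := by
  obtain ⟨K, p, hp, h⟩ := h
  exact ⟨K, p, Oser_le_WW hp, h⟩

lemma XX_mem (u : Fin 2 → ZMod L) : XX L u ∈ MO L := by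
  refine ⟨(-ordX L u).toNat, PowerSeries.X ^ (ordX L u).toNat * YY (zt L) u, Oser.mul_mem (Oser.pow_mem X_mem_Oser _) (YY_mem_Oser u), fun z => ?_⟩
  have h := (HasPS.X_pow (ordX L u).toNat).mul (hasPS_Yf u) z
  have e : XX L u z * QQ L z ^ (-ordX L u).toNat = QQ L z ^ (ordX L u).toNat * Yf L u z := by
    rw [XX_eq, ← zpow_split _ (QQ_ne_zero L z) (ordX L u)]; ring
  simp only [e]
  exact h

/-- the separating function -/
def hh (M : Matrix (Fin 2) (Fin 2) (ZMod L)) (z : ℍ) : ℂ := XX L (M 0) z * XX L (M 1) z ^ (2 * L ^ 2 + 1)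

lemma hh_mem (M : Matrix (Fin 2) (Fin 2) (ZMod L)) : hh M ∈ MO L :=
  (MO L).mul_mem (XX_mem (M 0)) ((MO L).pow_mem (XX_mem (M 1)) _)

lemma red_row_ne (h2 : 2 ≤ L) (A : SL(2, ℤ)) (i : Fin 2) : red L A i ≠ 0 := by
  intro h
  have : Fact (1 < L) := ⟨h2⟩
  have hd := red_det (L := L) A
  fin_cases i
  · have h0 := congrFun h 0
    have h1 := congrFun h 1
    simp at h0 h1
    simp [h0, h1] at hd
  · have h0 := congrFun h 0
    have h1 := congrFun h 1
    simp at h0 h1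
    simp [h0, h1] at hd

lemma hh_smul (h2 : 2 ≤ L) (A B : SL(2, ℤ)) (z : ℍ) : hh (red L A) (B • z) = hh (red L (A * B)) z := by
  unfold hh
  rw [XX_smul, XX_smul, if_neg (red_row_ne h2 A 0), if_neg (red_row_ne h2 A 1), one_mul, one_mul, red_mul]
  rfl

lemma hasOrd_hh (M : Matrix (Fin 2) (Fin 2) (ZMod L)) :
    HasOrd L (hh M) (oo (M 0 0) + (2 * L ^ 2 + 1) * oo (M 1 0)) := by
  refine ((hasOrd_XX (M 0)).mul ((hasOrd_XX (M 1)).zpow (2 * L ^ 2 + 1 : ℕ))).congr (fun z => ?_) ?_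
  · rw [zpow_natCast]; rfl
  · rw [ordX_eq_oo, ordX_eq_oo]; push_cast; rfl

lemma oo_bound (a : ZMod L) : -(L : ℤ) ^ 2 ≤ oo a ∧ oo a ≤ (L : ℤ) ^ 2 := by
  unfold oo
  have h1 : (a.val : ℤ) ≤ L := by exact_mod_cast (ZMod.val_lt a).le
  have h0 : (0 : ℤ) ≤ a.val := by positivity
  constructor <;> nlinarith [sq_nonneg (2 * (a.val : ℤ) - L)]

lemma oo_inj {a b : ZMod L} (h : oo a = oo b) : a = b ∨ a = -b := by
  unfold oo at h
  have h1 : ((a.val : ℤ) - b.val) * ((a.val : ℤ) + b.val - L) = 0 := by linarith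
  rcases mul_eq_zero.mp h1 with h | h
  · left; exact ZMod.val_injective L (by omega)
  · right
    have : ((a.val + b.val : ℕ) : ZMod L) = (L : ZMod L) := by congr 1; omega
    rw [Nat.cast_add, val_cast, val_cast, ZMod.natCast_self] at this
    exact eq_neg_of_add_eq_zero_left this

lemma digits {t a b c d : ℤ} {B : ℤ} (ht : 2 * B < t) (ha : |a| ≤ B) (hc : |c| ≤ B)
    (h : a + t * b = c + t * d) : a = c ∧ b = d := by
  rw [abs_le] at ha hc
  have hbd : b = d := by
    by_contra hne
    rcases lt_or_gt_of_ne hne with hlt | hlt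
    · have : t * (d - b) ≥ t * 1 := mul_le_mul_of_nonneg_left (by omega) (by omega)
      nlinarith
    · have : t * (b - d) ≥ t * 1 := mul_le_mul_of_nonneg_left (by omega) (by omega)
      nlinarith
  subst hbd
  exact ⟨by linarith, rfl⟩

lemma hh_sep (h2 : 2 ≤ L) {A : SL(2, ℤ)} (h : hh (red L A) = hh (red L 1)) : red L A = 1 ∨ red L A = -1 := by
  have key : ∀ B : SL(2, ℤ), oo (red L (A * B) 0 0) = oo (red L B 0 0) ∧ oo (red L (A * B) 1 0) = oo (red L B 1 0) := by
    intro B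
    have h1 : hh (red L (A * B)) = hh (red L B) := by
      funext z
      rw [← hh_smul h2, h, hh_smul h2, one_mul]
    have h3 := (hasOrd_hh (red L (A * B))).unique (h1 ▸ hasOrd_hh (red L B))
    exact digits (B := (L : ℤ) ^ 2) (by linarith) (abs_le.mpr (oo_bound _)) (abs_le.mpr (oo_bound _)) h3
  have k1 := key 1
  have k2 := key S
  have hS : red L S = !![0, -1; 1, 0] := by
    ext i j
    fin_cases i <;> fin_cases j <;> simp [red, S]
  rw [mul_one, red_one] at k1
  rw [red_mul, hS] at k2
  simp [Matrix.mul_apply, Fin.sum_univ_two] at k1 k2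
  have hd := red_det (L := L) A
  obtain ⟨a, ha⟩ : ∃ a, a = red L A 0 0 := ⟨_, rfl⟩
  obtain ⟨b, hb⟩ : ∃ a, a = red L A 0 1 := ⟨_, rfl⟩
  obtain ⟨c, hc⟩ : ∃ a, a = red L A 1 0 := ⟨_, rfl⟩
  obtain ⟨d, hd'⟩ : ∃ a, a = red L A 1 1 := ⟨_, rfl⟩
  rw [← ha, ← hb, ← hc, ← hd'] at hd
  rw [← ha, ← hc] at k1
  rw [← hb, ← hd'] at k2
  have hb0 : b = 0 := by rcases oo_inj k2.1 with h | h <;> simpa using h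
  have hc0 : c = 0 := by rcases oo_inj k1.2 with h | h <;> simpa using h
  have e : red L A = !![a, b; c, d] := by
    ext i j
    fin_cases i <;> fin_cases j <;> simp [ha, hb, hc, hd']
  rw [e, hb0, hc0]
  rw [hb0, hc0, mul_zero, sub_zero] at hd
  rcases oo_inj k1.1 with h1 | h1
  · left
    rw [h1, one_mul] at hd
    rw [h1, hd, Matrix.one_fin_two]
  · right
    have : d = -1 := by rw [h1] at hd; linear_combination -hd
    rw [h1, this, Matrix.one_fin_two]
    ext i j
    fin_cases i <;> fin_cases j <;> simp

lemma hh_sep_f (h2 : 2 ≤ L) {f : ℍ → ℂ} {n : SL(2, ℤ) → ℤ} (hf : Good L f n) {A : SL(2, ℤ)} (h : hh (red L A) = hh (red L 1)) (z : ℍ) : f (A • z) = f z := by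
  rcases hh_sep h2 h with h | h
  · exact hf.inv A (gamma_iff.mpr h) z
  · have : red L (-A) = 1 := by
      ext i j
      have := congrFun (congrFun h i) j
      simp [red] at this ⊢
      rw [this]; simp
    have h3 := hf.inv (-A) (gamma_iff.mpr this) z
    rwa [ModularGroup.SL_neg_smul] at h3

end SU

namespace SU
set_option linter.unusedSectionVars false
variable {L : ℕ} [NeZero L]
open ModularGroup
open scoped ModularForm

lemma HasOrd.bdd' {F : ℍ → ℂ} {n : ℤ} (hF : HasOrd L F n) (hn : 0 ≤ n) : IsBoundedAtImInfty F := by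
  obtain ⟨k, hk, h⟩ := hF
  obtain ⟨m, rfl⟩ := Int.eq_ofNat_of_zero_le hn
  have h' := h.mul ((tendsto_QQ (L := L) Lpos).pow m)
  have e : F = fun z => F z * QQ L z ^ (-(m : ℤ)) * QQ L z ^ m := by
    funext z
    have := QQ_ne_zero L z
    rw [_root_.zpow_neg, zpow_natCast]; field_simp
  rw [e]
  exact h'.isBigO_one ℝ

section
variable {f : ℍ → ℂ} {n : SL(2, ℤ) → ℤ} (hf : Good L f n)

/-- index set -/
abbrev IG (L : ℕ) := Set.range (red L)

/-- a lift -/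
def lft (M : IG L) : SL(2, ℤ) := M.2.choose
lemma red_lft (M : IG L) : red L (lft M) = M.1 := M.2.choose_spec

/-- translation -/
def trE (A : SL(2, ℤ)) : IG L ≃ IG L where
  toFun M := ⟨M.1 * red L A, lft M * A, by rw [red_mul, red_lft]⟩
  invFun M := ⟨M.1 * red L A⁻¹, lft M * A⁻¹, by rw [red_mul, red_lft]⟩
  left_inv M := by
    apply Subtype.ext
    simp only [mul_assoc, ← red_mul, mul_inv_cancel, red_one, mul_one]
  right_inv M := by
    apply Subtype.ext
    simp only [mul_assoc, ← red_mul, inv_mul_cancel, red_one, mul_one]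

instance : Fintype (IG L) := Fintype.ofFinite _

/-- traces -/
def TT (f : ℍ → ℂ) (i : ℕ) (z : ℍ) : ℂ := ∑ M : IG L, f (lft M • z) * hh M.1 z ^ i

include hf in
lemma f_red {A B : SL(2, ℤ)} (h : red L A = red L B) (z : ℍ) : f (A • z) = f (B • z) := by
  rw [← hf.inv _ (gamma_of_red_eq h) (B • z), ← mul_smul]; simp

include hf in
lemma TT_inv (h2 : 2 ≤ L) (i : ℕ) (A : SL(2, ℤ)) (z : ℍ) : TT (L := L) f i (A • z) = TT (L := L) f i z := by
  unfold TT
  symm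
  rw [← Equiv.sum_comp (trE A)]
  symm
  refine Finset.sum_congr rfl fun M _ => ?_
  have e1 : hh M.1 (A • z) = hh (trE A M).1 z := by
    rw [← red_lft M, hh_smul h2, red_mul, red_lft]; rfl
  rw [e1, ← mul_smul, f_red hf (A := lft M * A) (B := lft (trE A M))]
  rw [red_lft, red_mul, red_lft]; rfl

include hf in
lemma TT_md (i : ℕ) : MDifferentiable 𝓘(ℂ) 𝓘(ℂ) (TT (L := L) f i) := by
  have h1 : ∀ M : IG L, MDifferentiable 𝓘(ℂ) 𝓘(ℂ) (fun z => f (lft M • z) * hh M.1 z ^ i) := by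
    intro M
    refine mdiff_mul (hf.md.comp (UpperHalfPlane.mdifferentiable_smul (by simp))) ?_
    have h3 : MDifferentiable 𝓘(ℂ) 𝓘(ℂ) (hh M.1) := by
      refine mdiff_mul (mdiff_XX _) ?_
      simpa using mdiff_zpow (mdiff_XX (L := L) (M.1 1)) (XX_ne_zero _) (2 * L ^ 2 + 1 : ℕ)
    simpa using mdiff_zpow h3 (fun z => mul_ne_zero (XX_ne_zero _ _) (pow_ne_zero _ (XX_ne_zero _ _))) (i : ℕ)
  have e : TT (L := L) f i = ∑ M : IG L, fun z => f (lft M • z) * hh M.1 z ^ i := by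
    funext z
    simp only [TT, Finset.sum_apply]
  rw [e]
  exact MDifferentiable.sum fun M _ => h1 M

include hf in
lemma TT_bdd (d : ℕ) : ∃ K : ℕ, ∀ i ≤ d, IsBoundedAtImInfty (fun z => TT (L := L) f i z * XX L 0 z ^ K) := by
  let o (i : ℕ) (M : IG L) : ℤ := n (lft M) + i * (oo (M.1 0 0) + (2 * L ^ 2 + 1) * oo (M.1 1 0))
  let K : ℕ := ∑ i ∈ Finset.range (d + 1), ∑ M : IG L, (o i M).natAbs
  refine ⟨K, fun i hi => ?_⟩
  have h1 : ∀ M : IG L, IsBoundedAtImInfty (fun z => f (lft M • z) * hh M.1 z ^ i * XX L 0 z ^ K) := by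
    intro M
    refine HasOrd.bdd' (L := L) (n := o i M + K * ordX L 0) ?_ ?_
    · refine (((hf.ord (lft M)).mul ((hasOrd_hh M.1).zpow i)).mul ((hasOrd_XX 0).zpow K)).congr (fun z => ?_) rfl
      simp
    · have h2 : (o i M).natAbs ≤ K :=
        (Finset.single_le_sum (f := fun M => (o i M).natAbs) (fun _ _ => Nat.zero_le _) (Finset.mem_univ M)).trans
          (Finset.single_le_sum (f := fun i => ∑ M : IG L, (o i M).natAbs) (fun _ _ => Nat.zero_le _) (by simp; omega))
      have h3 : ordX L 0 = (L : ℤ) ^ 2 := by simp [ordX]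
      have h4 : (1 : ℤ) ≤ (L : ℤ) ^ 2 := by
        have := Lpos (L := L)
        have : (1 : ℤ) ≤ L := by exact_mod_cast this
        nlinarith
      rw [h3]
      have : (K : ℤ) * 1 ≤ K * L ^ 2 := mul_le_mul_of_nonneg_left h4 (by positivity)
      omega
  have e : (fun z => TT (L := L) f i z * XX L 0 z ^ K) = ∑ M : IG L, fun z => f (lft M • z) * hh M.1 z ^ i * XX L 0 z ^ K := by
    funext z
    simp only [TT, Finset.sum_mul, Finset.sum_apply]
  rw [e]
  exact Asymptotics.IsBigO.sum fun M _ => h1 M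

include hf in
lemma exists_S (h2 : 2 ≤ L) : ∃ S : MO L, S ≠ 0 ∧ f * S.1 ∈ MW L := by
  classical
  let hO (M : IG L) : MO L := ⟨hh M.1, hh_mem M.1⟩
  let e1 : IG L := ⟨red L 1, 1, rfl⟩
  let Orb : Finset (MO L) := (Finset.univ.image hO).erase (hO e1)
  let P : Polynomial (MO L) := ∏ k ∈ Orb, (Polynomial.X - Polynomial.C k)
  have hP0 : P.eval (hO e1) ≠ 0 := by
    rw [Polynomial.eval_prod, Finset.prod_ne_zero_iff]
    intro k hk
    simp only [Polynomial.eval_sub, Polynomial.eval_X, Polynomial.eval_C]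
    exact sub_ne_zero.mpr (Finset.ne_of_mem_erase hk).symm
  have hP1 : ∀ M, hO M ≠ hO e1 → P.eval (hO M) = 0 := by
    intro M hM
    rw [Polynomial.eval_prod]
    refine Finset.prod_eq_zero (i := hO M) (Finset.mem_erase.mpr ⟨hM, Finset.mem_image_of_mem _ (Finset.mem_univ _)⟩) ?_
    simp
  let m : ℕ := (Finset.univ.filter fun M => hO M = hO e1).card
  have hm : 0 < m := Finset.card_pos.mpr ⟨e1, by simp⟩
  obtain ⟨K, hK⟩ := TT_bdd hf P.natDegree
  let X0 : MO L := ⟨XX L 0, XX_mem 0⟩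
  have hsum : ∀ z, ∑ i ∈ Finset.range (P.natDegree + 1), (P.coeff i).1 z * TT (L := L) f i z = m * (f z * (P.eval (hO e1)).1 z) := by
    intro z
    have ev : ∀ M, (P.eval (hO M)).1 z = ∑ i ∈ Finset.range (P.natDegree + 1), (P.coeff i).1 z * hh M.1 z ^ i := by
      intro M
      rw [Polynomial.eval_eq_sum_range]
      simp [hO]
    unfold TT
    simp_rw [Finset.mul_sum]
    rw [Finset.sum_comm]
    have : ∀ M : IG L, ∑ i ∈ Finset.range (P.natDegree + 1), (P.coeff i).1 z * (f (lft M • z) * hh M.1 z ^ i) =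
        if hO M = hO e1 then f z * (P.eval (hO e1)).1 z else 0 := by
      intro M
      have e : ∑ i ∈ Finset.range (P.natDegree + 1), (P.coeff i).1 z * (f (lft M • z) * hh M.1 z ^ i) = f (lft M • z) * (P.eval (hO M)).1 z := by
        rw [ev, Finset.mul_sum]
        exact Finset.sum_congr rfl fun i _ => by ring
      rw [e]
      split_ifs with h
      · rw [h, hh_sep_f h2 hf]
        rw [red_lft]; exact congrArg Subtype.val h
      · rw [hP1 M h]; simp
    rw [Finset.sum_congr rfl fun M _ => this M, ← Finset.sum_filter, Finset.sum_const, nsmul_eq_mul]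
  refine ⟨m * P.eval (hO e1) * X0 ^ K, ?_, ?_⟩
  · refine mul_ne_zero (mul_ne_zero ?_ hP0) (pow_ne_zero _ ?_)
    · intro h
      have := congrFun (congrArg Subtype.val h) UpperHalfPlane.I
      simp at this
      omega
    · intro h
      exact XX_ne_zero (L := L) 0 UpperHalfPlane.I (congrFun (congrArg Subtype.val h) UpperHalfPlane.I)
  · have e : f * (m * P.eval (hO e1) * X0 ^ K : MO L).1 = ∑ i ∈ Finset.range (P.natDegree + 1), (P.coeff i).1 * (fun z => TT (L := L) f i z * XX L 0 z ^ K) := by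
      funext z
      have := hsum z
      simp only [Finset.sum_apply, Pi.mul_apply, ← mul_assoc]
      rw [← Finset.sum_mul, this]
      simp [X0]
      ring
    rw [e]
    refine (MW L).sum_mem fun i hi => (MW L).mul_mem (MO_le_MW (P.coeff i).2) ?_
    obtain ⟨p, hp, h⟩ := level_one_ps (L := L) (TT_md hf i) (TT_inv hf h2 i) K (hK i (by simp at hi; omega))
    exact ⟨0, p, hp, by simpa using h⟩

include hf in
lemma bounded_den (h2 : 2 ≤ L) {n1 : ℤ} {p : PowerSeries ℚ} (hp : HasPS 1 (PowerSeries.map (algebraMap ℚ ℂ) p) (fun z => f z * QQ L z ^ (-n1))) :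
    ∃ s ∈ Oser, s ≠ 0 ∧ PowerSeries.expand L (NeZero.ne L) (PowerSeries.map (algebraMap ℚ ℂ) p) * s ∈ Oser := by
  obtain ⟨⟨S, K1, s, hs, hS⟩, hS0, K2, w, hw, hW⟩ := exists_S hf h2
  have hs0 : s ≠ 0 := by
    rintro rfl
    apply hS0
    apply Subtype.ext
    funext z
    have h2 : S z * QQ L z ^ K1 = 0 := (hS z).unique (Ev.zero _)
    exact (mul_eq_zero.mp h2).resolve_right (pow_ne_zero _ (QQ_ne_zero L z))
  set P := PowerSeries.expand L (NeZero.ne L) (PowerSeries.map (algebraMap ℚ ℂ) p) with hP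
  have hp' : HasPS L P _ := hp.expand
  have hXn : ∀ k, (PowerSeries.X : PowerSeries ℂ) ^ k ∈ Oser := fun k => Oser.pow_mem X_mem_Oser k
  have key : P * (s * PowerSeries.X ^ (K2 + n1.toNat)) = w * PowerSeries.X ^ (K1 + (-n1).toNat) := by
    refine HasPS.unique (L := L) Lpos (hp'.mul (hS.mul (HasPS.X_pow _))) (fun z => ?_)
    have h := hW.mul (HasPS.X_pow (K1 + (-n1).toNat)) z
    have hq := QQ_ne_zero L z
    have e : QQ L z ^ n1.toNat = QQ L z ^ n1 * QQ L z ^ (-n1).toNat := (zpow_split _ hq n1).symm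
    have e2 : QQ L z ^ (-n1) * QQ L z ^ n1 = 1 := by rw [← zpow_add₀ hq]; simp
    have e3 : f z * QQ L z ^ (-n1) * (S z * QQ L z ^ K1 * QQ L z ^ (K2 + n1.toNat)) = (f * S) z * QQ L z ^ K2 * QQ L z ^ (K1 + (-n1).toNat) := by
      rw [pow_add, e, pow_add, Pi.mul_apply]
      linear_combination (f z * S z * QQ L z ^ K1 * QQ L z ^ K2 * QQ L z ^ (-n1).toNat) * e2
    simp only [e3]
    exact h
  have hwW : w * PowerSeries.X ^ (K1 + (-n1).toNat) ∈ WW := WW.mul_mem hw (Oser_le_WW (hXn _))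
  have hsO : s * PowerSeries.X ^ (K2 + n1.toNat) ∈ Oser := Oser.mul_mem hs (hXn _)
  obtain ⟨D, hD, hDO⟩ := WW_den hwW (by
    intro k
    rw [← key, PowerSeries.coeff_mul]
    refine Finset.sum_induction _ (IsAlgebraic ℚ) (fun a b => IsAlgebraic.add) isAlgebraic_zero fun x _ => ?_
    refine IsAlgebraic.mul ?_ ((IsFractionRing.isAlgebraic_iff ℤ ℚ ℂ).mp (mem_Oser.mp hsO _).isAlgebraic)
    rw [hP, PowerSeries.coeff_expand]
    split_ifs
    · rw [PowerSeries.coeff_map]; exact isAlgebraic_algebraMap _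
    · exact isAlgebraic_zero)
  refine ⟨(D : PowerSeries ℂ) * (s * PowerSeries.X ^ (K2 + n1.toNat)), Oser.mul_mem (natCast_mem _ D) hsO, ?_, ?_⟩
  · refine mul_ne_zero ?_ (mul_ne_zero hs0 (pow_ne_zero _ PowerSeries.X_ne_zero))
    have e : (D : PowerSeries ℂ) = PowerSeries.C (D : ℂ) := by simp
    rw [e, ne_eq, map_eq_zero_iff _ PowerSeries.C_injective]
    exact_mod_cast hD.ne'
  · rw [← key] at hDO
    rwa [mul_left_comm]

end

end SU

namespace SU
set_option linter.unusedSectionVars false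
variable {L : ℕ} [NeZero L]

lemma int_of_pow {r : ℚ} {d : ℂ} (hd0 : d ≠ 0) (hd : IsIntegral ℤ d) (h : ∀ k : ℕ, IsIntegral ℤ (d * (r : ℂ) ^ k)) :
    ∃ m : ℤ, r = m := by
  have halg : IsAlgebraic ℚ d⁻¹ :=
    ((IsFractionRing.isAlgebraic_iff ℤ ℚ ℂ).mp hd.isAlgebraic).inv
  obtain ⟨D, hD, hD2⟩ := exists_den halg
  have h1 : ∀ k : ℕ, ∃ m : ℤ, (D : ℚ) * r ^ k = m := by
    intro k
    have h2 : IsIntegral ℤ (((D : ℚ) * r ^ k : ℚ) : ℂ) := by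
      have := hD2.mul (h k)
      have e : (D : ℂ) * d⁻¹ * (d * (r : ℂ) ^ k) = (((D : ℚ) * r ^ k : ℚ) : ℂ) := by
        push_cast; field_simp
      rwa [e] at this
    have h3 : IsIntegral ℤ ((D : ℚ) * r ^ k) :=
      (isIntegral_algebraMap_iff (FaithfulSMul.algebraMap_injective ℚ ℂ)).mp h2
    obtain ⟨m, hm⟩ := IsIntegrallyClosed.isIntegral_iff.mp h3
    exact ⟨m, by rw [← hm]; rfl⟩
  have h2 : ∀ k : ℕ, r.den ^ k ∣ D := by
    intro k
    obtain ⟨m, hm⟩ := h1 k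
    have hden : (r.den : ℚ) ≠ 0 := by exact_mod_cast r.den_nz
    have e : (D : ℤ) * r.num ^ k = m * (r.den : ℤ) ^ k := by
      have : (D : ℚ) * (r.num : ℚ) ^ k = m * (r.den : ℚ) ^ k := by
        rw [← hm]
        conv_rhs => rw [← Rat.num_div_den r]
        rw [div_pow]
        rw [Rat.num_div_den]
        field_simp
      exact_mod_cast this
    have h3 : ((r.den ^ k : ℕ) : ℤ) ∣ (D : ℤ) * r.num ^ k := ⟨m, by rw [e]; push_cast; ring⟩
    have h4 : IsCoprime ((r.den ^ k : ℕ) : ℤ) (r.num ^ k) := by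
      push_cast
      refine IsCoprime.pow ?_
      rw [Int.isCoprime_iff_gcd_eq_one]
      have := r.reduced
      rw [Int.gcd_comm]
      simpa [Int.gcd, Nat.Coprime] using this
    exact_mod_cast h4.dvd_of_dvd_mul_right h3
  have h3 : r.den = 1 := by
    by_contra hne
    have h4 : 1 < r.den := by have := r.den_pos; omega
    have := Nat.le_of_dvd hD (h2 D)
    exact absurd this (not_le.mpr (Nat.lt_pow_self h4))
  exact ⟨r.num, by conv_lhs => rw [← Rat.num_div_den r, h3]; simp⟩

lemma complete {H d : PowerSeries ℂ} (hQ : ∀ n, ∃ r : ℚ, PowerSeries.coeff n H = r) (hd0 : d ≠ 0)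
    (h : ∀ k, d * H ^ k ∈ Oser) (n : ℕ) : ∃ m : ℤ, PowerSeries.coeff n H = m := by
  induction n using Nat.strong_induction_on with
  | _ n ih =>
    obtain ⟨r, hr⟩ := hQ n
    let T : PowerSeries ℂ := PowerSeries.mk fun i => if i < n then PowerSeries.coeff i H else 0
    have hT : T ∈ Oser := by
      rw [mem_Oser]
      intro i
      rw [PowerSeries.coeff_mk]
      split_ifs with hi
      · obtain ⟨m, hm⟩ := ih i hi
        rw [hm]; exact isIntegral_algebraMap (R := ℤ) (A := ℂ) (x := m)
      · exact isIntegral_zero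
    obtain ⟨H'', hH''⟩ : PowerSeries.X ^ n ∣ H - T := by
      rw [PowerSeries.X_pow_dvd_iff]
      intro i hi
      rw [map_sub, PowerSeries.coeff_mk, if_pos hi, sub_self]
    have hc : PowerSeries.constantCoeff H'' = r := by
      have h1 := congrArg (PowerSeries.coeff (0 + n)) hH''
      rw [mul_comm, PowerSeries.coeff_mul_X_pow, map_sub, zero_add, PowerSeries.coeff_mk, if_neg (lt_irrefl _), sub_zero, hr] at h1
      rw [h1]; simp
    have h2 : ∀ k, d * (H - T) ^ k ∈ Oser := by
      intro k
      rw [sub_eq_add_neg, add_pow, Finset.mul_sum]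
      refine Oser.sum_mem fun i _ => ?_
      rw [← mul_assoc, ← mul_assoc]
      exact Oser.mul_mem (Oser.mul_mem (h i) (Oser.pow_mem (Oser.neg_mem hT) _)) (natCast_mem _ _)
    obtain ⟨d', hd'⟩ : ∃ d', d = PowerSeries.X ^ d.order.toNat * d' := PowerSeries.X_pow_order_dvd
    have hd'0 : PowerSeries.constantCoeff d' ≠ 0 := by
      have h1 := congrArg (PowerSeries.coeff (0 + d.order.toNat)) hd'
      rw [mul_comm, PowerSeries.coeff_mul_X_pow, zero_add] at h1
      rw [← PowerSeries.coeff_zero_eq_constantCoeff_apply, ← h1]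
      exact PowerSeries.coeff_order hd0
    have h3 : ∀ k, IsIntegral ℤ (PowerSeries.constantCoeff d' * (r : ℂ) ^ k) := by
      intro k
      have h4 := mem_Oser.mp (h2 k) (0 + (d.order.toNat + n * k))
      have e : d * (H - T) ^ k = (d' * H'' ^ k) * PowerSeries.X ^ (d.order.toNat + n * k) := by
        rw [hH'']
        conv_lhs => rw [hd']
        rw [mul_pow, ← pow_mul, pow_add]; ring
      rw [e, PowerSeries.coeff_mul_X_pow, PowerSeries.coeff_zero_eq_constantCoeff_apply, map_mul, map_pow, hc] at h4
      exact h4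
    obtain ⟨m, hm⟩ := int_of_pow hd'0 (by simpa using h3 0) h3
    exact ⟨m, by rw [hr, hm]; simp⟩

lemma root_dvd {N n : ℕ} (hN : 0 < N) (hn : 0 < n) {G : PowerSeries ℤ} (b : ℤ) (h0 : PowerSeries.X ∣ G - 1)
    (h : PowerSeries.X ^ (n + 1) ∣ G ^ N - (1 - PowerSeries.C b * PowerSeries.X ^ n)) : (N : ℤ) ∣ b := by
  have key : ∀ j, 1 ≤ j → ∀ g : PowerSeries ℤ, PowerSeries.X ^ (j + 1) ∣ (1 + PowerSeries.X ^ j * g) ^ N - (1 + (N : PowerSeries ℤ) * (PowerSeries.X ^ j * g)) := by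
    intro j hj g
    have h1 : ((PowerSeries.X : PowerSeries ℤ) ^ j * g) ^ 2 ∣ (1 + PowerSeries.X ^ j * g) ^ N - (1 + (N : PowerSeries ℤ) * (PowerSeries.X ^ j * g)) := by
      obtain ⟨k, hk⟩ := (Polynomial.binomExpansion ((Polynomial.X : Polynomial (PowerSeries ℤ)) ^ N) 1 (PowerSeries.X ^ j * g))
      simp [Polynomial.derivative_X_pow] at hk
      exact ⟨k, by rw [hk]; ring⟩
    refine dvd_trans ?_ h1
    rw [mul_pow, ← pow_mul]
    exact dvd_mul_of_dvd_left (pow_dvd_pow _ (by omega)) _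
  have hNX : ∀ g : PowerSeries ℤ, PowerSeries.X ∣ (N : PowerSeries ℤ) * g → PowerSeries.X ∣ g := by
    intro g hg
    rw [PowerSeries.X_dvd_iff] at *
    rw [map_mul, map_natCast] at hg
    rcases mul_eq_zero.mp hg with h | h
    · exfalso; have : N = 0 := by exact_mod_cast h
      omega
    · exact h
  have h1 : ∀ j, 1 ≤ j → j ≤ n → PowerSeries.X ^ j ∣ G - 1 := by
    intro j hj
    induction j, hj using Nat.le_induction with
    | base => intro _; simpa using h0
    | succ j hj ih =>
      intro hjn
      obtain ⟨g, hg⟩ := ih (by omega)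
      have hG : G = 1 + PowerSeries.X ^ j * g := by rw [← hg]; ring
      have h2 := key j hj g
      rw [← hG] at h2
      have h3 : PowerSeries.X ^ (j + 1) ∣ G ^ N - 1 := by
        have h4 := (pow_dvd_pow PowerSeries.X (by omega : j + 1 ≤ n + 1)).trans h
        have h5 : (PowerSeries.X : PowerSeries ℤ) ^ (j + 1) ∣ PowerSeries.C b * PowerSeries.X ^ n :=
          dvd_mul_of_dvd_right (pow_dvd_pow _ hjn) _
        have := dvd_sub h4 h5
        convert this using 1; ring
      have h4 := dvd_sub h3 h2
      have e : G ^ N - 1 - (G ^ N - (1 + (N : PowerSeries ℤ) * (PowerSeries.X ^ j * g))) = PowerSeries.X ^ j * ((N : PowerSeries ℤ) * g) := by ring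
      rw [e, pow_succ] at h4
      have h5 := hNX g ((mul_dvd_mul_iff_left (pow_ne_zero j PowerSeries.X_ne_zero)).mp h4)
      rw [hg, pow_succ]
      exact mul_dvd_mul_left _ h5
  obtain ⟨g, hg⟩ := h1 n hn le_rfl
  have hG : G = 1 + PowerSeries.X ^ n * g := by rw [← hg]; ring
  have h2 := key n hn g
  rw [← hG] at h2
  have h4 := dvd_sub h h2
  have e : G ^ N - (1 - PowerSeries.C b * PowerSeries.X ^ n) - (G ^ N - (1 + (N : PowerSeries ℤ) * (PowerSeries.X ^ n * g))) = PowerSeries.X ^ n * ((N : PowerSeries ℤ) * g + PowerSeries.C b) := by ring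
  rw [e, pow_succ] at h4
  have h5 := (mul_dvd_mul_iff_left (pow_ne_zero n PowerSeries.X_ne_zero)).mp h4
  rw [PowerSeries.X_dvd_iff] at h5
  simp at h5
  exact ⟨-PowerSeries.constantCoeff g, by linarith⟩

/-- the basic integral products -/
def UU (r : ZMod L) : PowerSeries ℤ := prodPS (cc r (1 : ℤ))

lemma FN_dvd (c : ℕ → ℤ) (n : ℕ) : PowerSeries.X ^ (n + 1) ∣ prodPS c - FN c n := by
  rw [PowerSeries.X_pow_dvd_iff]
  intro i hi
  rw [map_sub, coeff_FN_stable c (by omega), sub_self]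

lemma prod_UU_dvd (b : ZMod L → ℕ) (n : ℕ) : PowerSeries.X ^ (n + 1) ∣
    ∏ r, UU r ^ b r - ∏ m ∈ Finset.range n, (1 - PowerSeries.X ^ (m + 1) : PowerSeries ℤ) ^ b ((m + 1 : ℕ) : ZMod L) := by
  classical
  have e : ∏ m ∈ Finset.range n, (1 - PowerSeries.X ^ (m + 1) : PowerSeries ℤ) ^ b ((m + 1 : ℕ) : ZMod L) =
      ∏ r, FN (cc r (1 : ℤ)) n ^ b r := by
    unfold FN
    simp_rw [← Finset.prod_pow]
    rw [Finset.prod_comm]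
    refine Finset.prod_congr rfl fun m _ => ?_
    rw [Finset.prod_eq_single ((m + 1 : ℕ) : ZMod L)]
    · simp [cc]
    · intro r _ hr
      have : cc r (1 : ℤ) m = 0 := by unfold cc; rw [if_neg (Ne.symm hr)]
      simp [this]
    · simp
  rw [e, ← Ideal.mem_span_singleton, ← Ideal.Quotient.eq, map_prod, map_prod]
  refine Finset.prod_congr rfl fun r _ => ?_
  rw [map_pow, map_pow]
  congr 1
  rw [Ideal.Quotient.eq, Ideal.mem_span_singleton]
  exact FN_dvd _ _

lemma dvd_b {N : ℕ} (hN : 0 < N) (b : ZMod L → ℕ) {H : PowerSeries ℤ} (h0 : PowerSeries.constantCoeff H = 1)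
    (h : H ^ N = ∏ r, UU r ^ b r) (n : ℕ) : N ∣ b ((n + 1 : ℕ) : ZMod L) := by
  induction n using Nat.strong_induction_on with
  | _ n ih =>
    have ih' : ∀ m, ∃ a, m < n → b ((m + 1 : ℕ) : ZMod L) = N * a := by
      intro m
      by_cases hm : m < n
      · obtain ⟨a, ha⟩ := ih m hm
        exact ⟨a, fun _ => ha⟩
      · exact ⟨0, fun h => absurd h hm⟩
    choose a ha using ih'
    let A : PowerSeries ℤ := ∏ m ∈ Finset.range n, (1 - PowerSeries.X ^ (m + 1) : PowerSeries ℤ) ^ a m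
    have hA1 : PowerSeries.constantCoeff A = 1 := by
      simp only [A]
      rw [map_prod]
      exact Finset.prod_eq_one fun m _ => by simp
    have hAu : IsUnit A := by
      rw [PowerSeries.isUnit_iff_constantCoeff, hA1]; exact isUnit_one
    obtain ⟨B, hB⟩ := hAu.exists_right_inv
    have hB1 : PowerSeries.constantCoeff B = 1 := by
      have := congrArg PowerSeries.constantCoeff hB
      simpa [hA1] using this
    have h1 := prod_UU_dvd b (n + 1)
    rw [← h, Finset.prod_range_succ] at h1
    have e : ∏ m ∈ Finset.range n, (1 - PowerSeries.X ^ (m + 1) : PowerSeries ℤ) ^ b ((m + 1 : ℕ) : ZMod L) = A ^ N := by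
      simp only [A]
      rw [← Finset.prod_pow]
      refine Finset.prod_congr rfl fun m hm => ?_
      rw [ha m (Finset.mem_range.mp hm), mul_comm, pow_mul]
    rw [e] at h1
    set β := b ((n + 1 : ℕ) : ZMod L) with hβ
    have h2 : PowerSeries.X ^ (n + 1 + 1) ∣ (1 - PowerSeries.X ^ (n + 1) : PowerSeries ℤ) ^ β - (1 - PowerSeries.C (β : ℤ) * PowerSeries.X ^ (n + 1)) := by
      obtain ⟨k, hk⟩ := (Polynomial.binomExpansion ((Polynomial.X : Polynomial (PowerSeries ℤ)) ^ β) 1 (-PowerSeries.X ^ (n + 1)))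
      simp [Polynomial.derivative_X_pow] at hk
      have e2 : (1 - PowerSeries.X ^ (n + 1) : PowerSeries ℤ) ^ β - (1 - PowerSeries.C (β : ℤ) * PowerSeries.X ^ (n + 1)) = k * (PowerSeries.X ^ (n + 1)) ^ 2 := by
        rw [sub_eq_add_neg 1 (PowerSeries.X ^ (n + 1)), hk]; simp; ring
      rw [e2, ← pow_mul]
      exact dvd_mul_of_dvd_right (pow_dvd_pow _ (by omega)) _
    have h3 : PowerSeries.X ^ (n + 1 + 1) ∣ (H * B) ^ N - (1 - PowerSeries.C (β : ℤ) * PowerSeries.X ^ (n + 1)) := by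
      have h4 := dvd_add (dvd_mul_of_dvd_right h1 (B ^ N)) h2
      have e3 : B ^ N * (H ^ N - A ^ N * (1 - PowerSeries.X ^ (n + 1)) ^ β) + ((1 - PowerSeries.X ^ (n + 1) : PowerSeries ℤ) ^ β - (1 - PowerSeries.C (β : ℤ) * PowerSeries.X ^ (n + 1))) =
        (H * B) ^ N - (1 - PowerSeries.C (β : ℤ) * PowerSeries.X ^ (n + 1)) + (1 - (A * B) ^ N) * (1 - PowerSeries.X ^ (n + 1)) ^ β := by
        rw [mul_pow, mul_pow]; ring
      rw [e3, hB] at h4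
      simpa using h4
    have h5 := root_dvd hN (Nat.succ_pos n) (β : ℤ) (by rw [PowerSeries.X_dvd_iff]; simp [h0, hB1]) h3
    exact_mod_cast h5

lemma dvd_b' {N : ℕ} (hN : 0 < N) (b : ZMod L → ℕ) {L' : ℕ} (hL' : L' ≠ 0) {h0 : PowerSeries ℚ} (hc : PowerSeries.constantCoeff h0 = 1)
    (hpow : h0 ^ N = PowerSeries.map (Int.castRingHom ℚ) (∏ r, UU r ^ b r))
    {s : PowerSeries ℂ} (hs : s ∈ Oser) (hs0 : s ≠ 0)
    (hO : PowerSeries.expand L' hL' (PowerSeries.map (algebraMap ℚ ℂ) h0) * s ∈ Oser) (r : ZMod L) : N ∣ b r := by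
  set E := PowerSeries.expand L' hL' (PowerSeries.map (algebraMap ℚ ℂ) h0) with hE
  have hEN : E ^ N ∈ Oser := by
    rw [hE, ← map_pow, ← map_pow, hpow]
    refine expand_mem_Oser _ (mem_Oser.mpr fun n => ?_)
    rw [PowerSeries.coeff_map, PowerSeries.coeff_map]
    have := (isIntegral_algebraMap (R := ℤ) (A := ℂ) (x := PowerSeries.coeff n (∏ r, UU r ^ b r)))
    simpa using this
  have hd : ∀ k, s ^ N * E ^ k ∈ Oser := by
    intro k
    have e : s ^ N * E ^ k = (E ^ N) ^ (k / N) * ((E * s) ^ (k % N) * s ^ (N - k % N)) := by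
      have hlt := Nat.mod_lt k hN
      conv_lhs => rw [← Nat.div_add_mod k N, pow_add, pow_mul]
      rw [mul_pow]
      conv_lhs => rw [show s ^ N = s ^ (k % N) * s ^ (N - k % N) by rw [← pow_add]; congr 1; omega]
      ring
    rw [e]
    exact Oser.mul_mem (Oser.pow_mem hEN _) (Oser.mul_mem (Oser.pow_mem hO _) (Oser.pow_mem hs _))
  have hcoef := complete (H := E) (fun n => by
    rw [hE, PowerSeries.coeff_expand]
    split_ifs
    · exact ⟨_, by rw [PowerSeries.coeff_map]; rfl⟩
    · exact ⟨0, by simp⟩) (pow_ne_zero N hs0) hd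
  have hcoef' : ∀ n, ∃ m : ℤ, PowerSeries.coeff n h0 = m := by
    intro n
    obtain ⟨m, hm⟩ := hcoef (L' * n)
    rw [hE, PowerSeries.coeff_expand_mul, PowerSeries.coeff_map] at hm
    refine ⟨m, ?_⟩
    have : ((PowerSeries.coeff n h0 : ℚ) : ℂ) = ((m : ℚ) : ℂ) := by simpa using hm
    exact_mod_cast this
  choose m hm using hcoef'
  let H : PowerSeries ℤ := PowerSeries.mk m
  have hH : PowerSeries.map (Int.castRingHom ℚ) H = h0 := by
    ext n; simp [H, hm]
  have hinj : Function.Injective (PowerSeries.map (Int.castRingHom ℚ)) := PowerSeries.map_injective _ (RingHom.injective_int _)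
  have h1 : H ^ N = ∏ r, UU r ^ b r := by
    apply hinj; rw [map_pow, hH, hpow]
  have h2 : PowerSeries.constantCoeff H = 1 := by
    have := cc_map (Int.castRingHom ℚ) H
    rw [hH, hc] at this
    simpa using this.symm
  have h3 := dvd_b hN b h2 h1 (r.val + L - 1)
  have e : ((r.val + L - 1 + 1 : ℕ) : ZMod L) = r := by
    have := Lpos (L := L)
    rw [Nat.sub_add_cancel (by omega)]; simp
  rwa [e] at h3

end SU

namespace SU
set_option linter.unusedSectionVars false
variable {L : ℕ} [NeZero L]
open ModularGroup

lemma eq_of_pow_eq {N : ℕ} (hN : 0 < N) {x y : PowerSeries ℚ} (hx : PowerSeries.constantCoeff x = 1)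
    (hy : PowerSeries.constantCoeff y = 1) (h : x ^ N = y ^ N) : x = y := by
  have h1 := (Commute.all x y).geom_sum₂_mul N
  rw [h, sub_self] at h1
  rcases mul_eq_zero.mp h1 with h2 | h2
  · exfalso
    have h3 := congrArg PowerSeries.constantCoeff h2
    rw [map_sum] at h3
    simp [hx, hy] at h3
    omega
  · exact sub_eq_zero.mp h2

lemma map_UU (r : ZMod L) : PowerSeries.map (Int.castRingHom ℂ) (UU r) = prodPS (cc r (1 : ℂ)) := by
  unfold UU
  rw [map_prodPS]
  congr 1
  funext n
  unfold cc
  split_ifs <;> simp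

lemma map_UU' (P : PowerSeries ℤ) : PowerSeries.map (algebraMap ℚ ℂ) (PowerSeries.map (Int.castRingHom ℚ) P) =
    PowerSeries.map (Int.castRingHom ℂ) P := by
  ext n; simp

lemma map_int_mem (P : PowerSeries ℤ) : PowerSeries.map (Int.castRingHom ℂ) P ∈ Oser := by
  rw [mem_Oser]
  intro n
  rw [PowerSeries.coeff_map]
  exact (isIntegral_algebraMap (R := ℤ) (A := ℂ) (x := PowerSeries.coeff n P))

lemma C_mem (a : ℤ) : PowerSeries.C (a : ℂ) ∈ Oser := by
  have := map_int_mem (PowerSeries.C a)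
  simpa using this

lemma cc_UU (b : ZMod L → ℕ) : PowerSeries.constantCoeff (∏ r, UU r ^ b r) = 1 := by
  rw [map_prod]
  refine Finset.prod_eq_one fun r _ => ?_
  rw [map_pow, UU, constantCoeff_prodPS, one_pow]

lemma hasPS_UU (b : ZMod L → ℕ) : HasPS 1 (PowerSeries.map (Int.castRingHom ℂ) (∏ r, UU r ^ b r)) (fun z => ∏ r, qp L r z ^ b r) := by
  rw [map_prod]
  refine HasPS.prod _ fun r _ => ?_
  rw [map_pow, map_UU]
  exact (hasPS_qp r).pow _

lemma exists_a {f : ℍ → ℂ} {n : SL(2, ℤ) → ℤ} (hmu : IsModularUnit f) (hf : Good L f n) {p : PowerSeries ℚ} (hp : RExp L f (n 1) p) :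
    ∃ a : ZMod L → ℤ, a 0 = 0 ∧ (∀ r, a (-r) = a r) ∧ ∑ r, a r * oo r = 24 * n 1 ∧
      ∃ γ : ℚ, γ ≠ 0 ∧ ∀ z, f z * QQ L z ^ (-n 1) = γ * ∏ r, qp L r z ^ a r := by
  classical
  obtain ⟨N, b, hN, hb0, hbe, hbo, c, hc, h⟩ := exists_b hf hp
  -- bounded denominators at level 2L
  have : NeZero (2 * L) := ⟨by have := Lpos (L := L); omega⟩
  obtain ⟨n', hf'⟩ := good_of (L := 2 * L) hmu (fun A hA z => hf.inv A (by
    rw [CongruenceSubgroup.Gamma_mem] at *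
    have key : ∀ x y : ℤ, ((x : ZMod (2 * L)) = y) → ((x : ZMod L) = y) := by
      intro x y hxy
      rw [ZMod.intCast_eq_intCast_iff_dvd_sub] at *
      exact (Dvd.intro_left _ (by push_cast; ring : (2 : ℤ) * L = ((2 * L : ℕ) : ℤ))).trans hxy
    refine ⟨?_, ?_, ?_, ?_⟩
    · simpa using key _ 1 (by simpa using hA.1)
    · simpa using key _ 0 (by simpa using hA.2.1)
    · simpa using key _ 0 (by simpa using hA.2.2.1)
    · simpa using key _ 1 (by simpa using hA.2.2.2)) z)
  have hQ : ∀ z, QQ (2 * L) z ^ (-(2 * n 1)) = QQ L z ^ (-n 1) := by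
    intro z
    have hL : (L : ℂ) ≠ 0 := Lne
    rw [QQ, QQ, ee_zpow, ee_zpow]
    congr 1
    push_cast
    field_simp
  obtain ⟨s, hs, hs0, hsO⟩ := bounded_den hf' (by have := Lpos (L := L); omega) (n1 := 2 * n 1) (p := p) (by
    intro z
    simp only [hQ]
    exact hp.ps z)
  -- shift
  obtain ⟨t, ht⟩ : ∃ t : ℕ, ∀ r, (b r).natAbs ≤ t := ⟨∑ r, (b r).natAbs, fun r => Finset.single_le_sum (f := fun r => (b r).natAbs) (fun _ _ => Nat.zero_le _) (Finset.mem_univ r)⟩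
  have hnn : ∀ r, 0 ≤ b r + N * t := by
    intro r
    have h1 := ht r
    have h2 : (t : ℤ) ≤ N * t := by
      have : (1 : ℤ) ≤ N := by exact_mod_cast hN
      nlinarith
    omega
  let b' : ZMod L → ℕ := fun r => (b r + N * t).toNat
  have hb' : ∀ r, (b' r : ℤ) = b r + N * t := fun r => Int.toNat_of_nonneg (hnn r)
  set P : PowerSeries ℤ := ∏ r : ZMod L, UU r ^ t with hP
  have hPc : PowerSeries.constantCoeff P = 1 := cc_UU (fun _ => t)
  set c0 : ℚ := PowerSeries.constantCoeff p with hc0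
  have hc0n : c0 ≠ 0 := hp.c0
  have hPS1 : HasPS 1 (PowerSeries.map (algebraMap ℚ ℂ) p * PowerSeries.map (Int.castRingHom ℂ) P)
      (fun z => f z * QQ L z ^ (-n 1) * ∏ r, qp L r z ^ t) := hp.ps.mul (hasPS_UU (fun _ => t))
  have hPS2 : HasPS 1 (PowerSeries.C c * PowerSeries.map (Int.castRingHom ℂ) (∏ r, UU r ^ b' r))
      (fun z => c * ∏ r, qp L r z ^ b' r) := (HasPS.C c).mul (hasPS_UU b')
  have e1 : (PowerSeries.map (algebraMap ℚ ℂ) p * PowerSeries.map (Int.castRingHom ℂ) P) ^ N =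
      PowerSeries.C c * PowerSeries.map (Int.castRingHom ℂ) (∏ r, UU r ^ b' r) := by
    refine HasPS.unique one_pos (hPS1.pow N) ?_
    intro z
    have := hPS2 z
    have e : c * ∏ r, qp L r z ^ b' r = (f z * QQ L z ^ (-n 1) * ∏ r, qp L r z ^ t) ^ N := by
      rw [mul_pow, h z, mul_assoc, ← Finset.prod_pow, ← Finset.prod_mul_distrib]
      congr 1
      refine Finset.prod_congr rfl fun r _ => ?_
      have hq := qp_ne_zero r z
      rw [← pow_mul, ← zpow_natCast, ← zpow_natCast, ← zpow_add₀ hq, hb']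
      congr 1
      push_cast; ring
    simp only [← e]; exact this
  have hcc : c = ((c0 ^ N : ℚ) : ℂ) := by
    have := congrArg PowerSeries.constantCoeff e1
    rw [map_pow, map_mul, map_mul, cc_map, cc_map, cc_map, hPc, cc_UU] at this
    simp at this
    rw [← this]; simp [hc0]
  have hinj : Function.Injective (PowerSeries.map (algebraMap ℚ ℂ)) := PowerSeries.map_injective _ (algebraMap ℚ ℂ).injective
  have e2 : (p * PowerSeries.map (Int.castRingHom ℚ) P) ^ N =
      PowerSeries.C (c0 ^ N) * PowerSeries.map (Int.castRingHom ℚ) (∏ r, UU r ^ b' r) := by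
    apply hinj
    rw [map_pow, map_mul, map_mul, map_UU', map_UU', e1, PowerSeries.map_C, hcc]
    rfl
  set h0 : PowerSeries ℚ := PowerSeries.C c0⁻¹ * (p * PowerSeries.map (Int.castRingHom ℚ) P) with hh0
  have h0c : PowerSeries.constantCoeff h0 = 1 := by
    rw [hh0, map_mul, map_mul, cc_map, hPc]
    simp [← hc0, hc0n]
  have h0N : h0 ^ N = PowerSeries.map (Int.castRingHom ℚ) (∏ r, UU r ^ b' r) := by
    rw [hh0, mul_pow, e2, ← mul_assoc, ← map_pow, ← map_mul, inv_pow, inv_mul_cancel₀ (pow_ne_zero _ hc0n), map_one, one_mul]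
  clear_value h0
  have hdvd : ∀ r, N ∣ b' r := by
    refine dvd_b' hN b' (NeZero.ne (2 * L)) h0c h0N (s := s * PowerSeries.C ((c0.num : ℤ) : ℂ)) (Oser.mul_mem hs (C_mem _)) ?_ ?_
    · refine mul_ne_zero hs0 ?_
      rw [Ne, map_eq_zero_iff _ PowerSeries.C_injective]
      exact_mod_cast Rat.num_ne_zero.mpr hc0n
    · have e3 : PowerSeries.map (algebraMap ℚ ℂ) h0 * PowerSeries.C ((c0.num : ℤ) : ℂ) =
          PowerSeries.C ((c0.den : ℤ) : ℂ) * PowerSeries.map (algebraMap ℚ ℂ) p * PowerSeries.map (Int.castRingHom ℂ) P := by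
        rw [hh0, map_mul, map_mul, map_UU', PowerSeries.map_C]
        have : PowerSeries.C (algebraMap ℚ ℂ c0⁻¹) * PowerSeries.C ((c0.num : ℤ) : ℂ) = PowerSeries.C ((c0.den : ℤ) : ℂ) := by
          rw [← map_mul]
          congr 1
          have : c0⁻¹ * c0.num = c0.den := by
            rw [inv_mul_eq_iff_eq_mul₀ hc0n, Rat.mul_den_eq_num]
          have h2 : ((c0⁻¹ * c0.num : ℚ) : ℂ) = ((c0.den : ℚ) : ℂ) := by rw [this]
          simpa using h2
        rw [← this]; ring
      have e4 : PowerSeries.expand (2 * L) (NeZero.ne (2 * L)) (PowerSeries.map (algebraMap ℚ ℂ) h0) * (s * PowerSeries.C ((c0.num : ℤ) : ℂ)) =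
          PowerSeries.C ((c0.den : ℤ) : ℂ) * PowerSeries.expand (2 * L) (NeZero.ne (2 * L)) (PowerSeries.map (Int.castRingHom ℂ) P) *
          (PowerSeries.expand (2 * L) (NeZero.ne (2 * L)) (PowerSeries.map (algebraMap ℚ ℂ) p) * s) := by
        have := congrArg (PowerSeries.expand (2 * L) (NeZero.ne (2 * L))) e3
        rw [map_mul, map_mul, map_mul, PowerSeries.expand_C, PowerSeries.expand_C] at this
        linear_combination s * this
      rw [e4]
      exact Oser.mul_mem (Oser.mul_mem (C_mem _) (expand_mem_Oser _ (map_int_mem _))) hsO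
  choose a' ha' using hdvd
  have hba : ∀ r, b r = N * ((a' r : ℤ) - t) := by
    intro r
    have h1 := hb' r
    rw [ha' r] at h1
    push_cast at h1
    linarith
  have hNz : (N : ℤ) ≠ 0 := by exact_mod_cast hN.ne'
  refine ⟨fun r => (a' r : ℤ) - t, ?_, ?_, ?_, c0, hc0n, ?_⟩
  · have := hba 0
    rw [hb0] at this
    rcases mul_eq_zero.mp this.symm with h | h
    · exact absurd h hNz
    · exact h
  · intro r
    have := hbe r
    rw [hba, hba] at this
    exact mul_left_cancel₀ hNz this
  · refine mul_left_cancel₀ hNz ?_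
    rw [Finset.mul_sum]
    rw [show (N : ℤ) * (24 * n 1) = 24 * (N * n 1) by ring, ← hbo]
    refine Finset.sum_congr rfl fun r _ => ?_
    rw [hba]; ring
  · intro z
    have h5 : h0 = PowerSeries.map (Int.castRingHom ℚ) (∏ r, UU r ^ a' r) := by
      refine eq_of_pow_eq hN h0c (by rw [cc_map, cc_UU]; simp) ?_
      rw [h0N, ← map_pow, ← Finset.prod_pow]
      congr 1
      refine Finset.prod_congr rfl fun r _ => ?_
      rw [ha', mul_comm, pow_mul]
    have h6 : p * PowerSeries.map (Int.castRingHom ℚ) P = PowerSeries.C c0 * PowerSeries.map (Int.castRingHom ℚ) (∏ r, UU r ^ a' r) := by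
      rw [← h5, hh0, ← mul_assoc, ← map_mul, mul_inv_cancel₀ hc0n, map_one, one_mul]
    have h7 := congrArg (PowerSeries.map (algebraMap ℚ ℂ)) h6
    rw [map_mul, map_mul, map_UU', map_UU', PowerSeries.map_C] at h7
    have h8 := (HasPS.C (algebraMap ℚ ℂ c0)).mul (hasPS_UU a') (L := 1)
    have h9 := hPS1 z
    rw [h7] at h9
    have h10 := HasSum.unique h9 (h8 z)
    have hne : ∏ r : ZMod L, qp L r z ^ t ≠ 0 := Finset.prod_ne_zero_iff.mpr fun r _ => pow_ne_zero _ (qp_ne_zero r z)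
    refine mul_right_cancel₀ hne (h10.trans ?_)
    rw [mul_assoc, ← Finset.prod_mul_distrib]
    refine congrArg₂ (· * ·) rfl (Finset.prod_congr rfl fun r _ => ?_)
    have hq := qp_ne_zero r z
    rw [← zpow_natCast, ← zpow_natCast, ← zpow_add₀ hq]
    congr 1
    ring

end SU

namespace SU
set_option linter.unusedSectionVars false
variable {L : ℕ} [NeZero L]
open ModularGroup

lemma tprod_rl (r : ℤ) (z : ℍ) : (∏' n : {n : ℤ // 0 < n ∧ n ≡ r [ZMOD (L : ℤ)]},
      (1 - Complex.exp (2 * (π : ℂ) * Complex.I * ((n : ℤ) : ℂ) * (z : ℂ)))⁻¹) = (qp L (r : ZMod L) z)⁻¹ := by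
  have h1 := (multipliable_c (norm_cc_le (r : ZMod L) (w := (1 : ℂ)) (by simp)) (norm_QQ_lt one_pos z)).tprod_inv₀ (qp_ne_zero (r : ZMod L) z)
  unfold qp
  rw [← h1]
  have hinj : Function.Injective (fun n : {n : ℤ // 0 < n ∧ n ≡ r [ZMOD (L : ℤ)]} => ((n : ℤ) - 1).toNat) := by
    rintro ⟨n, hn, _⟩ ⟨m, hm, _⟩ h
    simp only at h
    rw [Subtype.mk_eq_mk]
    omega
  rw [← hinj.tprod_eq]
  · refine tprod_congr ?_
    rintro ⟨n, hn, hr⟩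
    simp only
    obtain ⟨k, rfl⟩ : ∃ k : ℕ, n = k + 1 := ⟨(n - 1).toNat, by omega⟩
    have e : ((k : ℤ) + 1 - 1).toNat = k := by omega
    rw [e]
    have hc : cc (r : ZMod L) (1 : ℂ) k = 1 := by
      unfold cc
      rw [if_pos]
      have := (ZMod.intCast_eq_intCast_iff _ _ _).mpr hr
      rw [← this]; push_cast; rfl
    rw [hc, one_mul, QQ_one, ee_pow, ee]
    congr 3
    push_cast; ring
  · intro k hk
    have hc : ((k + 1 : ℕ) : ZMod L) = (r : ZMod L) := by
      by_contra hne
      apply hk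
      have hz : cc (r : ZMod L) (1 : ℂ) k = 0 := by unfold cc; rw [if_neg hne]
      simp only [hz]; simp
    refine ⟨⟨(k : ℤ) + 1, by omega, ?_⟩, ?_⟩
    · rw [← ZMod.intCast_eq_intCast_iff, ← hc]; push_cast; rfl
    · simp

lemma rl_eq (r : ℤ) (z : ℍ) : rl L r z = ee ((-((L : ℝ) * bern ((r : ℝ) / (L : ℝ)) / 2) : ℝ) * z) * (qp L (r : ZMod L) z)⁻¹ * (qp L (-(r : ZMod L)) z)⁻¹ := by
  have h := tprod_rl (L := L) (-r) z
  rw [Int.cast_neg] at h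
  unfold rl
  rw [tprod_rl, h, ee, Int.cast_natCast]
  rw [mul_assoc (2 * (π : ℂ) * Complex.I)]

lemma qp_split (s : ZMod L) (z : ℍ) : qp L s z = qp (2 * L) ((s.val : ℕ) : ZMod (2 * L)) z * qp (2 * L) ((s.val + L : ℕ) : ZMod (2 * L)) z := by
  unfold qp
  rw [← Multipliable.tprod_mul (multipliable_c (norm_cc_le _ (by simp)) (norm_QQ_lt one_pos z)) (multipliable_c (norm_cc_le _ (by simp)) (norm_QQ_lt one_pos z))]
  refine tprod_congr fun n => ?_
  have hL := Lpos (L := L)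
  unfold cc
  have hs := ZMod.val_lt s
  have i0 : ((n + 1 : ℕ) : ZMod L) = s ↔ (n + 1) % L = s.val := by
    conv_lhs => rw [← val_cast s]
    rw [ZMod.natCast_eq_natCast_iff']
    rw [Nat.mod_eq_of_lt hs]
  have i1 : ((n + 1 : ℕ) : ZMod (2 * L)) = ((s.val : ℕ) : ZMod (2 * L)) ↔ (n + 1) % (2 * L) = s.val := by
    rw [ZMod.natCast_eq_natCast_iff', Nat.mod_eq_of_lt (b := 2 * L) (a := s.val) (by omega)]
  have i2 : ((n + 1 : ℕ) : ZMod (2 * L)) = ((s.val + L : ℕ) : ZMod (2 * L)) ↔ (n + 1) % (2 * L) = s.val + L := by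
    rw [ZMod.natCast_eq_natCast_iff', Nat.mod_eq_of_lt (b := 2 * L) (a := s.val + L) (by omega)]
  simp only [i0, i1, i2]
  have e : (n + 1) % L = (n + 1) % (2 * L) % L := by rw [Nat.mod_mod_of_dvd _ (Dvd.intro_left 2 rfl)]
  have hlt : (n + 1) % (2 * L) < 2 * L := Nat.mod_lt _ (by omega)
  rw [e]
  generalize (n + 1) % (2 * L) = m at *
  by_cases hm : m < L
  · rw [Nat.mod_eq_of_lt hm]
    have : ¬ m = s.val + L := by omega
    simp [this]
  · have : ¬ m = s.val := by omega
    have h2 : m % L = m - L := by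
      rw [Nat.mod_eq_sub_mod (by omega), Nat.mod_eq_of_lt (by omega)]
    have h3 : m - L = s.val ↔ m = s.val + L := by omega
    simp [this, h2, h3]

lemma prod_ZMod (φ : ZMod L → ℂ) : ∏ s, φ s = ∏ r ∈ Finset.range L, φ ((r : ℕ) : ZMod L) := by
  refine Finset.prod_nbij' (fun s => s.val) (fun r => ((r : ℕ) : ZMod L)) ?_ ?_ ?_ ?_ ?_
  · intro s _; exact Finset.mem_range.mpr (ZMod.val_lt s)
  · intro r _; exact Finset.mem_univ _
  · intro s _; simp
  · intro r hr; exact ZMod.val_cast_of_lt (Finset.mem_range.mp hr)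
  · intro s _; simp

lemma prod_ZMod_Icc (φ : ZMod L → ℂ) (h0 : φ 0 = 1) : ∏ s, φ s = ∏ r ∈ Finset.Icc 1 L, φ ((r : ℕ) : ZMod L) := by
  rw [prod_ZMod, Finset.prod_range_eq_mul_Ico _ Lpos, ← Finset.Ico_succ_right_eq_Icc, Order.succ_eq_add_one, Finset.prod_Ico_succ_top Lpos]
  simp [h0]

lemma prod_ZMod_odd (φ : ZMod L → ℂ) (h0 : φ 0 = 1) (hL : Odd L) :
    ∏ s, φ s = ∏ r ∈ Finset.Icc 1 (L / 2), (φ ((r : ℕ) : ZMod L) * φ (-((r : ℕ) : ZMod L))) := by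
  obtain ⟨k, hk⟩ := hL
  have e : L / 2 = k := by omega
  rw [prod_ZMod, Finset.prod_range_eq_mul_Ico _ Lpos, e, Nat.cast_zero, h0, one_mul, Finset.prod_mul_distrib,
    ← Finset.prod_Ico_consecutive _ (by omega : 1 ≤ k + 1) (by omega : k + 1 ≤ L), ← Finset.Ico_succ_right_eq_Icc, Order.succ_eq_add_one]
  congr 1
  refine Finset.prod_nbij' (fun r => L - r) (fun r => L - r) ?_ ?_ ?_ ?_ ?_
  · intro r hr; rw [Finset.mem_Ico] at *; omega
  · intro r hr; rw [Finset.mem_Ico] at *; omega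
  · intro r hr; rw [Finset.mem_Ico] at *; omega
  · intro r hr; rw [Finset.mem_Ico] at *; omega
  · intro r hr; rw [Finset.mem_Ico] at *
    rw [Nat.cast_sub (by omega)]; simp

section
variable {f : ℍ → ℂ} {n1 : ℤ} {a : ZMod L → ℤ} {γ : ℚ} (ha0 : a 0 = 0) (hae : ∀ r, a (-r) = a r)
  (hao : ∑ r, a r * oo r = 24 * n1) (h : ∀ z, f z * QQ L z ^ (-n1) = γ * ∏ r, qp L r z ^ a r)

include hao h in
lemma f_eq (z : ℍ) : f z = γ * ∏ s, (ee ((oo s : ℂ) / (24 * L) * z) * qp L s z) ^ a s := by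
  have hL : (L : ℂ) ≠ 0 := Lne
  simp_rw [mul_zpow, Finset.prod_mul_distrib]
  have e1 : ∏ s : ZMod L, ee ((oo s : ℂ) / (24 * L) * z) ^ a s = QQ L z ^ n1 := by
    have e2 : ∀ s : ZMod L, ee ((oo s : ℂ) / (24 * L) * z) ^ a s = ee ((z : ℂ) / (24 * L)) ^ (a s * oo s) := by
      intro s
      rw [ee_zpow, ee_zpow]; congr 1; push_cast; ring
    simp_rw [e2]
    rw [prod_zpow_sum _ (ee_ne_zero _), hao, QQ, ee_zpow, ee_zpow]
    congr 1; push_cast; field_simp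
  rw [e1, mul_left_comm, ← h z, mul_left_comm, ← zpow_add₀ (QQ_ne_zero L z)]
  simp

lemma bern_of {x : ℝ} (h0 : 0 ≤ x) (h1 : x < 1) : bern x = x ^ 2 - x + 1 / 6 := by
  unfold bern; rw [Int.fract_eq_self.mpr ⟨h0, h1⟩]

include ha0 hae hao h in
lemma final_odd (hL : Odd L) : MemE L (fun z => ∏ s, (ee ((oo s : ℂ) / (24 * L) * z) * qp L s z) ^ a s) := by
  refine ⟨fun r => -a ((r : ℕ) : ZMod L), fun z => ?_⟩
  have hLc : (L : ℂ) ≠ 0 := Lne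
  have hLp := Lpos (L := L)
  simp only []
  rw [prod_ZMod_odd _ (by simp [ha0]) hL]
  refine Finset.prod_congr rfl fun r hr => ?_
  rw [Finset.mem_Icc] at hr
  rw [hae, ← mul_zpow, oo_neg, rl_eq, _root_.zpow_neg, ← _root_.inv_zpow]
  congr 1
  have hr2 : (r : ℤ) < L := by omega
  have hb : bern (((r : ℤ) : ℝ) / (L : ℝ)) = ((r : ℝ) / L) ^ 2 - r / L + 1 / 6 := by
    have hLr : (0 : ℝ) < L := by exact_mod_cast hLp
    rw [bern_of (by positivity) (by rw [div_lt_one hLr]; exact_mod_cast hr2)]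
    simp
  have hv : ((r : ℕ) : ZMod L).val = r := ZMod.val_cast_of_lt (by omega)
  rw [hb, mul_inv, mul_inv, inv_inv, inv_inv, ← ee_neg]
  rw [show ee (-((-((L : ℝ) * (((r : ℝ) / L) ^ 2 - r / L + 1 / 6) / 2) : ℝ) * (z : ℂ))) = ee ((oo ((r : ℕ) : ZMod L) : ℂ) / (24 * L) * z) * ee ((oo ((r : ℕ) : ZMod L) : ℂ) / (24 * L) * z) by
    rw [← ee_add]
    congr 1
    unfold oo
    rw [hv]
    push_cast
    field_simp
    ring]
  simp only [Int.cast_natCast]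
  ring

include ha0 hae hao h in
lemma final_gen : MemE (2 * L) (fun z => ∏ s, (ee ((oo s : ℂ) / (24 * L) * z) * qp L s z) ^ a s) := by
  refine ⟨fun r => -a ((r : ℕ) : ZMod L), fun z => ?_⟩
  have hLc : (L : ℂ) ≠ 0 := Lne
  have hLp := Lpos (L := L)
  have : NeZero (2 * L) := ⟨by omega⟩
  let K : ZMod L → ℂ := fun s => ee (((oo s : ℂ) / (24 * L) - (s.val : ℂ) / 8) * z) * qp (2 * L) ((s.val : ℕ) : ZMod (2 * L)) z
  let G : ZMod L → ℂ := fun s => ee ((s.val : ℂ) / 8 * z) * qp (2 * L) ((s.val + L : ℕ) : ZMod (2 * L)) z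
  have e1 : ∏ s, (ee ((oo s : ℂ) / (24 * L) * z) * qp L s z) ^ a s = ∏ s, (K s * G (-s)) ^ a s := by
    have e2 : ∀ s : ZMod L, ee ((oo s : ℂ) / (24 * L) * z) * qp L s z = K s * G s := by
      intro s
      simp only [K, G]
      rw [qp_split s z, sub_mul, ee_sub]
      have := ee_ne_zero ((s.val : ℂ) / 8 * z)
      generalize ee ((s.val : ℂ) / 8 * z) = E1 at *
      field_simp
    simp_rw [e2, mul_zpow, Finset.prod_mul_distrib]
    congr 1
    rw [← Equiv.prod_comp (Equiv.neg (ZMod L))]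
    refine Finset.prod_congr rfl fun s _ => ?_
    simp [hae]
  simp only []
  rw [e1, prod_ZMod_Icc _ (by simp [ha0]), Nat.mul_div_cancel_left _ (by norm_num : 0 < 2)]
  refine Finset.prod_congr rfl fun r hr => ?_
  rw [Finset.mem_Icc] at hr
  rcases hr.2.eq_or_lt with rfl | hlt
  · simp [ha0]
  have hv : ((r : ℕ) : ZMod L).val = r := ZMod.val_cast_of_lt hlt
  have hne : ((r : ℕ) : ZMod L) ≠ 0 := by
    intro h0; rw [h0, ZMod.val_zero] at hv; omega
  have hvn : (-((r : ℕ) : ZMod L)).val = L - r := by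
    have := NeZero.mk hne
    rw [ZMod.val_neg_of_ne_zero, hv]
  rw [rl_eq, _root_.zpow_neg, ← _root_.inv_zpow]
  congr 1
  have hb : bern (((r : ℤ) : ℝ) / ((2 * L : ℕ) : ℝ)) = ((r : ℝ) / (2 * L)) ^ 2 - r / (2 * L) + 1 / 6 := by
    have hLr : (0 : ℝ) < (2 * L : ℕ) := by exact_mod_cast (by omega : 0 < 2 * L)
    rw [bern_of (by positivity) (by rw [div_lt_one hLr]; exact_mod_cast (by omega : r < 2 * L))]
    push_cast; rfl
  rw [hb, mul_inv, mul_inv, inv_inv, inv_inv, ← ee_neg]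
  simp only [K, G]
  rw [hv, hvn]
  have e3 : ((L - r + L : ℕ) : ZMod (2 * L)) = -(((r : ℤ) : ℤ) : ZMod (2 * L)) := by
    rw [show L - r + L = 2 * L - r by omega, Nat.cast_sub (by omega), ZMod.natCast_self, zero_sub, Int.cast_natCast]
  rw [e3]
  have e4 : ee (-((-(((2 * L : ℕ) : ℝ) * (((r : ℝ) / (2 * L)) ^ 2 - r / (2 * L) + 1 / 6) / 2) : ℝ) * (z : ℂ))) =
      ee (((oo ((r : ℕ) : ZMod L) : ℂ) / (24 * L) - (r : ℂ) / 8) * z) * ee (((L - r : ℕ) : ℂ) / 8 * z) := by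
    rw [← ee_add]
    congr 1
    unfold oo
    rw [hv, Nat.cast_sub hlt.le]
    push_cast
    field_simp
    ring
  rw [e4, Int.cast_natCast]
  ring

end

end SU

/-- A modular unit invariant under `Γ(l)` whose Fourier expansion (after dividing by a suitable
fractional power of `q`) has rational coefficients lies in `ℚ* · E(2l)`, and even
in `ℚ* · E(l)` if `l` is odd. -/
theorem sl2z_invariant_units_stmt0 (l : ℕ) (hl : 1 ≤ l) (f : UpperHalfPlane → ℂ)
    (hf : IsModularUnit f)
    (hinv : ∀ A ∈ CongruenceSubgroup.Gamma l, ∀ z : UpperHalfPlane, f (A • z) = f z)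
    (hexp : ∃ (s : ℚ) (c : ℕ → ℚ), ∀ z : UpperHalfPlane,
      f z * Complex.exp (-(2 * (π : ℂ) * Complex.I * (s : ℂ) * (z : ℂ))) =
        ∑' n : ℕ, (c n : ℂ) * Complex.exp (2 * (π : ℂ) * Complex.I * (n : ℂ) * (z : ℂ))) :
    (∃ (γ : ℚ) (g : UpperHalfPlane → ℂ), γ ≠ 0 ∧ MemE (2 * l) g ∧ f = fun z => (γ : ℂ) * g z) ∧
    (Odd l →
      ∃ (γ : ℚ) (g : UpperHalfPlane → ℂ), γ ≠ 0 ∧ MemE l g ∧ f = fun z => (γ : ℂ) * g z) := by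
  have : NeZero l := ⟨by omega⟩
  obtain ⟨n, hg⟩ := SU.good_of (L := l) hf hinv
  obtain ⟨p, hp⟩ := SU.exists_rexp hg hexp
  obtain ⟨a, ha0, hae, hao, γ, hγ, h⟩ := SU.exists_a hf hg hp
  have hfe := SU.f_eq hao h
  exact ⟨⟨γ, _, hγ, SU.final_gen ha0 hae hao h, funext hfe⟩,
    fun hodd => ⟨γ, _, hγ, SU.final_odd ha0 hae hao h hodd, funext hfe⟩⟩
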